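/- arXiv:1911.05867 — 8 statements merged into one kernel-verified Lean document; each statement's English description precedes it below -/
import Mathlib

section
/- Let d ≥ 2 be an integer and let x ∈ ℝ^d with |x| > 1. Then ∫_{S^{d-1}} |x − θ|^{−d} σ₁(dθ) = |x|^{2−d} / (|x|² − 1). -/
open MeasureTheory Metric Set Real Filter

/-- The uniform probability measure on the unit sphere in `ℝ^d`, viewed as a measure on `ℝ^d`. -/
noncomputable def unifSphere (d : ℕ) : Measure (EuclideanSpace ℝ (Fin d)) :=
  let ν : Measure (EuclideanSpace ℝ (Fin d)) :=
    ((volume : Measure (EuclideanSpace ℝ (Fin d))).toSphere).map Subtype.val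
  (ν Set.univ)⁻¹ • ν

open scoped RealInnerProductSpace Pointwise

theorem hasDerivAt_integral_of_continuousOn_deriv {X : Type*} [TopologicalSpace X]
    [CompactSpace X] [MeasurableSpace X] [OpensMeasurableSpace X] (μ : Measure X) [IsFiniteMeasure μ]
    {U : Set ℝ} (hU : IsOpen U) {F F' : ℝ → X → ℝ} (hF : ∀ u ∈ U, Continuous (F u))
    (hF' : ContinuousOn (fun p : ℝ × X => F' p.1 p.2) (U ×ˢ univ))
    (hd : ∀ u ∈ U, ∀ a, HasDerivAt (fun v => F v a) (F' u a) u) {u : ℝ} (hu : u ∈ U) :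
    HasDerivAt (fun v => ∫ a, F v a ∂μ) (∫ a, F' u a ∂μ) u := by
  obtain ⟨r, hr, hrU⟩ := Metric.nhds_basis_closedBall.mem_iff.1 (hU.mem_nhds hu)
  obtain ⟨C, hC⟩ := ((isCompact_closedBall u r).prod
    (isCompact_univ (X := X))).exists_bound_of_continuousOn (hF'.mono (prod_mono hrU subset_rfl))
  have hcont : Continuous (F' u) := by
    have := hF'.comp (f := fun a : X => (u, a)) (s := univ) (by fun_prop) (fun a _ => ⟨hu, trivial⟩)
    exact continuousOn_univ.1 this
  refine (hasDerivAt_integral_of_dominated_loc_of_deriv_le (bound := fun _ => C)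
    (Metric.closedBall_mem_nhds u hr) ?_ ?_ hcont.aestronglyMeasurable ?_ (integrable_const _) ?_).2
  · filter_upwards [hU.mem_nhds hu] with v hv using (hF v hv).aestronglyMeasurable
  · exact (hF u hu).integrable_of_hasCompactSupport (HasCompactSupport.of_compactSpace _)
  · exact .of_forall fun a v hv => hC (v, a) ⟨hv, trivial⟩
  · exact .of_forall fun a v hv => hd v (hrU hv) a

theorem exists_linearIsometryEquiv_inner_eq {E : Type*} [NormedAddCommGroup E]
    [InnerProductSpace ℝ E] {e w : E} (he : ‖e‖ = 1) (hw : ‖w‖ = 1)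
    (hew : ⟪e, w⟫ = 0) (φ : ℝ) :
    ∃ g : E ≃ₗᵢ[ℝ] E, ∀ θ, ⟪e, g θ⟫ = cos φ * ⟪e, θ⟫ + sin φ * ⟪w, θ⟫ ∧
      ⟪w, g θ⟫ = sin φ * ⟪e, θ⟫ - cos φ * ⟪w, θ⟫ := by
  obtain ⟨ψ, rfl⟩ : ∃ ψ, φ = 2 * ψ := ⟨φ / 2, by ring⟩
  have hee : ⟪e, e⟫ = 1 := by simp [he]
  have hww : ⟪w, w⟫ = 1 := by simp [hw]
  have hwe : ⟪w, e⟫ = 0 := by rw [real_inner_comm, hew]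
  have hcs := sin_sq_add_cos_sq ψ
  have hv : ‖sin ψ • e - cos ψ • w‖ ^ 2 = 1 := by
    rw [← real_inner_self_eq_norm_sq]
    simp only [inner_sub_left, inner_sub_right, real_inner_smul_left, real_inner_smul_right,
      hee, hww, hwe, hew]
    linear_combination hcs
  refine ⟨(ℝ ∙ (sin ψ • e - cos ψ • w))ᗮ.reflection, fun θ => ?_⟩
  rw [Submodule.reflection_orthogonal]
  simp only [LinearIsometryEquiv.trans_apply, LinearIsometryEquiv.coe_neg,
    Submodule.reflection_singleton_apply, RCLike.ofReal_real_eq_id, id, hv, div_one,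
    inner_neg_right, inner_sub_left, inner_sub_right, real_inner_smul_left, real_inner_smul_right,
    hee, hww, hwe, hew, two_smul, inner_add_right, cos_two_mul, sin_two_mul]
  constructor
  · linear_combination (-2 * ⟪e, θ⟫) * hcs
  · ring

section Sphere

variable {E : Type*} [NormedAddCommGroup E] [InnerProductSpace ℝ E] [FiniteDimensional ℝ E]
  [MeasurableSpace E] [BorelSpace E]

theorem integral_toSphere_comp_linearIsometryEquiv (g : E ≃ₗᵢ[ℝ] E) (F : E → ℝ) :
    ∫ θ : sphere (0 : E) 1, F (g θ) ∂(volume : Measure E).toSphere =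
      ∫ θ : sphere (0 : E) 1, F θ ∂(volume : Measure E).toSphere := by
  let G : sphere (0 : E) 1 ≃ₜ sphere (0 : E) 1 := g.toHomeomorph.subtype (by simp)
  have hG : MeasurePreserving G (volume : Measure E).toSphere (volume : Measure E).toSphere := by
    refine ⟨G.measurable, ?_⟩
    ext s hs
    rw [Measure.map_apply G.measurable hs, Measure.toSphere_apply' _ (G.measurable hs),
      Measure.toSphere_apply' _ hs]
    congr 1
    rw [← g.measurePreserving.measure_preimage_emb g.toHomeomorph.measurableEmbedding
      (Ioo (0 : ℝ) 1 • (((↑) : sphere (0 : E) 1 → E) '' s))]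
    congr 1
    ext y
    simp only [Set.mem_smul, mem_image, mem_preimage, Subtype.exists]
    constructor
    · rintro ⟨c, hc, _, ⟨z, hz, h, rfl⟩, rfl⟩
      exact ⟨c, hc, g z, ⟨g z, by simpa using hz, h, rfl⟩, by simp⟩
    · rintro ⟨c, hc, _, ⟨z, hz, h, rfl⟩, hy⟩
      refine ⟨c, hc, g.symm z, ⟨g.symm z, by simpa using hz, ?_, rfl⟩, ?_⟩
      · convert h using 1
        exact Subtype.ext (g.apply_symm_apply z)
      · apply g.injective
        simpa using hy
  exact hG.integral_comp G.measurableEmbedding (fun θ => F θ)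

theorem integral_toSphere_rotation {e w : E} (he : ‖e‖ = 1) (hw : ‖w‖ = 1) (hew : ⟪e, w⟫ = 0)
    {f f' : ℝ → ℝ} (hf' : ContinuousOn f' (Icc (-1) 1))
    (hf : ∀ t ∈ Icc (-1 : ℝ) 1, HasDerivAt f (f' t) t) :
    ∫ θ : sphere (0 : E) 1, (f' ⟪e, θ⟫ * ⟪w, (θ : E)⟫ ^ 2 - ⟪e, (θ : E)⟫ * f ⟪e, θ⟫)
      ∂(volume : Measure E).toSphere = 0 := by
  have hfc : ContinuousOn f (Icc (-1) 1) := fun t ht => (hf t ht).continuousAt.continuousWithinAt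
  have hmem (φ : ℝ) (θ : sphere (0 : E) 1) :
      cos φ * ⟪e, (θ : E)⟫ + sin φ * ⟪w, (θ : E)⟫ ∈ Icc (-1 : ℝ) 1 := by
    obtain ⟨g, hg⟩ := exists_linearIsometryEquiv_inner_eq he hw hew φ
    rw [← (hg θ).1, mem_Icc, ← abs_le]
    simpa [he] using abs_real_inner_le_norm e (g θ)
  have key := hasDerivAt_integral_of_continuousOn_deriv (volume : Measure E).toSphere isOpen_univ
    (F := fun φ θ => f (cos φ * ⟪e, (θ : E)⟫ + sin φ * ⟪w, (θ : E)⟫) *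
      (sin φ * ⟪e, (θ : E)⟫ - cos φ * ⟪w, (θ : E)⟫))
    (F' := fun φ θ => (f' (cos φ * ⟪e, (θ : E)⟫ + sin φ * ⟪w, (θ : E)⟫) *
      (-sin φ * ⟪e, (θ : E)⟫ + cos φ * ⟪w, (θ : E)⟫)) *
      (sin φ * ⟪e, (θ : E)⟫ - cos φ * ⟪w, (θ : E)⟫) +
      f (cos φ * ⟪e, (θ : E)⟫ + sin φ * ⟪w, (θ : E)⟫) *
      (cos φ * ⟪e, (θ : E)⟫ - -sin φ * ⟪w, (θ : E)⟫))
    (fun φ _ => (hfc.comp_continuous (by fun_prop) (hmem φ)).mul (by fun_prop))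
    (by
      refine Continuous.continuousOn (.add (.mul (.mul ?_ ?_) ?_) (.mul ?_ ?_))
      · exact hf'.comp_continuous (by fun_prop) (fun p => hmem p.1 p.2)
      · fun_prop
      · fun_prop
      · exact hfc.comp_continuous (by fun_prop) (fun p => hmem p.1 p.2)
      · fun_prop)
    (fun φ _ θ => by
      have h1 := ((hasDerivAt_cos φ).mul_const ⟪e, (θ : E)⟫).add
        ((hasDerivAt_sin φ).mul_const ⟪w, (θ : E)⟫)
      have h2 := ((hasDerivAt_sin φ).mul_const ⟪e, (θ : E)⟫).sub
        ((hasDerivAt_cos φ).mul_const ⟪w, (θ : E)⟫)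
      exact ((hf _ (hmem φ θ)).comp φ h1).mul h2)
    (mem_univ 0)
  have hconst : (fun φ : ℝ => ∫ θ : sphere (0 : E) 1,
      f (cos φ * ⟪e, (θ : E)⟫ + sin φ * ⟪w, (θ : E)⟫) *
      (sin φ * ⟪e, (θ : E)⟫ - cos φ * ⟪w, (θ : E)⟫) ∂(volume : Measure E).toSphere) =
      fun _ => ∫ θ : sphere (0 : E) 1, f ⟪e, θ⟫ * ⟪w, (θ : E)⟫ ∂(volume : Measure E).toSphere := by
    funext φ
    obtain ⟨g, hg⟩ := exists_linearIsometryEquiv_inner_eq he hw hew φ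
    rw [← integral_toSphere_comp_linearIsometryEquiv g (fun θ => f ⟪e, θ⟫ * ⟪w, θ⟫)]
    simp_rw [hg]
  rw [hconst] at key
  have h0 := key.unique (hasDerivAt_const _ _)
  rw [← neg_eq_zero, ← integral_neg, ← h0]
  congr 1
  funext θ
  simp
  ring

theorem integral_toSphere_zonal {e : E} (he : ‖e‖ = 1)
    {f f' : ℝ → ℝ} (hf' : ContinuousOn f' (Icc (-1) 1))
    (hf : ∀ t ∈ Icc (-1 : ℝ) 1, HasDerivAt f (f' t) t) :
    ∫ θ : sphere (0 : E) 1, ((1 - ⟪e, (θ : E)⟫ ^ 2) * f' ⟪e, θ⟫ -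
      (Module.finrank ℝ E - 1) * (⟪e, (θ : E)⟫ * f ⟪e, θ⟫)) ∂(volume : Measure E).toSphere = 0 := by
  classical
  have hfc : ContinuousOn f (Icc (-1) 1) := fun t ht => (hf t ht).continuousAt.continuousWithinAt
  have hmem (θ : sphere (0 : E) 1) : ⟪e, (θ : E)⟫ ∈ Icc (-1 : ℝ) 1 := by
    rw [mem_Icc, ← abs_le]
    simpa [he] using abs_real_inner_le_norm e θ
  have horth : Orthonormal ℝ ((↑) : ({e} : Set E) → E) := by
    rw [orthonormal_subtype_iff_ite]
    rintro v rfl w rfl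
    simp [he]
  obtain ⟨u, b, hub, hb⟩ := horth.exists_orthonormalBasis_extension
  have heu : e ∈ u := hub rfl
  have hbo := b.orthonormal
  rw [hb, orthonormal_subtype_iff_ite] at hbo
  have hcard : (u.erase e).card = (Module.finrank ℝ E : ℝ) - 1 := by
    rw [Finset.card_erase_of_mem heu, Nat.cast_pred (Finset.card_pos.2 ⟨e, heu⟩),
      Module.finrank_eq_card_basis b.toBasis, Fintype.card_coe]
  have hsum (θ : sphere (0 : E) 1) : ∑ w ∈ u.erase e, ⟪w, (θ : E)⟫ ^ 2 = 1 - ⟪e, (θ : E)⟫ ^ 2 := by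
    have h := b.sum_sq_norm_inner_right (θ : E)
    simp only [hb, norm_eq_of_mem_sphere, Real.norm_eq_abs, sq_abs] at h
    rw [Finset.sum_coe_sort u (fun w => ⟪w, (θ : E)⟫ ^ 2), ← Finset.add_sum_erase _ _ heu] at h
    linarith
  have hrot : ∑ w ∈ u.erase e, ∫ θ : sphere (0 : E) 1, (f' ⟪e, θ⟫ * ⟪w, (θ : E)⟫ ^ 2 -
      ⟪e, (θ : E)⟫ * f ⟪e, θ⟫) ∂(volume : Measure E).toSphere = 0 := by
    refine Finset.sum_eq_zero fun w hw => integral_toSphere_rotation he ?_ ?_ hf' hf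
    · have := hbo w (Finset.mem_of_mem_erase hw) w (Finset.mem_of_mem_erase hw)
      rwa [if_pos rfl, real_inner_self_eq_norm_sq,
        pow_eq_one_iff_of_nonneg (norm_nonneg w) two_ne_zero] at this
    · have := hbo e heu w (Finset.mem_of_mem_erase hw)
      rwa [if_neg (Finset.ne_of_mem_erase hw).symm] at this
  rw [← integral_finsetSum] at hrot
  · rw [← hrot]
    congr 1
    funext θ
    rw [Finset.sum_sub_distrib, ← Finset.mul_sum, hsum, Finset.sum_const, nsmul_eq_mul, hcard]
    ring
  · intro w _
    refine Continuous.integrable_of_hasCompactSupport (.sub (.mul ?_ (by fun_prop))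
      (.mul (by fun_prop) ?_)) (HasCompactSupport.of_compactSpace _)
    · exact hf'.comp_continuous (by fun_prop) hmem
    · exact hfc.comp_continuous (by fun_prop) hmem

end Sphere

theorem one_sub_two_mul_add_sq_pos {u t : ℝ} (hu : u ∈ Ioo (-1 : ℝ) 1) (ht : t ∈ Icc (-1 : ℝ) 1) :
    0 < 1 - 2 * u * t + u ^ 2 := by
  obtain ⟨h1, h2⟩ := hu
  obtain ⟨h3, h4⟩ := ht
  nlinarith [mul_pos (sub_pos.2 h1) (sub_pos.2 h2), sq_nonneg (u - t),
    mul_nonneg (sub_nonneg.2 h3) (sub_nonneg.2 h4)]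

/-- The Poisson integral identity for a law on `[-1, 1]` satisfying the integration by parts formula
of the zonal marginal of the uniform measure on the sphere of `ℝ^(m+2)`. -/
theorem integral_rpow_of_zonal {X : Type*} [TopologicalSpace X] [CompactSpace X]
    [MeasurableSpace X] [OpensMeasurableSpace X] (μ : Measure X) [IsFiniteMeasure μ]
    {t : X → ℝ} (htc : Continuous t) (ht : ∀ a, t a ∈ Icc (-1 : ℝ) 1) (m : ℕ)
    (hz : ∀ f f' : ℝ → ℝ, ContinuousOn f' (Icc (-1) 1) →
      (∀ s ∈ Icc (-1 : ℝ) 1, HasDerivAt f (f' s) s) →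
      ∫ a, ((1 - t a ^ 2) * f' (t a) - (m + 1) * (t a * f (t a))) ∂μ = 0)
    {u : ℝ} (hu : u ∈ Ioo (0 : ℝ) 1) :
    ∫ a, (1 - 2 * u * t a + u ^ 2) ^ (-((m + 2 : ℝ) / 2)) ∂μ = μ.real univ / (1 - u ^ 2) := by
  set p : ℝ := (m + 2 : ℝ) / 2 with hp
  have hpos {v : ℝ} (hv : v ∈ Ioo (-1 : ℝ) 1) (a : X) : 0 < 1 - 2 * v * t a + v ^ 2 :=
    one_sub_two_mul_add_sq_pos hv (ht a)
  have hcont {v : ℝ} (hv : v ∈ Ioo (-1 : ℝ) 1) (r : ℝ) :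
      Continuous fun a => (1 - 2 * v * t a + v ^ 2) ^ r :=
    Continuous.rpow_const (by fun_prop) fun a => .inl (hpos hv a).ne'
  have hcont2 (r : ℝ) : ContinuousOn (fun q : ℝ × X => (1 - 2 * q.1 * t q.2 + q.1 ^ 2) ^ r)
      (Ioo (-1) 1 ×ˢ univ) :=
    ContinuousOn.rpow_const (by fun_prop) fun q hq => .inl (hpos hq.1 q.2).ne'
  have hderiv (r : ℝ) {v : ℝ} (hv : v ∈ Ioo (-1 : ℝ) 1) (a : X) :
      HasDerivAt (fun v => (1 - 2 * v * t a + v ^ 2) ^ r)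
        ((2 * (v - t a)) * r * (1 - 2 * v * t a + v ^ 2) ^ (r - 1)) v := by
    have h : HasDerivAt (fun v => 1 - 2 * v * t a + v ^ 2) (2 * (v - t a)) v := by
      have := ((((hasDerivAt_id v).const_mul 2).mul_const (t a)).const_sub 1).add
        ((hasDerivAt_id v).pow 2)
      refine this.congr_deriv ?_
      simp
      ring
    exact h.rpow_const (.inl (hpos hv a).ne')
  have hstep (r : ℝ) {v : ℝ} (hv : v ∈ Ioo (-1 : ℝ) 1) (a : X) :
      (1 - 2 * v * t a + v ^ 2) ^ r =
        (1 - 2 * v * t a + v ^ 2) * (1 - 2 * v * t a + v ^ 2) ^ (r - 1) := by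
    conv_rhs => rw [mul_comm, ← rpow_add_one (hpos hv a).ne', sub_add_cancel]
  have hint {g : X → ℝ} (hg : Continuous g) : Integrable g μ :=
    hg.integrable_of_hasCompactSupport (HasCompactSupport.of_compactSpace _)
  -- The flux vanishes.
  have hflux {v : ℝ} (hv : v ∈ Ioo (-1 : ℝ) 1) :
      ∫ a, v ^ (m + 1) * ((v - t a) * (1 - 2 * v * t a + v ^ 2) ^ (-p)) ∂μ = 0 := by
    have hD (v : ℝ) (hv : v ∈ Ioo (-1 : ℝ) 1) : HasDerivAt
        (fun v => ∫ a, v ^ (m + 1) * ((v - t a) * (1 - 2 * v * t a + v ^ 2) ^ (-p)) ∂μ) 0 v := by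
      have key := hasDerivAt_integral_of_continuousOn_deriv μ isOpen_Ioo
        (F := fun v a => v ^ (m + 1) * ((v - t a) * (1 - 2 * v * t a + v ^ 2) ^ (-p)))
        (F' := fun v a => ((m + 1 : ℕ) * v ^ m) * ((v - t a) * (1 - 2 * v * t a + v ^ 2) ^ (-p)) +
          v ^ (m + 1) * (1 * (1 - 2 * v * t a + v ^ 2) ^ (-p) + (v - t a) *
            ((2 * (v - t a)) * (-p) * (1 - 2 * v * t a + v ^ 2) ^ (-p - 1))))
        (fun v hv => by have := hcont hv (-p); fun_prop)
        (by have h1 := hcont2 (-p); have h2 := hcont2 (-p - 1); fun_prop)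
        (fun v hv a => ((hasDerivAt_pow (m + 1) v).mul
          (((hasDerivAt_id v).sub_const (t a)).mul (hderiv (-p) hv a))))
        hv
      refine key.congr_deriv ?_
      have hq {s : ℝ} (hs : s ∈ Icc (-1 : ℝ) 1) := one_sub_two_mul_add_sq_pos hv hs
      have hzv := hz (fun s => (1 - 2 * v * s + v ^ 2) ^ (-p))
        (fun s => (-(2 * v)) * (-p) * (1 - 2 * v * s + v ^ 2) ^ (-p - 1))
        (.mul (by fun_prop) (.rpow_const (by fun_prop) fun s hs => .inl (hq hs).ne'))
        (fun s hs => by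
          have h : HasDerivAt (fun s => 1 - 2 * v * s + v ^ 2) (-(2 * v)) s := by
            simpa using (((hasDerivAt_id s).const_mul (2 * v)).const_sub 1).add_const (v ^ 2)
          exact h.rpow_const (.inl (hq hs).ne'))
      rw [← mul_zero (v ^ m), ← hzv, ← integral_const_mul]
      congr 1
      funext a
      rw [hstep (-p) hv a]
      push_cast
      rw [hp]
      ring
    rw [isOpen_Ioo.is_const_of_deriv_eq_zero isPreconnected_Ioo
      (fun v hv => (hD v hv).differentiableAt.differentiableWithinAt)
      (fun v hv => (hD v hv).deriv) hv (show (0 : ℝ) ∈ Ioo (-1 : ℝ) 1 by norm_num)]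
    simp
  have hflux' {v : ℝ} (hv : v ∈ Ioo (-1 : ℝ) 1) :
      ∫ a, (v - t a) * (1 - 2 * v * t a + v ^ 2) ^ (-p) ∂μ = 0 := by
    rcases eq_or_ne v 0 with rfl | h0
    · have h1 := hz (fun _ => 1) (fun _ => 0) continuousOn_const fun s _ => hasDerivAt_const s 1
      simp only [mul_zero, mul_one, zero_sub, integral_neg, integral_const_mul, neg_eq_zero] at h1
      have h2 := (mul_eq_zero.1 h1).resolve_left (by positivity)
      simp [integral_neg, h2]
    · have := hflux hv
      rw [integral_const_mul] at this
      exact (mul_eq_zero.1 this).resolve_left (pow_ne_zero _ h0)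
  -- The mean value property.
  have hmean {v : ℝ} (hv : v ∈ Ioo (-1 : ℝ) 1) :
      ∫ a, (1 - 2 * v * t a + v ^ 2) ^ (1 - p) ∂μ = μ.real univ := by
    have hD (v : ℝ) (hv : v ∈ Ioo (-1 : ℝ) 1) : HasDerivAt
        (fun v => ∫ a, (1 - 2 * v * t a + v ^ 2) ^ (1 - p) ∂μ) 0 v := by
      have key := hasDerivAt_integral_of_continuousOn_deriv μ isOpen_Ioo
        (fun v hv => hcont hv (1 - p))
        (by have h1 := hcont2 (1 - p - 1); fun_prop)
        (fun v hv a => hderiv (1 - p) hv a) hv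
      refine key.congr_deriv ?_
      rw [← mul_zero (2 * (1 - p)), ← hflux' hv, ← integral_const_mul]
      congr 1
      funext a
      rw [show 1 - p - 1 = -p by ring]
      ring
    rw [isOpen_Ioo.is_const_of_deriv_eq_zero isPreconnected_Ioo
      (fun v hv => (hD v hv).differentiableAt.differentiableWithinAt)
      (fun v hv => (hD v hv).deriv) hv (show (0 : ℝ) ∈ Ioo (-1 : ℝ) 1 by norm_num)]
    simp
  have hu' : u ∈ Ioo (-1 : ℝ) 1 := ⟨by linarith [hu.1], hu.2⟩
  have hu2 : 0 < 1 - u ^ 2 := by nlinarith [hu.1, hu.2]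
  rw [eq_div_iff hu2.ne', ← hmean hu', ← sub_eq_zero, ← integral_mul_const,
    ← integral_sub (hint ((hcont hu' _).mul_const _)) (hint (hcont hu' _)),
    ← mul_zero (-(2 * u)), ← hflux' hu', ← integral_const_mul]
  congr 1
  funext a
  rw [hstep (1 - p) hu' a, show 1 - p - 1 = -p by ring]
  ring

/-- For `|x| > 1`, `∫_{S^{d-1}} |x−θ|^{−d} σ₁(dθ) = |x|^{2−d} / (|x|² − 1)`. -/
theorem stmt0 (d : ℕ) (hd : 2 ≤ d) (x : EuclideanSpace ℝ (Fin d)) (hx : 1 < ‖x‖) :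
    ∫ θ, ‖x - θ‖ ^ (-(d : ℝ)) ∂(unifSphere d) = ‖x‖ ^ ((2 : ℝ) - d) / (‖x‖ ^ 2 - 1) := by
  obtain ⟨m, rfl⟩ := Nat.exists_eq_add_of_le' hd
  have hr : 0 < ‖x‖ := by linarith
  set r := ‖x‖ with hrdef
  let E := EuclideanSpace ℝ (Fin (m + 2))
  set e : E := r⁻¹ • x with hedef
  have he : ‖e‖ = 1 := by rw [hedef, norm_smul, norm_inv, norm_norm, ← hrdef, inv_mul_cancel₀ hr.ne']
  have hmem (θ : sphere (0 : E) 1) : inner ℝ e (θ : E) ∈ Icc (-1 : ℝ) 1 := by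
    rw [mem_Icc, ← abs_le]
    simpa [he] using abs_real_inner_le_norm e θ
  have hu : r⁻¹ ∈ Ioo (0 : ℝ) 1 := ⟨inv_pos.2 hr, inv_lt_one_of_one_lt₀ hx⟩
  have key := integral_rpow_of_zonal (volume : Measure E).toSphere
    (t := fun θ => inner ℝ e (θ : E)) (by fun_prop) hmem m
    (fun f f' hf' hf => by
      have h := integral_toSphere_zonal he hf' hf
      rw [finrank_euclideanSpace_fin] at h
      rw [← h]
      congr 1
      funext θ
      push_cast
      ring) hu
  have hnorm (θ : sphere (0 : E) 1) : ‖x - θ‖ ^ (-((m + 2 : ℕ) : ℝ)) =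
      r ^ (-((m + 2 : ℕ) : ℝ)) *
        (1 - 2 * r⁻¹ * inner ℝ e (θ : E) + r⁻¹ ^ 2) ^ (-((m + 2 : ℝ) / 2)) := by
    have hsq : ‖x - θ‖ ^ 2 = r ^ 2 * (1 - 2 * r⁻¹ * inner ℝ e (θ : E) + r⁻¹ ^ 2) := by
      rw [norm_sub_sq_real, norm_eq_of_mem_sphere, hedef, real_inner_smul_left, ← hrdef]
      field_simp
    have hq := one_sub_two_mul_add_sq_pos ⟨by linarith [hu.1], hu.2⟩ (hmem θ)
    have hpow (y : ℝ) (hy : 0 ≤ y) :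
        y ^ (-((m + 2 : ℕ) : ℝ)) = (y ^ 2) ^ (-((m + 2 : ℝ) / 2)) := by
      rw [← rpow_natCast y 2, ← rpow_mul hy]
      congr 1
      push_cast
      ring
    rw [hpow _ (norm_nonneg _), hpow r hr.le, hsq, mul_rpow (by positivity) hq.le]
  have hμ : (volume : Measure E).toSphere.real univ ≠ 0 := by
    rw [Ne, measureReal_eq_zero_iff, Measure.measure_univ_eq_zero]
    have : Nontrivial E := inferInstanceAs (Nontrivial (EuclideanSpace ℝ (Fin (m + 2))))
    exact Measure.toSphere_ne_zero _
  rw [unifSphere]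
  rw [integral_smul_measure, (MeasurableEmbedding.subtype_coe
    isClosed_sphere.measurableSet).integral_map,
    (MeasurableEmbedding.subtype_coe isClosed_sphere.measurableSet).map_apply, preimage_univ]
  simp_rw [hnorm]
  rw [integral_const_mul, key, ENNReal.toReal_inv, ← measureReal_def, smul_eq_mul,
    show (2 : ℝ) - ((m + 2 : ℕ) : ℝ) = -((m + 2 : ℕ) : ℝ) + 2 by ring, rpow_add hr, rpow_two]
  have h1 : r ^ 2 - 1 ≠ 0 := by nlinarith
  have h2 : 1 - r⁻¹ ^ 2 ≠ 0 := by nlinarith [hu.1, hu.2]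
  field_simp
end

section
/- Let d ≥ 2 be an integer and α ∈ (0,2). Define H_{S^{d-1}}(x) = ||x|² − 1|^{α/2} ∫_{S^{d-1}} |θ − x|^{−d} σ₁(dθ) for x ∈ ℝ^d with |x| ≠ 1. Then H_{S^{d-1}}(x) = |x|^{α−d} (1 − |x|^{−2})^{α/2−1} when |x| > 1, and H_{S^{d-1}}(x) = (1 − |x|²)^{α/2−1} when |x| < 1. -/
open MeasureTheory Metric Set Real Filter

lemma one_sub_norm_sq_pos {E : Type*} [NormedAddCommGroup E] {x : E} (hx : ‖x‖ < 1) :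
    0 < 1 - ‖x‖ ^ 2 := by
  nlinarith [norm_nonneg x]

section RadialShift

variable {E : Type*} [NormedAddCommGroup E] [InnerProductSpace ℝ E]

/-- The discriminant of the quadratic equation `‖z + t • x‖ ^ 2 = t ^ 2` in `t`. -/
noncomputable def radialDisc (x z : E) : ℝ :=
  inner ℝ x z ^ 2 + (1 - ‖x‖ ^ 2) * ‖z‖ ^ 2

/-- The positive solution `t` of `‖z + t • x‖ = t`, for `‖x‖ < 1` and `z ≠ 0`. -/
noncomputable def radialRoot (x z : E) : ℝ :=
  (inner ℝ x z + √(radialDisc x z)) / (1 - ‖x‖ ^ 2)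

/-- The derivative of `radialRoot x` at `z`. -/
noncomputable def radialRootDeriv (x z : E) : StrongDual ℝ E :=
  (1 - ‖x‖ ^ 2)⁻¹ • (innerSL ℝ x + (√(radialDisc x z))⁻¹ •
    (inner ℝ x z • innerSL ℝ x + (1 - ‖x‖ ^ 2) • innerSL ℝ z))

lemma abs_inner_lt_sqrt_radialDisc {x z : E} (hx : ‖x‖ < 1) (hz : z ≠ 0) :
    |inner ℝ x z| < √(radialDisc x z) := by
  apply Real.lt_sqrt_of_sq_lt
  rw [sq_abs, radialDisc]
  have := one_sub_norm_sq_pos hx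
  have := norm_pos_iff.2 hz
  have : 0 < (1 - ‖x‖ ^ 2) * ‖z‖ ^ 2 := by positivity
  linarith

lemma radialDisc_pos {x z : E} (hx : ‖x‖ < 1) (hz : z ≠ 0) : 0 < radialDisc x z :=
  Real.sqrt_pos.1 ((abs_nonneg _).trans_lt (abs_inner_lt_sqrt_radialDisc hx hz))

lemma radialRoot_pos {x z : E} (hx : ‖x‖ < 1) (hz : z ≠ 0) : 0 < radialRoot x z := by
  have := neg_abs_le (inner ℝ x z)
  have := abs_inner_lt_sqrt_radialDisc hx hz
  exact div_pos (by linarith) (one_sub_norm_sq_pos hx)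

lemma norm_add_radialRoot_smul {x z : E} (hx : ‖x‖ < 1) (hz : z ≠ 0) :
    ‖z + radialRoot x z • x‖ = radialRoot x z := by
  have hr := radialRoot_pos hx hz
  rw [← sq_eq_sq₀ (norm_nonneg _) hr.le, norm_add_sq_real, norm_smul, inner_smul_right,
    real_inner_comm, mul_pow, Real.norm_eq_abs, sq_abs]
  have h1 := one_sub_norm_sq_pos hx
  have hs := Real.sq_sqrt (radialDisc_pos hx hz).le
  have h2 : (1 - ‖x‖ ^ 2) * radialRoot x z - inner ℝ x z = √(radialDisc x z) := by
    rw [radialRoot]; field_simp; ring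
  rw [← h2, radialDisc] at hs
  have : (1 - ‖x‖ ^ 2) * ((1 - ‖x‖ ^ 2) * radialRoot x z ^ 2 - 2 * radialRoot x z * inner ℝ x z
    - ‖z‖ ^ 2) = 0 := by linear_combination hs
  have := (mul_eq_zero.1 this).resolve_left h1.ne'
  linear_combination -this

lemma radialRoot_sub_norm_smul {x y : E} (hx : ‖x‖ < 1) :
    radialRoot x (y - ‖y‖ • x) = ‖y‖ := by
  have h1 := one_sub_norm_sq_pos hx
  have hd : radialDisc x (y - ‖y‖ • x) = (‖y‖ - inner ℝ x y) ^ 2 := by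
    rw [radialDisc, norm_sub_sq_real, norm_smul, inner_sub_right, inner_smul_right,
      inner_smul_right, real_inner_self_eq_norm_sq, real_inner_comm x y, norm_norm]
    ring
  have h2 : 0 ≤ ‖y‖ - inner ℝ x y := by
    have := real_inner_le_norm x y
    nlinarith [norm_nonneg y]
  rw [radialRoot, hd, Real.sqrt_sq h2, inner_sub_right, inner_smul_right,
    real_inner_self_eq_norm_sq]
  field_simp
  ring

lemma sub_norm_smul_ne_zero {x y : E} (hx : ‖x‖ < 1) (hy : y ≠ 0) : y - ‖y‖ • x ≠ 0 := by
  intro h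
  have h2 := congrArg norm (sub_eq_zero.1 h)
  rw [norm_smul, norm_norm] at h2
  have := norm_pos_iff.2 hy
  nlinarith

lemma hasFDerivAt_radialRoot {x z : E} (hx : ‖x‖ < 1) (hz : z ≠ 0) :
    HasFDerivAt (radialRoot x) (radialRootDeriv x z) z := by
  have hi : HasFDerivAt (fun z ↦ inner ℝ x z) (innerSL ℝ x) z := (innerSL ℝ x).hasFDerivAt
  have hn : HasFDerivAt (fun z : E ↦ ‖z‖ ^ 2) (2 • innerSL ℝ z) z :=
    (hasStrictFDerivAt_norm_sq z).hasFDerivAt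
  have h := ((hi.add (((hi.pow 2).add (hn.const_mul (1 - ‖x‖ ^ 2))).sqrt
    (radialDisc_pos hx hz).ne')).mul_const (1 - ‖x‖ ^ 2)⁻¹)
  refine h.congr_fderiv ?_
  ext v
  have := Real.sqrt_pos.2 (radialDisc_pos hx hz)
  change 0 < √(inner ℝ x z ^ 2 + (1 - ‖x‖ ^ 2) * ‖z‖ ^ 2) at this
  simp [radialRootDeriv, radialDisc]
  field_simp

lemma radialRootDeriv_self (x z : E) (hx : ‖x‖ < 1) :
    1 + radialRootDeriv x z x
      = (1 - ‖x‖ ^ 2)⁻¹ * (1 + inner ℝ x z / √(radialDisc x z)) := by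
  have h1 := one_sub_norm_sq_pos hx
  simp only [radialRootDeriv, smul_apply, add_apply,
    innerSL_apply_apply, smul_eq_mul, real_inner_self_eq_norm_sq, real_inner_comm x z]
  field_simp
  ring

lemma abs_inner_div_sqrt_radialDisc_le {x z : E} (hx : ‖x‖ < 1) :
    |inner ℝ x z / √(radialDisc x z)| ≤ 1 := by
  rcases eq_or_ne z 0 with rfl | hz
  · simp
  rw [abs_div, abs_of_nonneg (Real.sqrt_nonneg _)]
  exact div_le_one_of_le₀ (abs_inner_lt_sqrt_radialDisc hx hz).le (Real.sqrt_nonneg _)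

lemma image_add_radialRoot_smul {x : E} (hx : ‖x‖ < 1) :
    (fun z ↦ z + radialRoot x z • x) '' (ball (0 : E) 1 \ {0})
      = {y | y ≠ 0 ∧ ‖y - ‖y‖ • x‖ < 1} := by
  ext y
  constructor
  · rintro ⟨z, ⟨hz1, hz0⟩, rfl⟩
    have h := norm_add_radialRoot_smul hx hz0
    refine ⟨norm_pos_iff.1 (h ▸ radialRoot_pos hx hz0), ?_⟩
    simpa [h] using hz1
  · rintro ⟨hy0, hy1⟩
    exact ⟨y - ‖y‖ • x, ⟨by simpa using hy1, sub_norm_smul_ne_zero hx hy0⟩,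
      by simp [radialRoot_sub_norm_smul hx]⟩

variable [FiniteDimensional ℝ E] [MeasurableSpace E] [BorelSpace E] (μ : Measure E)
  [μ.IsAddHaarMeasure]

lemma integral_ball_inner_div_sqrt_radialDisc (x : E) :
    ∫ z in ball (0 : E) 1 \ {0}, inner ℝ x z / √(radialDisc x z) ∂μ = 0 := by
  have hs : MeasurableSet (ball (0 : E) 1 \ {0}) := isOpen_ball.measurableSet.diff (by simp)
  rw [← integral_indicator hs]
  set g := (ball (0 : E) 1 \ {0}).indicator fun z ↦ inner ℝ x z / √(radialDisc x z)
  have h := integral_neg_eq_self g μ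
  have hg : ∀ z, g (-z) = -g z := fun z ↦ by
    by_cases hz : z ∈ ball (0 : E) 1 \ {0}
    · have hz' : -z ∈ ball (0 : E) 1 \ {0} := by simpa using hz
      simp [g, indicator_of_mem hz, indicator_of_mem hz', radialDisc, neg_div]
    · have hz' : -z ∉ ball (0 : E) 1 \ {0} := by simpa using hz
      simp [g, indicator_of_notMem hz, indicator_of_notMem hz']
  simp_rw [hg, integral_neg] at h
  linarith

lemma measure_norm_sub_norm_smul_lt [Nontrivial E] {x : E} (hx : ‖x‖ < 1) :
    μ {y | y ≠ 0 ∧ ‖y - ‖y‖ • x‖ < 1} = ENNReal.ofReal (1 - ‖x‖ ^ 2)⁻¹ * μ (ball 0 1) := by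
  have h1 := one_sub_norm_sq_pos hx
  have hs : MeasurableSet (ball (0 : E) 1 \ {0}) := isOpen_ball.measurableSet.diff (by simp)
  have hfin : μ (ball (0 : E) 1 \ {0}) ≠ ⊤ :=
    ((measure_mono sdiff_subset).trans_lt measure_ball_lt_top).ne
  have hinj : InjOn (fun z ↦ z + radialRoot x z • x) (ball (0 : E) 1 \ {0}) := by
    have hl : LeftInvOn (fun y : E ↦ y - ‖y‖ • x) (fun z ↦ z + radialRoot x z • x)
        (ball (0 : E) 1 \ {0}) := fun z hz ↦ by
      simp [norm_add_radialRoot_smul hx hz.2]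
    exact hl.injOn
  have hderiv : ∀ z ∈ ball (0 : E) 1 \ {0}, HasFDerivWithinAt (fun z ↦ z + radialRoot x z • x)
      (ContinuousLinearMap.id ℝ E + (radialRootDeriv x z).smulRight x)
      (ball (0 : E) 1 \ {0}) z := fun z hz ↦
    ((hasFDerivAt_id z).add ((hasFDerivAt_radialRoot hx hz.2).smul_const x)).hasFDerivWithinAt
  have hdet : ∀ z, (ContinuousLinearMap.id ℝ E + (radialRootDeriv x z).smulRight x).det
      = (1 - ‖x‖ ^ 2)⁻¹ * (1 + inner ℝ x z / √(radialDisc x z)) := fun z ↦ by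
    rw [← radialRootDeriv_self x z hx]
    exact LinearMap.transvection.det (radialRootDeriv x z).toLinearMap x
  have hnn : ∀ z, 0 ≤ (1 - ‖x‖ ^ 2)⁻¹ * (1 + inner ℝ x z / √(radialDisc x z)) := fun z ↦ by
    have := (abs_le.1 (abs_inner_div_sqrt_radialDisc_le (z := z) hx)).1
    exact mul_nonneg (inv_nonneg.2 h1.le) (by linarith)
  have hint : IntegrableOn (fun z ↦ inner ℝ x z / √(radialDisc x z)) (ball (0 : E) 1 \ {0}) μ := by
    refine Measure.integrableOn_of_bounded (M := 1) hfin ?_ ?_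
    · unfold radialDisc
      exact (Measurable.aestronglyMeasurable (by fun_prop))
    · exact ae_of_all _ fun z ↦ abs_inner_div_sqrt_radialDisc_le hx
  have hone : IntegrableOn (fun _ : E ↦ (1 : ℝ)) (ball (0 : E) 1 \ {0}) μ :=
    integrableOn_const hfin
  rw [← image_add_radialRoot_smul hx, ← lintegral_abs_det_fderiv_eq_addHaar_image μ hs hderiv hinj]
  simp_rw [hdet, abs_of_nonneg (hnn _)]
  rw [← ofReal_integral_eq_lintegral_ofReal ((Integrable.fun_add hone hint).const_mul _) (ae_of_all _ hnn),
    integral_const_mul, integral_add hone hint, integral_ball_inner_div_sqrt_radialDisc]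
  rw [add_zero, setIntegral_const, smul_eq_mul, mul_one, ENNReal.ofReal_mul (inv_nonneg.2 h1.le),
    ofReal_measureReal hfin]
  rw [measure_sdiff_null (measure_singleton _)]

lemma measure_norm_sub_norm_smul_lt_eq_lintegral [Nontrivial E] {x : E} (hx : ‖x‖ ≠ 1) :
    μ {y | y ≠ 0 ∧ ‖y - ‖y‖ • x‖ < 1} = ∫⁻ θ : sphere (0 : E) 1,
      ENNReal.ofReal (‖(θ : E) - x‖ ^ (-(Module.finrank ℝ E : ℝ)) / Module.finrank ℝ E)
        ∂μ.toSphere := by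
  have hpos : ∀ θ : sphere (0 : E) 1, 0 < ‖(θ : E) - x‖ := fun θ ↦ by
    refine norm_pos_iff.2 (sub_ne_zero.2 fun h ↦ hx ?_)
    simp [← h]
  set S : Set (sphere (0 : E) 1 × Ioi (0 : ℝ)) := {p | (p.2 : ℝ) < ‖(p.1 : E) - x‖⁻¹} with hS
  have hSm : MeasurableSet S := measurableSet_lt (by fun_prop) (by fun_prop)
  have hpre : {y | y ≠ 0 ∧ ‖y - ‖y‖ • x‖ < 1}
      = Subtype.val '' (homeomorphUnitSphereProd E ⁻¹' S) := by
    have key : ∀ y : E, y ≠ 0 → (‖y - ‖y‖ • x‖ < 1 ↔ ‖y‖ < ‖‖y‖⁻¹ • y - x‖⁻¹) := fun y hy ↦ by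
      have hn := norm_pos_iff.2 hy
      have h1 : 0 < ‖‖y‖⁻¹ • y - x‖ := hpos ⟨‖y‖⁻¹ • y, by simp [norm_smul, hn.ne']⟩
      have h2 : y - ‖y‖ • x = ‖y‖ • (‖y‖⁻¹ • y - x) := by
        rw [smul_sub, smul_inv_smul₀ hn.ne']
      rw [h2, norm_smul, norm_norm, lt_inv_comm₀ hn h1, ← one_div, lt_div_iff₀ hn, mul_comm]
    ext y
    constructor
    · rintro ⟨h0, h⟩
      exact ⟨⟨y, h0⟩, by simpa [S] using (key y h0).1 h, rfl⟩
    · rintro ⟨⟨z, h0⟩, h, rfl⟩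
      exact ⟨h0, (key z h0).2 (by simpa [S] using h)⟩
  rw [hpre, ← comap_subtype_coe_apply (measurableSet_singleton _).compl,
    μ.measurePreserving_homeomorphUnitSphereProd.measure_preimage hSm.nullMeasurableSet,
    Measure.prod_apply hSm]
  refine lintegral_congr fun θ ↦ ?_
  have : Prod.mk θ ⁻¹' S = Iio ⟨‖(θ : E) - x‖⁻¹, inv_pos.2 (hpos θ)⟩ := rfl
  rw [this, Measure.volumeIoiPow_apply_Iio]
  have hd : 0 < Module.finrank ℝ E := Module.finrank_pos
  rw [Nat.sub_add_cancel hd, Nat.cast_pred hd, sub_add_cancel, rpow_neg (hpos θ).le,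
    rpow_natCast, inv_pow]

lemma integral_toSphere_norm_sub_rpow_neg_finrank [Nontrivial E] {x : E} (hx : ‖x‖ < 1) :
    ∫ θ : sphere (0 : E) 1, ‖(θ : E) - x‖ ^ (-(Module.finrank ℝ E : ℝ)) ∂μ.toSphere
      = (1 - ‖x‖ ^ 2)⁻¹ * μ.toSphere.real univ := by
  have hd : (Module.finrank ℝ E : ℝ) ≠ 0 := Nat.cast_ne_zero.2 Module.finrank_pos.ne'
  have h : ∫ θ : sphere (0 : E) 1,
      ‖(θ : E) - x‖ ^ (-(Module.finrank ℝ E : ℝ)) / Module.finrank ℝ E ∂μ.toSphere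
      = (1 - ‖x‖ ^ 2)⁻¹ * μ.real (ball 0 1) := by
    rw [integral_eq_lintegral_of_nonneg_ae (ae_of_all _ fun θ ↦ by positivity)
      (Measurable.aestronglyMeasurable (by fun_prop)),
      ← measure_norm_sub_norm_smul_lt_eq_lintegral μ hx.ne, measure_norm_sub_norm_smul_lt μ hx,
      ENNReal.toReal_mul, ENNReal.toReal_ofReal (inv_nonneg.2 (one_sub_norm_sq_pos hx).le),
      measureReal_def]
  rw [integral_div, div_eq_iff hd] at h
  rw [h, Measure.toSphere_real_apply_univ]
  ring

end RadialShift

/-- The Poisson integral formula for the constant function `1` on the unit sphere. -/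
lemma integral_unifSphere_norm_sub_rpow_of_lt_one {d : ℕ} (hd : 0 < d)
    {x : EuclideanSpace ℝ (Fin d)} (hx : ‖x‖ < 1) :
    ∫ θ, ‖θ - x‖ ^ (-(d : ℝ)) ∂(unifSphere d) = (1 - ‖x‖ ^ 2)⁻¹ := by
  have : Nonempty (Fin d) := ⟨⟨0, hd⟩⟩
  have h := integral_toSphere_norm_sub_rpow_neg_finrank volume hx
  rw [finrank_euclideanSpace_fin] at h
  have h0 : (volume : Measure (EuclideanSpace ℝ (Fin d))).toSphere.real univ ≠ 0 := by
    rw [measureReal_ne_zero_iff]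
    exact Measure.measure_univ_ne_zero.2 (Measure.toSphere_ne_zero _)
  have he : MeasurableEmbedding
      (Subtype.val : sphere (0 : EuclideanSpace ℝ (Fin d)) 1 → EuclideanSpace ℝ (Fin d)) :=
    .subtype_coe isClosed_sphere.measurableSet
  simp only [unifSphere]
  rw [integral_smul_measure, he.integral_map, h, he.map_apply, preimage_univ, ENNReal.toReal_inv,
    ← measureReal_def, smul_eq_mul]
  field_simp

lemma norm_sub_eq_mul_norm_sub_inversion {E : Type*} [NormedAddCommGroup E]
    [InnerProductSpace ℝ E] {θ x : E} (hθ : ‖θ‖ = 1) (hx : x ≠ 0) :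
    ‖θ - x‖ = ‖x‖ * ‖θ - (‖x‖ ^ 2)⁻¹ • x‖ := by
  have hn := norm_pos_iff.2 hx
  rw [← sq_eq_sq₀ (norm_nonneg _) (by positivity), mul_pow, norm_sub_sq_real, norm_sub_sq_real,
    inner_smul_right, norm_smul, hθ, norm_inv, norm_pow, norm_norm]
  field_simp
  ring

lemma ae_unifSphere_norm_eq_one (d : ℕ) : ∀ᵐ θ ∂(unifSphere d), ‖θ‖ = 1 := by
  refine Measure.ae_smul_measure ?_ _
  refine (ae_map_iff (by fun_prop) (isClosed_eq continuous_norm continuous_const).measurableSet).2 ?_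
  exact ae_of_all _ fun θ ↦ by simp

lemma integral_unifSphere_norm_sub_rpow_of_one_lt {d : ℕ} (hd : 0 < d)
    {x : EuclideanSpace ℝ (Fin d)} (hx : 1 < ‖x‖) :
    ∫ θ, ‖θ - x‖ ^ (-(d : ℝ)) ∂(unifSphere d) = ‖x‖ ^ (-(d : ℝ)) * (1 - ‖x‖ ^ (-2 : ℝ))⁻¹ := by
  have hpos : 0 < ‖x‖ := one_pos.trans hx
  have hinv : ‖(‖x‖ ^ 2)⁻¹ • x‖ = ‖x‖⁻¹ := by
    rw [norm_smul, norm_inv, norm_pow, norm_norm]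
    field_simp
  have h := integral_unifSphere_norm_sub_rpow_of_lt_one hd (x := (‖x‖ ^ 2)⁻¹ • x)
    (hinv ▸ inv_lt_one_of_one_lt₀ hx)
  rw [hinv] at h
  have hsq : ‖x‖ ^ (-2 : ℝ) = ‖x‖⁻¹ ^ 2 := by
    rw [rpow_neg hpos.le, inv_pow]; norm_cast
  rw [hsq, ← h, ← integral_const_mul]
  refine integral_congr_ae ?_
  filter_upwards [ae_unifSphere_norm_eq_one d] with θ hθ
  rw [norm_sub_eq_mul_norm_sub_inversion hθ (norm_pos_iff.1 hpos),
    mul_rpow hpos.le (norm_nonneg _)]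

/-- Explicit evaluation of `H_{S^{d-1}}(x) = ||x|²−1|^{α/2} ∫_{S^{d-1}} |θ−x|^{−d} σ₁(dθ)`. -/
theorem stmt2 (d : ℕ) (hd : 2 ≤ d) (α : ℝ) (hα : α ∈ Set.Ioo (0 : ℝ) 2)
    (x : EuclideanSpace ℝ (Fin d)) :
    (1 < ‖x‖ →
      |‖x‖ ^ 2 - 1| ^ (α / 2) * ∫ θ, ‖θ - x‖ ^ (-(d : ℝ)) ∂(unifSphere d)
        = ‖x‖ ^ (α - d) * (1 - ‖x‖ ^ (-2 : ℝ)) ^ (α / 2 - 1)) ∧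
    (‖x‖ < 1 →
      |‖x‖ ^ 2 - 1| ^ (α / 2) * ∫ θ, ‖θ - x‖ ^ (-(d : ℝ)) ∂(unifSphere d)
        = (1 - ‖x‖ ^ 2) ^ (α / 2 - 1)) := by
  have hd0 : 0 < d := by omega
  refine ⟨fun hx ↦ ?_, fun hx ↦ ?_⟩
  · have hpos : 0 < ‖x‖ := one_pos.trans hx
    have hsq : ‖x‖ ^ (-2 : ℝ) = (‖x‖ ^ 2)⁻¹ := by
      rw [rpow_neg hpos.le]; norm_cast
    have hlt : 0 < 1 - ‖x‖ ^ (-2 : ℝ) := by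
      rw [hsq, sub_pos]
      exact inv_lt_one_of_one_lt₀ (one_lt_pow₀ hx two_ne_zero)
    have hfac : ‖x‖ ^ 2 - 1 = ‖x‖ ^ (2 : ℝ) * (1 - ‖x‖ ^ (-2 : ℝ)) := by
      rw [hsq, rpow_two]
      field_simp
    rw [integral_unifSphere_norm_sub_rpow_of_one_lt hd0 hx, hfac,
      abs_of_pos (by positivity), mul_rpow (by positivity) hlt.le, ← rpow_mul hpos.le,
      mul_div_cancel₀ α two_ne_zero, rpow_sub_one hlt.ne', sub_eq_add_neg α, rpow_add hpos]
    ring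
  · have hlt := one_sub_norm_sq_pos hx
    rw [integral_unifSphere_norm_sub_rpow_of_lt_one hd0 hx, abs_sub_comm, abs_of_pos hlt,
      rpow_sub_one hlt.ne', ← div_eq_mul_inv]
end

section
/- Let d ≥ 2 be an integer, let r > 0, and let z ∈ ℝ^d with |z| < r. Then ∫_{rS^{d-1}} r^{d−2} (r² − |z|²) |z − θ|^{−d} σ_r(dθ) = 1, where σ_r denotes the uniform probability measure on the sphere rS^{d-1} = {x ∈ ℝ^d : |x| = r} centred at the origin of radius r. -/
open MeasureTheory Metric Set Real Filter

section PoissonKernel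

open scoped RealInnerProductSpace ENNReal

variable {E : Type*} [NormedAddCommGroup E] [InnerProductSpace ℝ E]

lemma injective_sub_norm_smul {w : E} (hw : ‖w‖ < 1) :
    Function.Injective fun x : E => x - ‖x‖ • w := by
  intro x y hxy
  have h : x - y = (‖x‖ - ‖y‖) • w := by
    rw [sub_smul, sub_eq_sub_iff_add_eq_add]
    have := sub_eq_sub_iff_add_eq_add.1 hxy
    rw [this]; abel
  have h1 : |‖x‖ - ‖y‖| ≤ |‖x‖ - ‖y‖| * ‖w‖ := by
    calc |‖x‖ - ‖y‖| ≤ ‖x - y‖ := abs_norm_sub_norm_le x y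
      _ = |‖x‖ - ‖y‖| * ‖w‖ := by rw [h, norm_smul, Real.norm_eq_abs]
  have h2 : ‖x‖ - ‖y‖ = 0 := by
    rw [← abs_eq_zero]
    nlinarith [abs_nonneg (‖x‖ - ‖y‖)]
  rw [h2, zero_smul] at h
  exact sub_eq_zero.1 h

lemma surjective_sub_norm_smul {w : E} (hw : ‖w‖ < 1) :
    Function.Surjective fun x : E => x - ‖x‖ • w := by
  intro y
  have hc : 0 < 1 - ‖w‖ ^ 2 := by nlinarith [norm_nonneg w]
  set S := √(⟪y, w⟫ ^ 2 + (1 - ‖w‖ ^ 2) * ‖y‖ ^ 2) with hS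
  have hS2 : S ^ 2 = ⟪y, w⟫ ^ 2 + (1 - ‖w‖ ^ 2) * ‖y‖ ^ 2 := Real.sq_sqrt (by positivity)
  have hSge : |⟪y, w⟫| ≤ S := Real.abs_le_sqrt (by nlinarith [mul_nonneg hc.le (sq_nonneg ‖y‖)])
  set N := (⟪y, w⟫ + S) / (1 - ‖w‖ ^ 2) with hN
  have hN0 : 0 ≤ N := div_nonneg (by linarith [neg_abs_le ⟪y, w⟫]) hc.le
  have hNe : N * (1 - ‖w‖ ^ 2) = ⟪y, w⟫ + S := div_mul_cancel₀ _ hc.ne'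
  have hq : (N ^ 2 - (‖y‖ ^ 2 + 2 * N * ⟪y, w⟫ + N ^ 2 * ‖w‖ ^ 2)) * (1 - ‖w‖ ^ 2) = 0 := by
    linear_combination (N * (1 - ‖w‖ ^ 2) - ⟪y, w⟫ + S) * hNe + hS2
  have hnorm : ‖y + N • w‖ = N := by
    rw [← sq_eq_sq₀ (norm_nonneg _) hN0, norm_add_sq_real, norm_smul, inner_smul_right,
      Real.norm_eq_abs, mul_pow, sq_abs]
    linarith [(mul_eq_zero.1 hq).resolve_right hc.ne']
  exact ⟨y + N • w, by simp [hnorm]⟩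

lemma sub_norm_smul_eq_zero_iff {w : E} (hw : ‖w‖ < 1) {x : E} :
    x - ‖x‖ • w = 0 ↔ x = 0 :=
  ⟨fun h => injective_sub_norm_smul hw (by simpa using h), by rintro rfl; simp⟩

lemma hasFDerivAt_sub_norm_smul (w : E) {x : E} (hx : x ≠ 0) :
    HasFDerivAt (fun x : E => x - ‖x‖ • w)
      (ContinuousLinearMap.id ℝ E - ((‖x‖⁻¹ • innerSL ℝ x).smulRight w)) x := by
  have h : HasFDerivAt (fun x : E => ‖x‖) (‖x‖⁻¹ • innerSL ℝ x) x := by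
    have h1 := (hasStrictFDerivAt_norm_sq x).hasFDerivAt.sqrt (by simpa using hx)
    simp only [Real.sqrt_sq (norm_nonneg _)] at h1
    convert h1 using 1
    ext v
    simp
    field_simp
  exact (hasFDerivAt_id x).sub (h.smul_const w)

lemma det_id_sub_smulRight [FiniteDimensional ℝ E] (f : E →L[ℝ] ℝ) (w : E) :
    (ContinuousLinearMap.id ℝ E - f.smulRight w).det = 1 - f w := by
  have h : ((ContinuousLinearMap.id ℝ E - f.smulRight w : E →L[ℝ] E) : E →ₗ[ℝ] E) =
      LinearMap.transvection (f : E →ₗ[ℝ] ℝ) (-w) := by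
    ext v
    simp [LinearMap.transvection.apply, sub_eq_add_neg]
  rw [ContinuousLinearMap.det, h, LinearMap.transvection.det]
  simp [sub_eq_add_neg]

/-- The Jacobian of `x ↦ x - ‖x‖ • w` is inverse to the density `(1 + odd) / (1 - ‖w‖²)`. -/
lemma jacobian_mul_density {w x : E} (hw : ‖w‖ < 1) (hx : x ≠ 0) :
    |1 - ‖x‖⁻¹ * ⟪x, w⟫| * (1 + ⟪x - ‖x‖ • w, w⟫ /
      √(⟪x - ‖x‖ • w, w⟫ ^ 2 + (1 - ‖w‖ ^ 2) * ‖x - ‖x‖ • w‖ ^ 2)) = 1 - ‖w‖ ^ 2 := by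
  have hx0 : 0 < ‖x‖ := norm_pos_iff.2 hx
  have hlt : ⟪x, w⟫ < ‖x‖ := (real_inner_le_norm x w).trans_lt (by nlinarith)
  have hS : √(⟪x - ‖x‖ • w, w⟫ ^ 2 + (1 - ‖w‖ ^ 2) * ‖x - ‖x‖ • w‖ ^ 2) = ‖x‖ - ⟪x, w⟫ := by
    rw [← Real.sqrt_sq (sub_nonneg.2 hlt.le), norm_sub_sq_real, inner_sub_left, inner_smul_left,
      inner_smul_right, norm_smul, real_inner_self_eq_norm_sq, norm_norm]
    simp only [conj_trivial]
    ring_nf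
  have hJ : 0 < 1 - ‖x‖⁻¹ * ⟪x, w⟫ := by
    have : ‖x‖⁻¹ * ⟪x, w⟫ < ‖x‖⁻¹ * ‖x‖ := by gcongr
    rw [inv_mul_cancel₀ hx0.ne'] at this
    linarith
  rw [hS, abs_of_pos hJ, inner_sub_left, inner_smul_left, real_inner_self_eq_norm_sq]
  have : ‖x‖ - ⟪x, w⟫ ≠ 0 := by linarith
  simp only [conj_trivial]
  field_simp
  ring

variable [MeasurableSpace E] [BorelSpace E] [FiniteDimensional ℝ E]
  (μ : Measure E) [μ.IsAddHaarMeasure]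

lemma integral_ball_inner_div_sqrt_eq_zero (w : E) (c : ℝ) :
    ∫ y in ball (0 : E) 1, ⟪y, w⟫ / √(⟪y, w⟫ ^ 2 + c * ‖y‖ ^ 2) ∂μ = 0 := by
  have h := integral_neg_eq_self ((ball (0 : E) 1).indicator
    fun y => ⟪y, w⟫ / √(⟪y, w⟫ ^ 2 + c * ‖y‖ ^ 2)) μ
  have h2 : ∀ y : E, (ball (0 : E) 1).indicator
      (fun y => ⟪y, w⟫ / √(⟪y, w⟫ ^ 2 + c * ‖y‖ ^ 2)) (-y) =
      -(ball (0 : E) 1).indicator (fun y => ⟪y, w⟫ / √(⟪y, w⟫ ^ 2 + c * ‖y‖ ^ 2)) y := by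
    intro y
    by_cases hy : ‖y‖ < 1 <;> simp [Set.indicator, hy, neg_div]
  simp_rw [h2] at h
  rw [integral_neg, integral_indicator measurableSet_ball] at h
  linarith

lemma integrableOn_ball_inner_div_sqrt (w : E) {c : ℝ} (hc : 0 ≤ c) :
    IntegrableOn (fun y : E => ⟪y, w⟫ / √(⟪y, w⟫ ^ 2 + c * ‖y‖ ^ 2)) (ball 0 1) μ := by
  refine Measure.integrableOn_of_bounded (M := 1) measure_ball_lt_top.ne ?_ ?_
  · exact Measurable.aestronglyMeasurable (by fun_prop)
  · refine ae_of_all _ fun y => ?_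
    rw [norm_div, Real.norm_eq_abs, Real.norm_eq_abs, abs_of_nonneg (Real.sqrt_nonneg _)]
    exact div_le_one_of_le₀ (Real.abs_le_sqrt (by nlinarith [mul_nonneg hc (sq_nonneg ‖y‖)]))
      (Real.sqrt_nonneg _)

lemma measureReal_norm_sub_norm_smul_lt_one [Nontrivial E] {w : E} (hw : ‖w‖ < 1) :
    (1 - ‖w‖ ^ 2) * μ.real ({x : E | ‖x - ‖x‖ • w‖ < 1} \ {0}) = μ.real (ball 0 1 \ {0}) := by
  have hc : 0 < 1 - ‖w‖ ^ 2 := by nlinarith [norm_nonneg w]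
  set A : Set E := {x : E | ‖x - ‖x‖ • w‖ < 1} \ {0} with hA
  have hAm : MeasurableSet A :=
    (measurableSet_lt (by fun_prop) measurable_const).diff (measurableSet_singleton _)
  have himage : (fun x : E => x - ‖x‖ • w) '' A = ball 0 1 \ {0} := by
    ext y
    constructor
    · rintro ⟨x, ⟨hx1, hx0⟩, rfl⟩
      exact ⟨by simpa using hx1, fun h => hx0 ((sub_norm_smul_eq_zero_iff hw).1 h)⟩
    · rintro ⟨hy1, hy0⟩
      obtain ⟨x, rfl⟩ := surjective_sub_norm_smul hw y
      exact ⟨x, ⟨by simpa using hy1, fun h => hy0 ((sub_norm_smul_eq_zero_iff hw).2 h)⟩, rfl⟩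
  have key := integral_image_eq_integral_abs_det_fderiv_smul μ hAm
    (fun x hx => (hasFDerivAt_sub_norm_smul w hx.2).hasFDerivWithinAt)
    (injective_sub_norm_smul hw).injOn
    (fun y => 1 + ⟪y, w⟫ / √(⟪y, w⟫ ^ 2 + (1 - ‖w‖ ^ 2) * ‖y‖ ^ 2))
  rw [himage, setIntegral_congr_fun (g := fun _ => 1 - ‖w‖ ^ 2) hAm] at key
  · have hae : (ball (0 : E) 1 \ {0} : Set E) =ᵐ[μ] ball 0 1 :=
      sdiff_null_ae_eq_self (measure_singleton _)
    rw [setIntegral_congr_set hae, integral_add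
      (integrableOn_const (hs := measure_ball_lt_top.ne) (C := (1 : ℝ)))
      (integrableOn_ball_inner_div_sqrt μ w hc.le), integral_ball_inner_div_sqrt_eq_zero] at key
    rw [measureReal_congr hae]
    simp only [setIntegral_const, smul_eq_mul, mul_one, add_zero] at key
    rw [key, mul_comm]
  · intro x hx
    simp only [det_id_sub_smulRight, smul_eq_mul]
    simpa using jacobian_mul_density hw hx.2

lemma measure_norm_sub_norm_smul_lt_one [Nontrivial E] {w : E} (hw : ‖w‖ < 1) :
    μ ({x : E | ‖x - ‖x‖ • w‖ < 1} \ {0}) = ∫⁻ θ : sphere (0 : E) 1,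
      ENNReal.ofReal (‖w - θ‖⁻¹ ^ Module.finrank ℝ E / Module.finrank ℝ E) ∂μ.toSphere := by
  have hd : 0 < Module.finrank ℝ E := Module.finrank_pos
  have hpos (θ : sphere (0 : E) 1) : 0 < ‖w - θ‖⁻¹ := by
    refine inv_pos.2 (norm_pos_iff.2 (sub_ne_zero.2 fun h => ?_))
    rw [h, norm_eq_of_mem_sphere] at hw
    exact lt_irrefl _ hw
  set B : Set (sphere (0 : E) 1 × Ioi (0 : ℝ)) := {p | (p.2 : ℝ) < ‖w - p.1‖⁻¹}
  have hB : MeasurableSet B := measurableSet_lt (by fun_prop) (by fun_prop)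
  have hpre : (Subtype.val '' (homeomorphUnitSphereProd E ⁻¹' B) : Set E) =
      {x : E | ‖x - ‖x‖ • w‖ < 1} \ {0} := by
    ext x
    simp only [mem_image, mem_preimage, Subtype.exists, exists_and_right, exists_eq_right]
    have hx' (hx : x ≠ 0) : ‖x‖ < ‖w - ‖x‖⁻¹ • x‖⁻¹ ↔ ‖x - ‖x‖ • w‖ < 1 := by
      have hx0 : 0 < ‖x‖ := norm_pos_iff.2 hx
      have h1 : ‖x - ‖x‖ • w‖ = ‖x‖ * ‖w - ‖x‖⁻¹ • x‖ := by
        rw [norm_sub_rev, ← norm_norm x, ← norm_smul, smul_sub, smul_smul, norm_norm,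
          mul_inv_cancel₀ hx0.ne', one_smul]
      have h2 : 0 < ‖w - ‖x‖⁻¹ • x‖ := by
        have := hpos ⟨‖x‖⁻¹ • x, by simp [norm_smul, hx0.ne']⟩
        exact inv_pos.1 this
      rw [h1, lt_inv_comm₀ hx0 h2, ← one_div, lt_div_iff₀ hx0, mul_comm]
    constructor
    · rintro ⟨hx, h⟩
      exact ⟨(hx' hx).1 (by simpa [B] using h), hx⟩
    · rintro ⟨h, hx⟩
      exact ⟨hx, by simpa [B] using (hx' hx).2 h⟩
  rw [← hpre, ← comap_subtype_coe_apply (measurableSet_singleton _).compl,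
    μ.measurePreserving_homeomorphUnitSphereProd.measure_preimage hB.nullMeasurableSet,
    Measure.prod_apply hB]
  refine lintegral_congr fun θ => ?_
  have : Prod.mk θ ⁻¹' B = Iio ⟨‖w - θ‖⁻¹, hpos θ⟩ := by
    ext ρ
    simp [B, ← Subtype.coe_lt_coe]
  rw [this, Measure.volumeIoiPow_apply_Iio, Nat.sub_add_cancel hd, Nat.cast_pred hd,
    sub_add_cancel]

lemma integral_toSphere_poissonKernel [Nontrivial E] {w : E} (hw : ‖w‖ < 1) :
    ∫ θ : sphere (0 : E) 1, (1 - ‖w‖ ^ 2) * ‖w - θ‖⁻¹ ^ Module.finrank ℝ E ∂μ.toSphere =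
      μ.toSphere.real univ := by
  have hd : (Module.finrank ℝ E : ℝ) ≠ 0 := Nat.cast_ne_zero.2 Module.finrank_pos.ne'
  have h1 : ∫ θ : sphere (0 : E) 1, ‖w - θ‖⁻¹ ^ Module.finrank ℝ E / Module.finrank ℝ E
      ∂μ.toSphere = μ.real ({x : E | ‖x - ‖x‖ • w‖ < 1} \ {0}) := by
    rw [integral_eq_lintegral_of_nonneg_ae (ae_of_all _ fun θ => by positivity)
      (Measurable.aestronglyMeasurable (by fun_prop)), measureReal_def,
      measure_norm_sub_norm_smul_lt_one μ hw]
  have h2 := measureReal_norm_sub_norm_smul_lt_one μ hw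
  rw [integral_div, div_eq_iff hd] at h1
  rw [integral_const_mul, h1, ← mul_assoc, h2, measureReal_congr (sdiff_null_ae_eq_self
    (measure_singleton _)), μ.toSphere_real_apply_univ, mul_comm]

end PoissonKernel

/-- Poisson kernel identity: `∫_{rS^{d-1}} r^{d−2}(r² − |z|²)|z − θ|^{−d} σ_r(dθ) = 1` for `|z| < r`,
where `σ_r` is the uniform probability measure on the sphere of radius `r`, realised as the
pushforward of the normalised unit-sphere measure under scaling by `r`. -/
theorem stmt4 (d : ℕ) (hd : 2 ≤ d) (r : ℝ) (hr : 0 < r)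
    (z : EuclideanSpace ℝ (Fin d)) (hz : ‖z‖ < r) :
    ∫ θ, r ^ ((d : ℝ) - 2) * (r ^ 2 - ‖z‖ ^ 2) * ‖z - θ‖ ^ (-(d : ℝ))
        ∂((unifSphere d).map (fun θ => r • θ)) = 1 := by
  have : Nontrivial (EuclideanSpace ℝ (Fin d)) :=
    Module.nontrivial_of_finrank_pos (R := ℝ) (by rw [finrank_euclideanSpace_fin]; omega)
  set σ := (volume : Measure (EuclideanSpace ℝ (Fin d))).toSphere with hσ
  obtain ⟨w, rfl⟩ : ∃ w, z = r • w := ⟨r⁻¹ • z, (smul_inv_smul₀ hr.ne' z).symm⟩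
  have hw : ‖w‖ < 1 := by
    rwa [norm_smul, Real.norm_of_nonneg hr.le, mul_lt_iff_lt_one_right hr] at hz
  have hscale (θ : EuclideanSpace ℝ (Fin d)) :
      r ^ ((d : ℝ) - 2) * (r ^ 2 - ‖r • w‖ ^ 2) * ‖r • w - r • θ‖ ^ (-(d : ℝ)) =
        (1 - ‖w‖ ^ 2) * ‖w - θ‖⁻¹ ^ Module.finrank ℝ (EuclideanSpace ℝ (Fin d)) := by
    rw [← smul_sub, norm_smul, norm_smul, Real.norm_of_nonneg hr.le,
      Real.rpow_sub hr, Real.rpow_neg (by positivity), Real.rpow_natCast, Real.rpow_natCast,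
      finrank_euclideanSpace_fin, Real.rpow_two, mul_pow, mul_pow, mul_inv, inv_pow]
    field_simp
  have hsm : MeasurableEmbedding fun θ : EuclideanSpace ℝ (Fin d) => r • θ :=
    measurableEmbedding_const_smul₀ hr.ne'
  have hval : MeasurableEmbedding
      (Subtype.val : sphere (0 : EuclideanSpace ℝ (Fin d)) 1 → EuclideanSpace ℝ (Fin d)) :=
    .subtype_coe isClosed_sphere.measurableSet
  have hne : σ.real univ ≠ 0 :=
    (measureReal_ne_zero_iff (measure_ne_top _ _)).2 <| Measure.measure_univ_ne_zero.2
      (Measure.toSphere_ne_zero _)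
  rw [hsm.integral_map]
  simp_rw [hscale]
  simp only [unifSphere]
  rw [integral_smul_measure, hval.integral_map, integral_toSphere_poissonKernel _ hw,
    hval.map_apply, preimage_univ, ENNReal.toReal_inv, ← measureReal_def, smul_eq_mul,
    inv_mul_cancel₀ hne]
end

section
/- Let d ≥ 2 be an integer, let α > 0, and let z ∈ ℝ^d with |z| < 1. Then ∫_{{v ∈ ℝ^d : |v| > 1}} (|v|² − |z|²)^{−α/2} |z − v|^{−d} dv = (2π^{d/2} / (α Γ(d/2))) · (1 − |z|²)^{−α/2}, where the integral is with respect to Lebesgue measure on ℝ^d. -/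
open MeasureTheory Metric Set Real Filter
open scoped ENNReal

/-- Polar coordinates for nonnegative functions on a finite-dimensional real normed space. -/
lemma lintegral_eq_lintegral_toSphere {E : Type*} [NormedAddCommGroup E] [NormedSpace ℝ E]
    [MeasurableSpace E] [BorelSpace E] [FiniteDimensional ℝ E] [Nontrivial E]
    (μ : Measure E) [μ.IsAddHaarMeasure] {f : E → ℝ≥0∞} (hf : Measurable f) :
    ∫⁻ x, f x ∂μ = ∫⁻ θ : sphere (0 : E) 1, (∫⁻ r in Ioi (0 : ℝ),
      ENNReal.ofReal (r ^ (Module.finrank ℝ E - 1)) * f (r • (θ : E))) ∂μ.toSphere := by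
  have hmp := (μ.measurePreserving_homeomorphUnitSphereProd).symm
    (homeomorphUnitSphereProd E).toMeasurableEquiv
  have hg : Measurable fun p : sphere (0 : E) 1 × Ioi (0 : ℝ) ↦ f ((p.2 : ℝ) • (p.1 : E)) := by
    fun_prop
  calc ∫⁻ x, f x ∂μ = ∫⁻ x : ({(0)}ᶜ : Set E), f x ∂(μ.comap (↑)) := by
        rw [lintegral_subtype_comap (measurableSet_singleton _).compl, restrict_compl_singleton]
    _ = ∫⁻ p, f ((p.2 : ℝ) • (p.1 : E)) ∂(μ.toSphere.prod
          (.volumeIoiPow (Module.finrank ℝ E - 1))) := by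
        exact (hmp.lintegral_comp (hf.comp measurable_subtype_coe)).symm
    _ = _ := by
        rw [lintegral_prod _ hg.aemeasurable]
        refine lintegral_congr fun θ ↦ ?_
        rw [Measure.volumeIoiPow, lintegral_withDensity_eq_lintegral_mul _ (by fun_prop)
          (by fun_prop)]
        exact lintegral_subtype_comap measurableSet_Ioi
          fun r : ℝ ↦ ENNReal.ofReal (r ^ (Module.finrank ℝ E - 1)) * f (r • (θ : E))

/-- The substitution `t = r * (r + a)`, symmetrized in the sign of `a`. -/
lemma lintegral_mul_add_add_lintegral_mul_sub {h : ℝ → ℝ≥0∞} (hm : Measurable h)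
    (h0 : ∀ t ≤ 0, h t = 0) (a : ℝ) :
    (∫⁻ r in Ioi (0 : ℝ), h (r * (r + a)) * ENNReal.ofReal r⁻¹)
      + ∫⁻ r in Ioi (0 : ℝ), h (r * (r - a)) * ENNReal.ofReal r⁻¹
      = ∫⁻ t in Ioi (0 : ℝ), h t * ENNReal.ofReal t⁻¹ := by
  wlog ha : 0 ≤ a generalizing a
  · rw [add_comm, ← this (-a) (by linarith)]
    simp [sub_eq_add_neg]
  have hshift : ∫⁻ r in Ioi (0 : ℝ), h (r * (r - a)) * ENNReal.ofReal r⁻¹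
      = ∫⁻ r in Ioi (0 : ℝ), h (r * (r + a)) * ENNReal.ofReal (r + a)⁻¹ := by
    rw [← lintegral_indicator measurableSet_Ioi, ← lintegral_indicator measurableSet_Ioi,
      ← lintegral_add_right_eq_self _ a]
    refine lintegral_congr fun r ↦ ?_
    simp only [indicator, mem_Ioi, add_sub_cancel_right, mul_comm (r + a) r]
    split_ifs with h₁ h₂ h₂
    · rfl
    · rw [h0 _ (mul_nonpos_of_nonpos_of_nonneg (not_lt.1 h₂) h₁.le), zero_mul]
    · linarith
    · rfl
  have himage : (fun r : ℝ ↦ r * (r + a)) '' Ioi 0 = Ioi 0 := by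
    ext t
    simp only [mem_image, mem_Ioi]
    refine ⟨?_, fun ht ↦ ⟨√((a / 2) ^ 2 + t) - a / 2, ?_, ?_⟩⟩
    · rintro ⟨r, hr, rfl⟩
      positivity
    · exact sub_pos.2 (Real.lt_sqrt_of_sq_lt (by linarith))
    · linear_combination Real.sq_sqrt (show 0 ≤ (a / 2) ^ 2 + t by positivity)
  have hinj : InjOn (fun r : ℝ ↦ r * (r + a)) (Ioi 0) := by
    intro x hx y hy hxy
    simp only [mem_Ioi] at hx hy hxy
    have : (x - y) * (x + y + a) = 0 := by linear_combination hxy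
    rcases mul_eq_zero.1 this with h | h <;> linarith
  have hderiv (r : ℝ) (_ : r ∈ Ioi (0 : ℝ)) :
      HasDerivWithinAt (fun r : ℝ ↦ r * (r + a)) (2 * r + a) (Ioi 0) r := by
    have := ((hasDerivAt_id r).mul ((hasDerivAt_id r).add_const a)).hasDerivWithinAt (s := Ioi 0)
    convert! this using 1
    simp only [id_eq]
    ring
  rw [hshift, ← lintegral_add_left (by fun_prop)]
  conv_rhs => rw [← himage, lintegral_image_eq_lintegral_abs_deriv_mul measurableSet_Ioi
    hderiv hinj]
  refine setLIntegral_congr_fun measurableSet_Ioi fun r hr ↦ ?_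
  have hr : 0 < r := hr
  have hra : 0 < r + a := by positivity
  rw [← mul_add, ← ENNReal.ofReal_add (by positivity) (by positivity), mul_left_comm,
    ← ENNReal.ofReal_mul (by positivity), abs_of_pos (by positivity)]
  congr 2
  field_simp
  ring

open scoped RealInnerProductSpace in
/-- Integrating a function of `‖z + w‖ ^ 2 - ‖z‖ ^ 2` against `‖w‖ ^ (-d)`: after averaging over
`w` and `-w`, the dependence on `z` disappears in polar coordinates. -/
lemma two_mul_lintegral_comp_norm_sq_sub_mul_rpow_neg_finrank {E : Type*}
    [NormedAddCommGroup E] [InnerProductSpace ℝ E]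
    [MeasurableSpace E] [BorelSpace E] [FiniteDimensional ℝ E] [Nontrivial E]
    (μ : Measure E) [μ.IsAddHaarMeasure] {h : ℝ → ℝ≥0∞} (hm : Measurable h)
    (h0 : ∀ t ≤ 0, h t = 0) (z : E) :
    2 * ∫⁻ w, h (‖z + w‖ ^ 2 - ‖z‖ ^ 2) * ENNReal.ofReal (‖w‖ ^ (-(Module.finrank ℝ E : ℝ))) ∂μ
      = (∫⁻ t in Ioi (0 : ℝ), h t * ENNReal.ofReal t⁻¹) * μ.toSphere univ := by
  set f : E → ℝ≥0∞ := fun w ↦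
    h (‖z + w‖ ^ 2 - ‖z‖ ^ 2) * ENNReal.ofReal (‖w‖ ^ (-(Module.finrank ℝ E : ℝ))) with hf
  have hfm : Measurable f := by fun_prop
  have key (θ : E) (hθ : ‖θ‖ = 1) (r : ℝ) (hr : 0 < r) :
      ENNReal.ofReal (r ^ (Module.finrank ℝ E - 1)) * f (r • θ)
        = h (r * (r + 2 * ⟪z, θ⟫)) * ENNReal.ofReal r⁻¹ := by
    have hn : ‖r • θ‖ = r := by rw [norm_smul, hθ, mul_one, Real.norm_of_nonneg hr.le]
    have hd : 1 ≤ Module.finrank ℝ E := Module.finrank_pos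
    simp only [hf]
    rw [mul_left_comm, ← ENNReal.ofReal_mul (by positivity), norm_add_sq_real, hn,
      real_inner_smul_right, ← Real.rpow_natCast r (_ - 1), ← Real.rpow_add hr, ← Real.rpow_neg_one]
    congr 3
    · ring
    · push_cast [Nat.cast_sub hd]
      ring
  calc 2 * ∫⁻ w, f w ∂μ = ∫⁻ w, f w + f (-w) ∂μ := by
        rw [lintegral_add_left hfm, two_mul]
        congr 1
        exact ((Measure.measurePreserving_neg μ).lintegral_comp hfm).symm
    _ = ∫⁻ θ : sphere (0 : E) 1, (∫⁻ t in Ioi (0 : ℝ), h t * ENNReal.ofReal t⁻¹) ∂μ.toSphere := by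
        rw [lintegral_eq_lintegral_toSphere μ (by fun_prop)]
        refine lintegral_congr fun θ ↦ ?_
        rw [← lintegral_mul_add_add_lintegral_mul_sub hm h0 (2 * ⟪z, (θ : E)⟫),
          ← lintegral_add_left (by fun_prop)]
        refine setLIntegral_congr_fun measurableSet_Ioi fun r hr ↦ ?_
        have hθ : ‖(θ : E)‖ = 1 := by simp
        rw [mul_add, key θ hθ r hr, ← smul_neg, key (-θ) (by simp) r hr]
        simp [sub_eq_add_neg]
    _ = _ := by rw [lintegral_const]

/-- `∫_{|v|>1} (|v|² − |z|²)^{−α/2} |z − v|^{−d} dv = (2π^{d/2}/(αΓ(d/2)))(1 − |z|²)^{−α/2}`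
for `|z| < 1`. -/
theorem stmt5 (d : ℕ) (hd : 2 ≤ d) (α : ℝ) (hα : 0 < α)
    (z : EuclideanSpace ℝ (Fin d)) (hz : ‖z‖ < 1) :
    ∫ v in {v : EuclideanSpace ℝ (Fin d) | 1 < ‖v‖},
        (‖v‖ ^ 2 - ‖z‖ ^ 2) ^ (-α / 2) * ‖z - v‖ ^ (-(d : ℝ))
      = (2 * Real.pi ^ ((d : ℝ) / 2) / (α * Real.Gamma ((d : ℝ) / 2))) *
          (1 - ‖z‖ ^ 2) ^ (-α / 2) := by
  have : Nonempty (Fin d) := ⟨⟨0, by omega⟩⟩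
  set c : ℝ := 1 - ‖z‖ ^ 2 with hc
  have hc0 : 0 < c := by nlinarith [norm_nonneg z]
  set h : ℝ → ℝ≥0∞ := (Ioi c).indicator fun t ↦ ENNReal.ofReal (t ^ (-α / 2)) with hh
  have hm : Measurable h := Measurable.indicator (by fun_prop) measurableSet_Ioi
  have h0 : ∀ t ≤ 0, h t = 0 := fun t ht ↦ indicator_of_notMem (by simp; linarith) _
  have hmeas : MeasurableSet {v : EuclideanSpace ℝ (Fin d) | 1 < ‖v‖} :=
    measurableSet_lt measurable_const measurable_norm
  have hsq (v : EuclideanSpace ℝ (Fin d)) : 1 < ‖v‖ ↔ c < ‖v‖ ^ 2 - ‖z‖ ^ 2 := by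
    rw [hc, sub_lt_sub_iff_right, one_lt_sq_iff₀ (norm_nonneg v)]
  have hradial : ∫⁻ t in Ioi (0 : ℝ), h t * ENNReal.ofReal t⁻¹
      = ENNReal.ofReal (2 / α * c ^ (-α / 2)) := by
    have hlt : -α / 2 - 1 < -1 := by linarith
    have hval : 2 / α * c ^ (-α / 2) = ∫ t in Ioi c, t ^ (-α / 2 - 1) := by
      rw [integral_Ioi_rpow_of_lt hlt hc0]
      rw [sub_add_cancel]
      field_simp
    rw [hval, ofReal_integral_eq_lintegral_ofReal (integrableOn_Ioi_rpow_of_lt hlt hc0)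
      ((ae_restrict_mem measurableSet_Ioi).mono fun t ht ↦
        Real.rpow_nonneg (hc0.trans ht).le _),
      ← lintegral_indicator measurableSet_Ioi, ← lintegral_indicator measurableSet_Ioi]
    refine lintegral_congr fun t ↦ ?_
    by_cases ht : c < t
    · have ht0 : 0 < t := hc0.trans ht
      simp only [hh, indicator, mem_Ioi, ht, ht0, if_true]
      rw [← ENNReal.ofReal_mul (by positivity), Real.rpow_sub_one ht0.ne', div_eq_mul_inv (t ^ _)]
    · simp [hh, indicator, ht]
  have hsphere : (volume : Measure (EuclideanSpace ℝ (Fin d))).toSphere univ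
      = ENNReal.ofReal (2 * Real.pi ^ ((d : ℝ) / 2) / Real.Gamma ((d : ℝ) / 2)) := by
    have hd0 : (0 : ℝ) < d / 2 := by positivity
    rw [Measure.toSphere_apply_univ, EuclideanSpace.volume_ball, finrank_euclideanSpace_fin,
      Fintype.card_fin, ENNReal.ofReal_one, one_pow, one_mul, ← ENNReal.ofReal_natCast,
      ← ENNReal.ofReal_mul (by positivity), Real.Gamma_add_one hd0.ne',
      Real.sqrt_eq_rpow, ← Real.rpow_mul_natCast Real.pi_pos.le]
    congr 1
    have := Real.Gamma_pos_of_pos hd0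
    rw [show 1 / 2 * (d : ℝ) = d / 2 by ring]
    field_simp
  have hkey := two_mul_lintegral_comp_norm_sq_sub_mul_rpow_neg_finrank volume hm h0 z
  rw [hradial, hsphere, ← ENNReal.ofReal_mul (by positivity)] at hkey
  have htrans : ∫⁻ v in {v : EuclideanSpace ℝ (Fin d) | 1 < ‖v‖},
        ENNReal.ofReal ((‖v‖ ^ 2 - ‖z‖ ^ 2) ^ (-α / 2) * ‖z - v‖ ^ (-(d : ℝ)))
      = ∫⁻ w, h (‖z + w‖ ^ 2 - ‖z‖ ^ 2) * ENNReal.ofReal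
          (‖w‖ ^ (-(Module.finrank ℝ (EuclideanSpace ℝ (Fin d)) : ℝ))) := by
    rw [← lintegral_indicator hmeas, ← lintegral_add_left_eq_self _ z]
    refine lintegral_congr fun w ↦ ?_
    by_cases hw : 1 < ‖z + w‖
    · have hw' := (hsq _).1 hw
      simp only [hh, indicator, mem_ofPred_eq, mem_Ioi, hw, hw', if_true]
      rw [← ENNReal.ofReal_mul (Real.rpow_nonneg (hc0.trans hw').le _)]
      simp
    · have hw' := mt (hsq _).2 hw
      simp [hh, indicator, hw, hw']
  rw [integral_eq_lintegral_of_nonneg_ae ?_ (by fun_prop), htrans]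
  · have := congrArg ENNReal.toReal hkey
    rw [ENNReal.toReal_mul, ENNReal.toReal_ofReal (by positivity), ENNReal.toReal_ofNat] at this
    rw [← mul_right_inj' (two_ne_zero (α := ℝ)), this]
    field_simp
  · refine (ae_restrict_mem hmeas).mono fun v hv ↦ ?_
    have := hc0.trans ((hsq v).1 hv)
    simp only [Pi.zero_apply]
    positivity
end

section
/- Let d ≥ 2 be an integer, let α > 0, let R > 1, and let θ ∈ ℝ^d with |θ| = 1. Then ∫_{{y ∈ ℝ^d : 1 < |y| < R}} (|y|² − 1)^{α} |θ − y|^{−d} dy = (π^{d/2} / (α Γ(d/2))) · (R² − 1)^{α}, where the integral is with respect to Lebesgue measure on ℝ^d. -/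
open MeasureTheory Metric Set Real Filter

/-- The Poisson kernel identity in the polar angle. In the triangle with vertices `0`, a unit vector
and a point at distance `r` from `0`, let `φ`, `ψ` and `ψ - φ` be the angle at `0`, the exterior
angle at the unit vector and the angle at the far point; with `S x = ∫ t in 0..x, sin t ^ n`, the
function `S ψ + r ^ n * S (ψ - φ)` is an antiderivative in `φ`. -/
lemma integral_sin_pow_mul_rpow_poisson (n : ℕ) {r : ℝ} (hr : 1 < r) :
    IntervalIntegrable (fun φ ↦ sin φ ^ n * (1 - 2 * r * cos φ + r ^ 2) ^ (-((n : ℝ) + 2) / 2))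
      volume 0 π ∧
    (∫ φ in (0 : ℝ)..π, sin φ ^ n * (1 - 2 * r * cos φ + r ^ 2) ^ (-((n : ℝ) + 2) / 2)) *
      (r ^ n * (r ^ 2 - 1)) =
      ∫ φ in (0 : ℝ)..π, sin φ ^ n := by
  have hD : ∀ φ, 0 < 1 - 2 * r * cos φ + r ^ 2 := fun φ ↦ by
    nlinarith [cos_le_one φ, sq_nonneg (r - 1),
      mul_nonneg (sub_nonneg.2 (cos_le_one φ)) (by linarith : 0 ≤ r)]
  set D : ℝ → ℝ := fun φ ↦ 1 - 2 * r * cos φ + r ^ 2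
  have hDv : ∀ φ, D φ = 1 - 2 * r * cos φ + r ^ 2 := fun _ ↦ rfl
  replace hD : ∀ φ, 0 < D φ := hD
  have hDc : Continuous D := by fun_prop
  have hDd : ∀ φ, HasDerivAt D (2 * r * sin φ) φ := fun φ ↦ by
    convert! (((hasDerivAt_cos φ).const_mul (2 * r)).const_sub 1).add_const (r ^ 2) using 1; ring
  change IntervalIntegrable (fun φ ↦ sin φ ^ n * (D φ) ^ (-((n : ℝ) + 2) / 2)) volume 0 π ∧
    (∫ φ in (0 : ℝ)..π, sin φ ^ n * (D φ) ^ (-((n : ℝ) + 2) / 2)) * (r ^ n * (r ^ 2 - 1)) = _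
  clear_value D
  have hcont : Continuous fun φ ↦ sin φ ^ n * (D φ) ^ (-((n : ℝ) + 2) / 2) :=
    (continuous_sin.pow n).mul (hDc.rpow_const fun φ ↦ Or.inl (hD φ).ne')
  refine ⟨hcont.intervalIntegrable _ _, ?_⟩
  set S : ℝ → ℝ := fun x ↦ ∫ t in (0 : ℝ)..x, sin t ^ n with hS
  have hSd : ∀ x, HasDerivAt S (sin x ^ n) x := fun x ↦
    ((continuous_sin.pow n).integral_hasStrictDerivAt 0 x).hasDerivAt
  have hSc : Continuous S := continuous_iff_continuousAt.2 fun x ↦ (hSd x).continuousAt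
  set ψ : ℝ → ℝ := fun φ ↦ arccos ((r * cos φ - 1) / √(D φ)) with hψ
  have hψc : Continuous ψ :=
    continuous_arccos.comp (by
      refine Continuous.div (by fun_prop) (by fun_prop) fun φ ↦ (Real.sqrt_pos.2 (hD φ)).ne')
  have hsq : ∀ φ, (r * cos φ - 1) ^ 2 + (r * sin φ) ^ 2 = D φ := fun φ ↦ by
    rw [hDv]; nlinarith [sin_sq_add_cos_sq φ]
  have hψ0 : ψ 0 = 0 := by
    have : D 0 = (r - 1) ^ 2 := by rw [hDv, cos_zero]; ring
    simp only [hψ, this, cos_zero, Real.sqrt_sq (by linarith : 0 ≤ r - 1), mul_one]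
    rw [div_self (by linarith), arccos_one]
  have hψπ : ψ π = π := by
    have : D π = (r + 1) ^ 2 := by rw [hDv, cos_pi]; ring
    simp only [hψ, this, cos_pi, Real.sqrt_sq (by linarith : 0 ≤ r + 1)]
    rw [show (r * -1 - 1) / (r + 1) = -1 by field_simp; ring, arccos_neg_one]
  have hcosψ : ∀ φ ∈ Ioo 0 π, cos (ψ φ) = (r * cos φ - 1) / √(D φ) := fun φ hφ ↦ by
    have h1 : |(r * cos φ - 1) / √(D φ)| ≤ 1 := by
      rw [abs_div, abs_of_pos (Real.sqrt_pos.2 (hD φ)), div_le_one (Real.sqrt_pos.2 (hD φ))]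
      apply Real.abs_le_sqrt
      nlinarith [hsq φ, sq_nonneg (r * sin φ)]
    exact cos_arccos (abs_le.1 h1).1 (abs_le.1 h1).2
  have hone : ∀ φ ∈ Ioo 0 π, √(1 - ((r * cos φ - 1) / √(D φ)) ^ 2) = r * sin φ / √(D φ) := by
    intro φ hφ
    have := sin_pos_of_mem_Ioo hφ
    rw [show 1 - ((r * cos φ - 1) / √(D φ)) ^ 2 = (r * sin φ / √(D φ)) ^ 2 by
      rw [div_pow, div_pow, Real.sq_sqrt (hD φ).le]
      have := (hD φ).ne'
      field_simp
      linarith [hsq φ]]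
    exact Real.sqrt_sq (by positivity)
  have hsinψ : ∀ φ ∈ Ioo 0 π, sin (ψ φ) = r * sin φ / √(D φ) := fun φ hφ ↦ by
    rw [hψ, sin_arccos, hone φ hφ]
  have hψd : ∀ φ ∈ Ioo 0 π, HasDerivAt ψ ((r ^ 2 - r * cos φ) / D φ) φ := by
    intro φ hφ
    have hs := sin_pos_of_mem_Ioo hφ
    have hq := Real.sqrt_pos.2 (hD φ)
    have hpos : 0 < r * sin φ / √(D φ) := by positivity
    have hu := (((hasDerivAt_cos φ).const_mul r).sub_const 1).div ((hDd φ).sqrt (hD φ).ne') hq.ne'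
    have hne : 0 < 1 - ((r * cos φ - 1) / √(D φ)) ^ 2 := by
      rw [← hone φ hφ] at hpos; exact Real.sqrt_pos.1 hpos
    have ha := (hasDerivAt_arccos (x := (r * cos φ - 1) / √(D φ))
      (by intro h; rw [h] at hne; norm_num at hne) (by intro h; rw [h] at hne; norm_num at hne)).comp φ hu
    convert! ha using 1
    rw [hone φ hφ]
    have h2 : √(D φ) ^ 2 = D φ := Real.sq_sqrt (hD φ).le
    have h3 : D φ = √(D φ) ^ 2 := h2.symm
    have h4 : √(D φ) ^ 2 = 1 - 2 * r * cos φ + r ^ 2 := h2.trans (hDv φ)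
    rw [h3, Real.sqrt_sq hq.le]
    field_simp
    rw [h4]; ring
  have hint := intervalIntegral.integral_eq_sub_of_hasDerivAt_of_le (a := 0) (b := π)
    (f := fun φ ↦ S (ψ φ) + r ^ n * S (ψ φ - φ))
    (f' := fun φ ↦ (sin φ ^ n * (D φ) ^ (-((n : ℝ) + 2) / 2)) * (r ^ n * (r ^ 2 - 1)))
    pi_pos.le (by fun_prop) (fun φ hφ ↦ ?_) ((hcont.mul continuous_const).intervalIntegrable _ _)
  · rw [intervalIntegral.integral_mul_const] at hint
    rw [hint]
    simp [hψ0, hψπ, hS]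
  · have hq := Real.sqrt_pos.2 (hD φ)
    have hχ : HasDerivAt (fun φ ↦ ψ φ - φ) ((r ^ 2 - r * cos φ) / D φ - 1) φ :=
      (hψd φ hφ).sub (hasDerivAt_id φ)
    have h1 := (hSd (ψ φ)).comp φ (hψd φ hφ)
    have h2 := (HasDerivAt.comp (h₂ := S) (h := fun φ ↦ ψ φ - φ) φ
      (hSd (ψ φ - φ)) hχ).const_mul (r ^ n)
    convert! h1.add h2 using 1
    have hsχ : sin (ψ φ - φ) = sin φ / √(D φ) := by
      rw [sin_sub, hsinψ φ hφ, hcosψ φ hφ]; field_simp; ring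
    have hpow : (D φ) ^ (-((n : ℝ) + 2) / 2) = (√(D φ) ^ (n + 2))⁻¹ := by
      rw [Real.sqrt_eq_rpow, ← Real.rpow_natCast, ← Real.rpow_mul (hD φ).le, ← Real.rpow_neg (hD φ).le]
      congr 1; push_cast; ring
    have h4 : √(D φ) ^ 2 = 1 - 2 * r * cos φ + r ^ 2 := (Real.sq_sqrt (hD φ).le).trans (hDv φ)
    have h3 : D φ = √(D φ) ^ 2 := (Real.sq_sqrt (hD φ).le).symm
    rw [hsχ, hsinψ φ hφ, hpow, h3, Real.sqrt_sq hq.le]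
    rw [div_pow, div_pow, mul_pow, pow_add]
    field_simp
    rw [h4]; ring

/-- The `lintegral` version of `MeasureTheory.integral_fun_norm_addHaar`. -/
lemma lintegral_fun_norm_addHaar {E : Type*} [NormedAddCommGroup E] [NormedSpace ℝ E]
    [FiniteDimensional ℝ E] [MeasurableSpace E] [BorelSpace E] [Nontrivial E]
    (μ : Measure E) [μ.IsAddHaarMeasure] {f : ℝ → ENNReal} (hf : Measurable f) :
    ∫⁻ x, f ‖x‖ ∂μ = (Module.finrank ℝ E * μ (ball 0 1)) *
      ∫⁻ y in Ioi (0 : ℝ), ENNReal.ofReal (y ^ (Module.finrank ℝ E - 1)) * f y := by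
  calc
    ∫⁻ x, f ‖x‖ ∂μ = ∫⁻ x : ({(0)}ᶜ : Set E), f ‖x.1‖ ∂(μ.comap (↑)) := by
      rw [lintegral_subtype_comap (measurableSet_singleton _).compl fun x ↦ f ‖x‖,
        restrict_compl_singleton]
    _ = ∫⁻ x, f x.2 ∂μ.toSphere.prod (.volumeIoiPow (Module.finrank ℝ E - 1)) := by
      simpa using μ.measurePreserving_homeomorphUnitSphereProd.lintegral_comp_emb
        (Homeomorph.measurableEmbedding _) (f ∘ Subtype.val ∘ Prod.snd)
    _ = μ.toSphere univ * ∫⁻ x : Ioi (0 : ℝ), f x ∂.volumeIoiPow (Module.finrank ℝ E - 1) := by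
      rw [lintegral_prod _ (by fun_prop)]
      simp [mul_comm]
    _ = _ := by
      rw [Measure.volumeIoiPow, lintegral_withDensity_eq_lintegral_mul _ (by fun_prop) (by fun_prop),
        μ.toSphere_apply_univ, ← lintegral_subtype_comap measurableSet_Ioi]
      rfl

open scoped RealInnerProductSpace in
lemma lintegral_fun_inner_norm {E : Type*} [NormedAddCommGroup E] [InnerProductSpace ℝ E]
    [FiniteDimensional ℝ E] [MeasurableSpace E] [BorelSpace E] {θ : E} (hθ : ‖θ‖ = 1)
    {f : ℝ × ℝ → ENNReal} (hf : Measurable f) :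
    ∫⁻ y : E, f (⟪θ, y⟫, ‖y‖) =
      ∫⁻ t : ℝ, ∫⁻ v : (ℝ ∙ θ)ᗮ, f (t, √(t ^ 2 + ‖v‖ ^ 2)) := by
  let e := (ℝ ∙ θ).orthogonalDecomposition
  let u := LinearIsometryEquiv.toSpanUnitSingleton (𝕜 := ℝ) θ hθ
  have h1 := (e.symm.measurePreserving).lintegral_comp_emb
    e.symm.toHomeomorph.measurableEmbedding (fun y ↦ f (⟪θ, y⟫, ‖y‖))
  have h2 := (WithLp.volume_preserving_toLp (ℝ ∙ θ) (ℝ ∙ θ)ᗮ).lintegral_comp_emb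
    (MeasurableEquiv.toLp 2 _).measurableEmbedding
    (fun p ↦ f (⟪θ, e.symm p⟫, ‖e.symm p‖))
  rw [← h1, ← h2, Measure.volume_eq_prod, lintegral_prod _ (by fun_prop),
    ← u.measurePreserving.lintegral_comp_emb u.toHomeomorph.measurableEmbedding]
  refine lintegral_congr fun t ↦ lintegral_congr fun v ↦ ?_
  have hv : ⟪θ, (v : E)⟫ = 0 := Submodule.mem_orthogonal_singleton_iff_inner_right.1 v.2
  have hu : ((u t : ℝ ∙ θ) : E) = t • θ := rfl
  congr 2
  · simp [e, hu, inner_add_right, inner_smul_right, hv, hθ]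
  · rw [LinearIsometryEquiv.norm_map, WithLp.prod_norm_eq_of_L2]
    simp

open scoped RealInnerProductSpace in
/-- Integration in polar coordinates of functions of the norm and of the component along a unit
vector. -/
lemma lintegral_fun_inner_norm_polar {E : Type*} [NormedAddCommGroup E] [InnerProductSpace ℝ E]
    [FiniteDimensional ℝ E] [MeasurableSpace E] [BorelSpace E] {n : ℕ}
    (hn : Module.finrank ℝ E = n + 2) {θ : E} (hθ : ‖θ‖ = 1) :
    ∃ c : ENNReal, ∀ f : ℝ × ℝ → ENNReal, Measurable f →
    ∫⁻ y : E, f (⟪θ, y⟫, ‖y‖) =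
      c * ∫⁻ r in Ioi (0 : ℝ), ENNReal.ofReal (r ^ (n + 1)) *
        ∫⁻ φ in Ioo 0 π, ENNReal.ofReal (sin φ ^ n) * f (r * cos φ, r) := by
  have : Fact (Module.finrank ℝ E = (n + 1) + 1) := ⟨hn⟩
  have hV : Module.finrank ℝ (ℝ ∙ θ)ᗮ = n + 1 :=
    Submodule.finrank_orthogonal_span_singleton (by rintro rfl; simp at hθ)
  have : Nontrivial (ℝ ∙ θ)ᗮ := Module.nontrivial_of_finrank_pos (R := ℝ) (by omega)
  refine ⟨(n + 1 : ℕ) * volume (ball (0 : (ℝ ∙ θ)ᗮ) 1), fun f hf ↦ ?_⟩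
  set c := (n + 1 : ℕ) * volume (ball (0 : (ℝ ∙ θ)ᗮ) 1)
  let g : ℝ × ℝ → ENNReal := (univ ×ˢ Ioi 0).indicator
    fun p ↦ ENNReal.ofReal (p.2 ^ n) * f (p.1, √(p.1 ^ 2 + p.2 ^ 2))
  have hg : Measurable g := Measurable.indicator (by fun_prop) (MeasurableSet.univ.prod measurableSet_Ioi)
  calc
    _ = ∫⁻ t : ℝ, c * ∫⁻ s : ℝ, g (t, s) := by
      rw [lintegral_fun_inner_norm hθ hf]
      refine lintegral_congr fun t ↦ ?_
      have hm : Measurable fun s ↦ f (t, √(t ^ 2 + s ^ 2)) := by fun_prop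
      rw [lintegral_fun_norm_addHaar volume hm, hV, ← lintegral_indicator measurableSet_Ioi]
      congr 1
      refine lintegral_congr fun s ↦ ?_
      simp [g, indicator]
    _ = c * ∫⁻ p : ℝ × ℝ, g p := by
      rw [lintegral_const_mul _ (by fun_prop), Measure.volume_eq_prod, lintegral_prod _ (by fun_prop)]
    _ = c * ∫⁻ r in Ioi (0 : ℝ), ∫⁻ φ in Ioo (-π) π,
        ENNReal.ofReal r * g (r * cos φ, r * sin φ) := by
      rw [← lintegral_comp_polarCoord_symm, polarCoord_target, Measure.volume_eq_prod,
        ← Measure.prod_restrict, lintegral_prod _ (by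
          simp only [polarCoord_symm_apply, smul_eq_mul]; fun_prop)]
      rfl
    _ = _ := by
      congr 1
      refine setLIntegral_congr_fun measurableSet_Ioi fun r (hr : 0 < r) ↦ ?_
      rw [← lintegral_const_mul _ (by fun_prop), ← lintegral_indicator measurableSet_Ioo,
        ← lintegral_indicator measurableSet_Ioo]
      refine lintegral_congr fun φ ↦ ?_
      by_cases hφ : φ ∈ Ioo 0 π
      · have hs := sin_pos_of_mem_Ioo hφ
        have hφ' : φ ∈ Ioo (-π) π := ⟨by linarith [hφ.1, pi_pos], hφ.2⟩
        rw [indicator_of_mem hφ, indicator_of_mem hφ']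
        simp only [g]
        rw [indicator_of_mem (by simp; positivity)]
        have hsq : √((r * cos φ) ^ 2 + (r * sin φ) ^ 2) = r := by
          rw [show (r * cos φ) ^ 2 + (r * sin φ) ^ 2 = r ^ 2 * (sin φ ^ 2 + cos φ ^ 2) by ring,
            sin_sq_add_cos_sq, mul_one, Real.sqrt_sq hr.le]
        simp only [hsq]
        rw [← mul_assoc, ← mul_assoc, ← ENNReal.ofReal_mul hr.le, ← ENNReal.ofReal_mul (by positivity)]
        congr 2; ring
      · rw [indicator_of_notMem hφ]
        by_cases hφ' : φ ∈ Ioo (-π) π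
        · rw [indicator_of_mem hφ']
          have hs : sin φ ≤ 0 := sin_nonpos_of_nonpos_of_neg_pi_le
            (by by_contra! h; exact hφ ⟨h, hφ'.2⟩) hφ'.1.le
          simp only [g]
          rw [indicator_of_notMem, mul_zero]
          simp only [mem_prod, mem_univ, true_and, mem_Ioi, not_lt]
          exact mul_nonpos_of_nonneg_of_nonpos hr.le hs
        · rw [indicator_of_notMem hφ']

lemma lintegral_radial_weight {α : ℝ} (hα : 0 < α) {R : ℝ} (hR : 1 < R) :
    ∫⁻ r in Ioo 1 R, ENNReal.ofReal (r * (r ^ 2 - 1) ^ (α - 1)) =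
      ENNReal.ofReal ((R ^ 2 - 1) ^ α / (2 * α)) := by
  have hcont : ContinuousOn (fun r : ℝ ↦ (r ^ 2 - 1) ^ α / (2 * α)) (Icc 1 R) :=
    (Continuous.div_const (Continuous.rpow_const (by fun_prop) fun _ ↦ Or.inr hα.le) _).continuousOn
  have hderiv : ∀ r ∈ Ioo 1 R, HasDerivAt (fun r : ℝ ↦ (r ^ 2 - 1) ^ α / (2 * α))
      (r * (r ^ 2 - 1) ^ (α - 1)) r := fun r hr ↦ by
    have h : r ^ 2 - 1 ≠ 0 := by nlinarith [hr.1]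
    convert! ((((hasDerivAt_pow 2 r).sub_const 1).rpow_const (p := α) (Or.inl h)).div_const (2 * α))
      using 1
    field_simp
    norm_num
    ring
  have hpos : ∀ r ∈ Ioo 1 R, 0 ≤ r * (r ^ 2 - 1) ^ (α - 1) := fun r hr ↦
    mul_nonneg (by linarith [hr.1]) (rpow_nonneg (by nlinarith [hr.1]) _)
  have hint := intervalIntegral.integrableOn_deriv_of_nonneg hcont hderiv hpos
  rw [← ofReal_integral_eq_lintegral_ofReal (hint.mono_set Ioo_subset_Ioc_self)
    ((ae_restrict_iff' measurableSet_Ioo).2 (.of_forall hpos)), ← integral_Ioc_eq_integral_Ioo,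
    ← intervalIntegral.integral_of_le hR.le,
    intervalIntegral.integral_eq_sub_of_hasDerivAt_of_le hR.le hcont hderiv
      ((intervalIntegrable_iff_integrableOn_Ioc_of_le hR.le).2 hint)]
  simp [zero_rpow hα.ne']

lemma lintegral_Ioo_zero_pi {f : ℝ → ℝ} (hf : IntervalIntegrable f volume 0 π)
    (hpos : ∀ φ ∈ Ioo 0 π, 0 ≤ f φ) :
    ∫⁻ φ in Ioo 0 π, ENNReal.ofReal (f φ) = ENNReal.ofReal (∫ φ in (0 : ℝ)..π, f φ) := by
  rw [intervalIntegral.integral_of_le pi_pos.le, integral_Ioc_eq_integral_Ioo,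
    ofReal_integral_eq_lintegral_ofReal
      (((intervalIntegrable_iff_integrableOn_Ioc_of_le pi_pos.le).1 hf).mono_set Ioo_subset_Ioc_self)
      ((ae_restrict_iff' measurableSet_Ioo).2 (.of_forall hpos))]

/-- `∫_{1<|y|<R} (|y|² − 1)^α |θ − y|^{−d} dy = (π^{d/2}/(αΓ(d/2)))(R² − 1)^α` for `|θ| = 1`. -/
theorem stmt6 (d : ℕ) (hd : 2 ≤ d) (α : ℝ) (hα : 0 < α) (R : ℝ) (hR : 1 < R)
    (θ : EuclideanSpace ℝ (Fin d)) (hθ : ‖θ‖ = 1) :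
    ∫ y in {y : EuclideanSpace ℝ (Fin d) | 1 < ‖y‖ ∧ ‖y‖ < R},
        (‖y‖ ^ 2 - 1) ^ α * ‖θ - y‖ ^ (-(d : ℝ))
      = (Real.pi ^ ((d : ℝ) / 2) / (α * Real.Gamma ((d : ℝ) / 2))) * (R ^ 2 - 1) ^ α := by
  obtain ⟨n, rfl⟩ : ∃ n, d = n + 2 := ⟨d - 2, by omega⟩
  obtain ⟨c, hc⟩ := lintegral_fun_inner_norm_polar (n := n) (by simp) hθ
  set A := ∫ φ in (0 : ℝ)..π, sin φ ^ n
  have hA : ∫⁻ φ in Ioo 0 π, ENNReal.ofReal (sin φ ^ n) = ENNReal.ofReal A :=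
    lintegral_Ioo_zero_pi ((continuous_sin.pow n).intervalIntegrable _ _)
      fun φ hφ ↦ pow_nonneg (sin_pos_of_mem_Ioo hφ).le _
  have hA0 : 0 < A := integral_sin_pow_pos n
  have hcA : c * ENNReal.ofReal A =
      ENNReal.ofReal (2 * π ^ (((n + 2 : ℕ) : ℝ) / 2) / Gamma (((n + 2 : ℕ) : ℝ) / 2)) := by
    have hball := hc (fun p ↦ (Ioo (-1) 1).indicator 1 p.2)
      ((measurable_one.indicator measurableSet_Ioo).comp measurable_snd)
    have hl : ∫⁻ y : EuclideanSpace ℝ (Fin (n + 2)), (Ioo (-1) 1).indicator 1 ‖y‖ =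
        volume (ball (0 : EuclideanSpace ℝ (Fin (n + 2))) 1) := by
      rw [← lintegral_indicator_one measurableSet_ball]
      refine lintegral_congr fun y ↦ ?_
      have : -1 < ‖y‖ := by linarith [norm_nonneg y]
      simp [indicator, this]
    have hr : ∫⁻ r in Ioi (0 : ℝ), ENNReal.ofReal (r ^ (n + 1)) *
        ∫⁻ φ in Ioo 0 π, ENNReal.ofReal (sin φ ^ n) * (Ioo (-1) 1).indicator 1 r =
        ENNReal.ofReal A * ENNReal.ofReal (1 / (n + 2)) := by
      have hI : ∫⁻ r in Ioc (0 : ℝ) 1, ENNReal.ofReal (r ^ (n + 1)) = ENNReal.ofReal (1 / (n + 2)) := by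
        rw [← ofReal_integral_eq_lintegral_ofReal (intervalIntegral.intervalIntegrable_pow _).1,
          ← intervalIntegral.integral_of_le zero_le_one]
        · rw [integral_pow]; congr 1; push_cast; simp; ring
        · filter_upwards [ae_restrict_mem measurableSet_Ioc] with y hy
          exact pow_nonneg hy.1.le _
      rw [← hI, ← setLIntegral_congr Ioo_ae_eq_Ioc, ← lintegral_const_mul _ (by fun_prop),
        ← lintegral_indicator measurableSet_Ioi, ← lintegral_indicator measurableSet_Ioo]
      refine lintegral_congr fun r ↦ ?_
      simp only [lintegral_mul_const _ (show Measurable fun φ ↦ ENNReal.ofReal (sin φ ^ n) by fun_prop), hA]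
      by_cases h0 : 0 < r
      · have : -1 < r := by linarith
        by_cases h1 : r < 1 <;> simp [indicator, h0, h1, this, mul_comm]
      · simp [indicator, h0]
    rw [hl, hr, EuclideanSpace.volume_ball, ← mul_assoc] at hball
    have h2 : ENNReal.ofReal (1 / ((n : ℝ) + 2)) * ENNReal.ofReal ((n : ℝ) + 2) = 1 := by
      rw [← ENNReal.ofReal_mul (by positivity), one_div_mul_cancel (by positivity), ENNReal.ofReal_one]
    rw [← mul_one (c * _), ← h2, ← mul_assoc, ← hball, ENNReal.ofReal_one, one_pow, one_mul,
      ← ENNReal.ofReal_mul (by positivity)]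
    congr 1
    have hg : (0 : ℝ) < Gamma (((n : ℝ) + 2) / 2) := Gamma_pos_of_pos (by positivity)
    rw [Fintype.card_fin, Gamma_add_one (by positivity), Real.sqrt_eq_rpow, ← rpow_natCast,
      ← rpow_mul pi_pos.le]
    push_cast
    rw [show 1 / 2 * ((n : ℝ) + 2) = ((n : ℝ) + 2) / 2 by ring]
    field_simp
  have hS : MeasurableSet {y : EuclideanSpace ℝ (Fin (n + 2)) | 1 < ‖y‖ ∧ ‖y‖ < R} :=
    (measurableSet_lt measurable_const measurable_norm).inter
      (measurableSet_lt measurable_norm measurable_const)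
  have hnn : ∀ y ∈ {y : EuclideanSpace ℝ (Fin (n + 2)) | 1 < ‖y‖ ∧ ‖y‖ < R},
      0 ≤ (‖y‖ ^ 2 - 1) ^ α * ‖θ - y‖ ^ (-((n + 2 : ℕ) : ℝ)) := fun y hy ↦
    mul_nonneg (rpow_nonneg (by nlinarith [hy.1]) _) (by positivity)
  rw [integral_eq_lintegral_of_nonneg_ae ((ae_restrict_iff' hS).2 (.of_forall hnn))
    (by apply Measurable.aestronglyMeasurable; fun_prop), ← lintegral_indicator hS]
  have hmain := hc (fun p ↦ (Ioo 1 R).indicator (fun r ↦ ENNReal.ofReal ((r ^ 2 - 1) ^ α)) p.2 *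
    ENNReal.ofReal ((1 - 2 * p.1 + p.2 ^ 2) ^ (-((n : ℝ) + 2) / 2)))
    (((Measurable.indicator (by fun_prop) measurableSet_Ioo).comp measurable_snd).mul (by fun_prop))
  have hl : ∀ y : EuclideanSpace ℝ (Fin (n + 2)),
      {y : EuclideanSpace ℝ (Fin (n + 2)) | 1 < ‖y‖ ∧ ‖y‖ < R}.indicator (fun y ↦
        ENNReal.ofReal ((‖y‖ ^ 2 - 1) ^ α * ‖θ - y‖ ^ (-((n + 2 : ℕ) : ℝ)))) y =
      (Ioo 1 R).indicator (fun r ↦ ENNReal.ofReal ((r ^ 2 - 1) ^ α)) ‖y‖ *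
        ENNReal.ofReal ((1 - 2 * inner ℝ θ y + ‖y‖ ^ 2) ^ (-((n : ℝ) + 2) / 2)) := fun y ↦ by
    by_cases hy : y ∈ {y : EuclideanSpace ℝ (Fin (n + 2)) | 1 < ‖y‖ ∧ ‖y‖ < R}
    · rw [indicator_of_mem hy, indicator_of_mem (show ‖y‖ ∈ Ioo 1 R from hy),
        ENNReal.ofReal_mul (rpow_nonneg (by nlinarith [hy.1]) _)]
      congr 2
      have h := norm_sub_sq_real θ y
      rw [hθ, one_pow] at h
      rw [← h, ← rpow_natCast, ← rpow_mul (norm_nonneg _)]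
      congr 1; push_cast; ring
    · rw [indicator_of_notMem hy, indicator_of_notMem (show ‖y‖ ∉ Ioo 1 R from hy), zero_mul]
  have hr : ∫⁻ r in Ioi (0 : ℝ), ENNReal.ofReal (r ^ (n + 1)) *
        ∫⁻ φ in Ioo 0 π, ENNReal.ofReal (sin φ ^ n) *
          ((Ioo 1 R).indicator (fun r ↦ ENNReal.ofReal ((r ^ 2 - 1) ^ α)) r *
            ENNReal.ofReal ((1 - 2 * (r * cos φ) + r ^ 2) ^ (-((n : ℝ) + 2) / 2))) =
      ENNReal.ofReal A * ENNReal.ofReal ((R ^ 2 - 1) ^ α / (2 * α)) := by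
    rw [← lintegral_radial_weight hα hR, ← lintegral_const_mul _ (by fun_prop),
      ← lintegral_indicator measurableSet_Ioi, ← lintegral_indicator measurableSet_Ioo]
    refine lintegral_congr fun r ↦ ?_
    by_cases hr : r ∈ Ioo 1 R
    · have h1 : 1 < r := hr.1
      have h0 : 0 < r := by linarith
      have hq : 0 < r ^ 2 - 1 := by nlinarith
      obtain ⟨hi, he⟩ := integral_sin_pow_mul_rpow_poisson n h1
      rw [indicator_of_mem hr, indicator_of_mem (show r ∈ Ioi (0 : ℝ) from h0)]
      simp only [indicator_of_mem hr]
      have hp : ∀ φ ∈ Ioo 0 π, 0 ≤ sin φ ^ n * (1 - 2 * r * cos φ + r ^ 2) ^ (-((n : ℝ) + 2) / 2) :=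
        fun φ hφ ↦ mul_nonneg (pow_nonneg (sin_pos_of_mem_Ioo hφ).le _) <| rpow_nonneg (by
          nlinarith [cos_le_one φ, sq_nonneg (r - 1)]) _
      have hk := lintegral_Ioo_zero_pi hi hp
      have hstep : ∫⁻ φ in Ioo 0 π, ENNReal.ofReal (sin φ ^ n) * (ENNReal.ofReal ((r ^ 2 - 1) ^ α) *
            ENNReal.ofReal ((1 - 2 * (r * cos φ) + r ^ 2) ^ (-((n : ℝ) + 2) / 2))) =
          ENNReal.ofReal ((r ^ 2 - 1) ^ α) * ENNReal.ofReal (A / (r ^ n * (r ^ 2 - 1))) := by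
        rw [show A = _ from he.symm, mul_div_cancel_right₀ _ (by positivity), ← hk,
          ← lintegral_const_mul _ (by fun_prop)]
        refine setLIntegral_congr_fun measurableSet_Ioo fun φ hφ ↦ ?_
        rw [ENNReal.ofReal_mul (pow_nonneg (sin_pos_of_mem_Ioo hφ).le _), mul_assoc 2 r]
        ring
      rw [hstep, ← ENNReal.ofReal_mul (by positivity), ← ENNReal.ofReal_mul (by positivity),
        ← ENNReal.ofReal_mul (by positivity), rpow_sub_one hq.ne']
      congr 1
      field_simp
      ring
    · rw [indicator_of_notMem hr]
      simp [indicator, show ¬(1 < r ∧ r < R) from hr]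
  rw [lintegral_congr hl, hmain, hr, ← mul_assoc, hcA, ← ENNReal.ofReal_mul (by
    have := Gamma_pos_of_pos (show (0 : ℝ) < ((n + 2 : ℕ) : ℝ) / 2 by positivity)
    positivity), ENNReal.toReal_ofReal (by
    have := Gamma_pos_of_pos (show (0 : ℝ) < ((n + 2 : ℕ) : ℝ) / 2 by positivity)
    have : (0 : ℝ) < R ^ 2 - 1 := by nlinarith
    positivity)]
  field_simp
end

section
/- Let d ≥ 2 be an integer, let α ∈ (0,2), let S ⊆ S^{d-1} be a closed set with σ₁(S) > 0, and let x ∈ ℝ^d with |x| < 1. For 0 < ε < 1 set B_ε = {rθ : r ∈ (1−ε, 1), θ ∈ S}. Then lim_{ε → 0+} ε^{α/2−1} ∫_{B_ε} (|z|² − |x|²)^{α/2} (1 − |z|²)^{−α/2} |x − z|^{−d} dz = (2π^{d/2}/Γ(d/2)) · (2^{−α/2}/(1 − α/2)) · (1 − |x|²)^{α/2} ∫_{S} |x − θ|^{−d} σ₁(dθ), where the integral over B_ε is with respect to Lebesgue measure on ℝ^d. (The integrand on the left is taken to be the given expression whenever |x| < |z| < 1, which holds on B_ε for all small ε.) -/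
open MeasureTheory Metric Set Real Filter

/-- Integration in polar coordinates, with the radial variable ranging over `(0, ∞)`. -/
theorem integral_eq_integral_toSphere_prod {E : Type*} [NormedAddCommGroup E] [NormedSpace ℝ E]
    [FiniteDimensional ℝ E] [Nontrivial E] [MeasurableSpace E] [BorelSpace E] (μ : Measure E)
    [μ.IsAddHaarMeasure] (G : E → ℝ) :
    ∫ z, G z ∂μ = ∫ p : sphere (0 : E) 1 × ℝ,
      (Ioi 0).indicator (fun r : ℝ => r ^ (Module.finrank ℝ E - 1) * G (r • (p.1 : E))) p.2
        ∂(μ.toSphere.prod volume) := by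
  have hσ : SigmaFinite (Measure.comap (Subtype.val : Ioi (0 : ℝ) → ℝ) volume) := by
    refine SigmaFinite.of_map _ measurable_subtype_coe.aemeasurable ?_
    rw [map_comap_subtype_coe measurableSet_Ioi]
    infer_instance
  have hemb : MeasurableEmbedding
      (Prod.map id Subtype.val : sphere (0 : E) 1 × Ioi (0 : ℝ) → sphere (0 : E) 1 × ℝ) :=
    MeasurableEmbedding.id.prodMap (MeasurableEmbedding.subtype_coe measurableSet_Ioi)
  have hmap : (μ.toSphere.prod (Measure.comap Subtype.val volume)).map
      (Prod.map id Subtype.val : sphere (0 : E) 1 × Ioi (0 : ℝ) → sphere (0 : E) 1 × ℝ) =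
      (μ.toSphere.prod volume).restrict (univ ×ˢ Ioi 0) := by
    rw [← Measure.map_prod_map _ _ measurable_id measurable_subtype_coe, Measure.map_id,
      map_comap_subtype_coe measurableSet_Ioi, ← Measure.prod_restrict, Measure.restrict_univ]
  calc
    ∫ z, G z ∂μ = ∫ z : ({(0)}ᶜ : Set E), G z.1 ∂(μ.comap (↑)) := by
      rw [integral_subtype_comap (measurableSet_singleton _).compl fun x ↦ G x,
        restrict_compl_singleton]
    _ = ∫ p : sphere (0 : E) 1 × Ioi (0 : ℝ), G (p.2.1 • p.1.1)
          ∂μ.toSphere.prod (.volumeIoiPow (Module.finrank ℝ E - 1)) := by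
      rw [← μ.measurePreserving_homeomorphUnitSphereProd.integral_comp
        (Homeomorph.measurableEmbedding _)]
      refine integral_congr_ae (.of_forall fun z => ?_)
      have hz : ‖(z : E)‖ ≠ 0 := norm_ne_zero_iff.2 z.2
      simp [smul_smul, hz]
    _ = ∫ p : sphere (0 : E) 1 × Ioi (0 : ℝ),
          p.2.1 ^ (Module.finrank ℝ E - 1) * G (p.2.1 • p.1.1)
          ∂μ.toSphere.prod (Measure.comap Subtype.val volume) := by
      rw [Measure.volumeIoiPow, prod_withDensity_right (by fun_prop),
        integral_withDensity_eq_integral_toReal_smul (by fun_prop) (by simp)]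
      refine integral_congr_ae (.of_forall fun p => ?_)
      have hp : (0 : ℝ) < p.2.1 := p.2.2
      simp [ENNReal.toReal_ofReal (pow_pos hp _).le]
    _ = ∫ p in (univ ×ˢ Ioi 0 : Set (sphere (0 : E) 1 × ℝ)),
          p.2 ^ (Module.finrank ℝ E - 1) * G (p.2 • p.1.1) ∂(μ.toSphere.prod volume) := by
      rw [← hmap, hemb.integral_map]
      rfl
    _ = _ := by
      rw [← integral_indicator (MeasurableSet.univ.prod measurableSet_Ioi)]
      refine integral_congr_ae (.of_forall fun p => ?_)
      simp [indicator]

/-- The change of variables `r = 1 - ε t` in the second coordinate of a product. -/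
theorem integral_prod_comp_one_sub_mul {Ω : Type*} [MeasurableSpace Ω] (σ : Measure Ω)
    [SFinite σ] (F : Ω × ℝ → ℝ) {ε : ℝ} (hε : 0 < ε) :
    ∫ p, F p ∂(σ.prod volume) = ε * ∫ p, F (p.1, 1 - ε * p.2) ∂(σ.prod volume) := by
  have hemb : MeasurableEmbedding (fun t : ℝ => 1 - ε * t) :=
    (MeasurableEquiv.subLeft (1 : ℝ)).measurableEmbedding.comp
      (measurableEmbedding_mulLeft₀ hε.ne')
  have hvol : (volume : Measure ℝ).map (fun t : ℝ => 1 - ε * t) = ENNReal.ofReal ε⁻¹ • volume := by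
    have h := Real.map_volume_mul_left hε.ne'
    rw [abs_of_pos (inv_pos.2 hε)] at h
    have : (fun t : ℝ => 1 - ε * t) = (fun t => 1 - t) ∘ (ε * ·) := rfl
    rw [this, ← Measure.map_map (by fun_prop) (by fun_prop), h, Measure.map_smul,
      (Measure.measurePreserving_sub_left volume (1 : ℝ)).map_eq]
  have hmap : (σ.prod volume).map (Prod.map id (fun t : ℝ => 1 - ε * t)) =
      ENNReal.ofReal ε⁻¹ • σ.prod volume := by
    rw [← Measure.map_prod_map _ _ measurable_id hemb.measurable, Measure.map_id, hvol,
      Measure.prod_smul_right]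
  have h := (MeasurableEmbedding.id.prodMap hemb).integral_map (μ := σ.prod volume) F
  rw [hmap, integral_smul_measure, ENNReal.toReal_ofReal (inv_pos.2 hε).le, smul_eq_mul] at h
  change _ = ε * ∫ p, F (Prod.map id (fun t : ℝ => 1 - ε * t) p) ∂(σ.prod volume)
  rw [← h, mul_inv_cancel_left₀ hε.ne']

theorem integrableOn_Ioo_rpow_neg {a : ℝ} (ha : a < 1) :
    IntegrableOn (fun t : ℝ => t ^ (-a)) (Ioo 0 1) :=
  (intervalIntegral.integrableOn_Ioo_rpow_iff one_pos).2 (by linarith)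

theorem integral_Ioo_rpow_neg {a : ℝ} (ha : a < 1) :
    ∫ t in Ioo (0 : ℝ) 1, t ^ (-a) = 1 / (1 - a) := by
  rw [← integral_Ioc_eq_integral_Ioo, ← intervalIntegral.integral_of_le zero_le_one,
    integral_rpow (Or.inl (by linarith)), one_rpow, zero_rpow (by linarith)]
  ring

/-- A weighted average over a shell of thickness `ε` shrinking to the boundary `r = 1`. -/
theorem tendsto_integral_rpow_neg_mul_shell {K : Type*} [TopologicalSpace K] [CompactSpace K]
    [SecondCountableTopology K] [MeasurableSpace K] [OpensMeasurableSpace K]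
    (σ : Measure K) [IsFiniteMeasure σ] {T : Set K} (hT : MeasurableSet T) {a : ℝ} (ha : a < 1)
    {ρ : ℝ} (hρ : ρ < 1) (H : K × ℝ → ℝ) (hH : ContinuousOn H (univ ×ˢ Icc ρ 1)) :
    Tendsto (fun ε : ℝ => ∫ p in T ×ˢ Ioo (0 : ℝ) 1, p.2 ^ (-a) * H (p.1, 1 - ε * p.2)
        ∂(σ.prod volume)) (nhdsWithin 0 (Ioi 0))
      (nhds ((∫ θ in T, H (θ, 1) ∂σ) * (1 / (1 - a)))) := by
  have hm : MeasurableSet (T ×ˢ Ioo (0 : ℝ) 1) := hT.prod measurableSet_Ioo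
  obtain ⟨C, hC⟩ := (isCompact_univ.prod isCompact_Icc).exists_bound_of_continuousOn hH
  have hsmall : ∀ᶠ ε in nhdsWithin (0 : ℝ) (Ioi 0), ε ∈ Ioo 0 (1 - ρ) :=
    Ioo_mem_nhdsGT (by linarith)
  have hmem : ∀ ε ∈ Ioo 0 (1 - ρ), ∀ p ∈ T ×ˢ Ioo (0 : ℝ) 1,
      (p.1, 1 - ε * p.2) ∈ (univ ×ˢ Icc ρ 1 : Set (K × ℝ)) := by
    rintro ε ⟨h0, h1⟩ p ⟨-, h2, h3⟩
    refine ⟨mem_univ _, ?_, ?_⟩ <;> dsimp only <;> nlinarith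
  rw [← integral_Ioo_rpow_neg ha, ← setIntegral_prod_mul (fun θ => H (θ, 1)) (fun t : ℝ => t ^ (-a))]
  refine tendsto_integral_filter_of_dominated_convergence
    (fun p : K × ℝ => C * p.2 ^ (-a)) ?_ ?_ ?_ ?_
  · filter_upwards [hsmall] with ε hε
    refine ContinuousOn.aestronglyMeasurable ?_ hm
    refine ContinuousOn.mul ?_ ?_
    · exact continuousOn_snd.rpow_const fun p hp => Or.inl hp.2.1.ne'
    · exact hH.comp (by fun_prop) (hmem ε hε)
  · filter_upwards [hsmall] with ε hε
    filter_upwards [ae_restrict_mem hm] with p hp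
    rw [norm_mul, mul_comm, norm_of_nonneg (rpow_nonneg hp.2.1.le _)]
    exact mul_le_mul_of_nonneg_right (hC _ (hmem ε hε p hp)) (rpow_nonneg hp.2.1.le _)
  · rw [← Measure.prod_restrict]
    exact (Integrable.comp_snd (integrableOn_Ioo_rpow_neg ha) (σ.restrict T)).const_mul C
  · filter_upwards [ae_restrict_mem hm] with p hp
    rw [mul_comm (H _)]
    refine Tendsto.const_mul _ ?_
    have h1 : (p.1, (1 : ℝ)) ∈ (univ ×ˢ Icc ρ 1 : Set (K × ℝ)) :=
      ⟨mem_univ _, hρ.le, le_rfl⟩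
    refine (hH _ h1).tendsto.comp (tendsto_nhdsWithin_iff.2 ⟨?_, ?_⟩)
    · refine (Continuous.tendsto' ?_ 0 _ (by simp)).mono_left nhdsWithin_le_nhds
      fun_prop
    · filter_upwards [hsmall] with ε hε using hmem ε hε p hp

theorem toSphere_real_univ_euclideanSpace {d : ℕ} (hd : d ≠ 0) :
    (volume : Measure (EuclideanSpace ℝ (Fin d))).toSphere.real univ =
      2 * Real.pi ^ ((d : ℝ) / 2) / Real.Gamma ((d : ℝ) / 2) := by
  have : Nonempty (Fin d) := Fin.pos_iff_nonempty.1 (Nat.pos_of_ne_zero hd)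
  have hd' : (0 : ℝ) < d := Nat.cast_pos.2 (Nat.pos_of_ne_zero hd)
  have hG : Real.Gamma ((d : ℝ) / 2) ≠ 0 := (Real.Gamma_pos_of_pos (by positivity)).ne'
  rw [Measure.toSphere_real_apply_univ, finrank_euclideanSpace_fin, measureReal_def,
    EuclideanSpace.volume_ball, ENNReal.ofReal_one, one_pow, one_mul, Fintype.card_fin,
    ENNReal.toReal_ofReal (by positivity), Real.Gamma_add_one (by positivity),
    Real.sqrt_eq_rpow, ← Real.rpow_natCast, ← Real.rpow_mul Real.pi_pos.le]
  rw [show (1 / 2 * (d : ℝ)) = d / 2 by ring]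
  field_simp

/-- Integrals against `unifSphere` in terms of the unnormalised surface measure. -/
theorem toSphere_real_univ_mul_setIntegral_unifSphere {d : ℕ} (hd : d ≠ 0)
    {S : Set (EuclideanSpace ℝ (Fin d))} (f : EuclideanSpace ℝ (Fin d) → ℝ) :
    (volume : Measure (EuclideanSpace ℝ (Fin d))).toSphere.real univ *
        ∫ θ in S, f θ ∂(unifSphere d) =
      ∫ θ in (Subtype.val ⁻¹' S : Set (sphere (0 : EuclideanSpace ℝ (Fin d)) 1)), f θ
        ∂(volume : Measure (EuclideanSpace ℝ (Fin d))).toSphere := by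
  have hemb : MeasurableEmbedding
      (Subtype.val : sphere (0 : EuclideanSpace ℝ (Fin d)) 1 → EuclideanSpace ℝ (Fin d)) :=
    .subtype_coe isClosed_sphere.measurableSet
  have hne : (volume : Measure (EuclideanSpace ℝ (Fin d))).toSphere.real univ ≠ 0 := by
    have hd' : (0 : ℝ) < d := Nat.cast_pos.2 (Nat.pos_of_ne_zero hd)
    have := Real.Gamma_pos_of_pos (half_pos hd')
    rw [toSphere_real_univ_euclideanSpace hd]
    positivity
  simp only [unifSphere]
  rw [Measure.restrict_smul, integral_smul_measure, hemb.setIntegral_map, hemb.map_apply,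
    preimage_univ, ENNReal.toReal_inv, ← measureReal_def, smul_eq_mul, mul_inv_cancel_left₀ hne]

/-- Limiting normalised integral over the interior shell `B_ε = {rθ : r ∈ (1−ε,1), θ ∈ S}`:
`lim_{ε→0+} ε^{α/2−1} ∫_{B_ε} (|z|²−|x|²)^{α/2}(1−|z|²)^{−α/2}|x−z|^{−d} dz
  = (2π^{d/2}/Γ(d/2)) (2^{−α/2}/(1−α/2)) (1−|x|²)^{α/2} ∫_S |x−θ|^{−d} σ₁(dθ)` for `|x| < 1`. -/
theorem stmt10 (d : ℕ) (hd : 2 ≤ d) (α : ℝ) (hα : α ∈ Set.Ioo (0 : ℝ) 2)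
    (S : Set (EuclideanSpace ℝ (Fin d))) (hS : IsClosed S)
    (hSsub : S ⊆ sphere (0 : EuclideanSpace ℝ (Fin d)) 1) (hSpos : 0 < unifSphere d S)
    (x : EuclideanSpace ℝ (Fin d)) (hx : ‖x‖ < 1) :
    Tendsto (fun ε : ℝ =>
        ε ^ (α / 2 - 1) * ∫ z in {z : EuclideanSpace ℝ (Fin d) |
            ∃ r ∈ Set.Ioo (1 - ε) (1 : ℝ), ∃ θ ∈ S, z = r • θ},
          (‖z‖ ^ 2 - ‖x‖ ^ 2) ^ (α / 2) * (1 - ‖z‖ ^ 2) ^ (-α / 2) * ‖x - z‖ ^ (-(d : ℝ)))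
      (nhdsWithin 0 (Set.Ioi 0))
      (nhds ((2 * Real.pi ^ ((d : ℝ) / 2) / Real.Gamma ((d : ℝ) / 2)) *
        ((2 : ℝ) ^ (-α / 2) / (1 - α / 2)) *
        (1 - ‖x‖ ^ 2) ^ (α / 2) * ∫ θ in S, ‖x - θ‖ ^ (-(d : ℝ)) ∂(unifSphere d))) := by
  have hd0 : d ≠ 0 := by omega
  have : Nonempty (Fin d) := ⟨⟨0, by omega⟩⟩
  have : Nontrivial (EuclideanSpace ℝ (Fin d)) := inferInstance
  obtain ⟨hα0, hα2⟩ := hα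
  set T : Set (sphere (0 : EuclideanSpace ℝ (Fin d)) 1) := Subtype.val ⁻¹' S with hT
  have hTm : MeasurableSet T := measurable_subtype_coe hS.measurableSet
  have hx0 : 0 ≤ ‖x‖ := norm_nonneg x
  let ρ : ℝ := (1 + ‖x‖) / 2
  have hρ1 : ρ < 1 := by simp only [ρ]; linarith
  have hρx : ‖x‖ < ρ := by simp only [ρ]; linarith
  let H : sphere (0 : EuclideanSpace ℝ (Fin d)) 1 × ℝ → ℝ := fun p =>
    p.2 ^ (d - 1) * ((p.2 ^ 2 - ‖x‖ ^ 2) ^ (α / 2) * (1 + p.2) ^ (-α / 2) *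
      ‖x - p.2 • (p.1 : EuclideanSpace ℝ (Fin d))‖ ^ (-(d : ℝ)))
  have hH : ContinuousOn H (univ ×ˢ Icc ρ 1) := by
    have hr : ∀ p ∈ (univ ×ˢ Icc ρ 1 : Set (sphere (0 : EuclideanSpace ℝ (Fin d)) 1 × ℝ)),
        ‖x‖ < p.2 :=
      fun p hp => hρx.trans_le hp.2.1
    refine ContinuousOn.mul (by fun_prop) (ContinuousOn.mul (ContinuousOn.mul ?_ ?_) ?_)
    · exact ContinuousOn.rpow_const (by fun_prop) fun p _ => Or.inr (by linarith)
    · exact ContinuousOn.rpow_const (by fun_prop) fun p hp => Or.inl (by linarith [hr p hp])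
    · refine ContinuousOn.rpow_const (by fun_prop) fun p hp => Or.inl ?_
      have h := hr p hp
      have h0 : 0 ≤ p.2 := hx0.trans h.le
      rw [norm_ne_zero_iff, sub_ne_zero]
      intro hxp
      rw [hxp, norm_smul, norm_eq_of_mem_sphere, mul_one, norm_of_nonneg h0] at h
      exact lt_irrefl _ h
  have hlim := tendsto_integral_rpow_neg_mul_shell
    (volume : Measure (EuclideanSpace ℝ (Fin d))).toSphere hTm
    (show α / 2 < 1 by linarith) hρ1 H hH
  have hval : (∫ θ in T, H (θ, 1) ∂(volume : Measure (EuclideanSpace ℝ (Fin d))).toSphere) *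
      (1 / (1 - α / 2)) =
      (2 * Real.pi ^ ((d : ℝ) / 2) / Real.Gamma ((d : ℝ) / 2)) *
        ((2 : ℝ) ^ (-α / 2) / (1 - α / 2)) *
        (1 - ‖x‖ ^ 2) ^ (α / 2) * ∫ θ in S, ‖x - θ‖ ^ (-(d : ℝ)) ∂(unifSphere d) := by
    have hH1 : ∀ θ : sphere (0 : EuclideanSpace ℝ (Fin d)) 1, H (θ, 1) =
        ((1 - ‖x‖ ^ 2) ^ (α / 2) * 2 ^ (-α / 2)) * ‖x - θ‖ ^ (-(d : ℝ)) := by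
      intro θ
      simp only [H, one_pow, one_mul, one_smul]
      norm_num
    simp_rw [hH1]
    rw [integral_const_mul, ← toSphere_real_univ_mul_setIntegral_unifSphere hd0
      (fun θ => ‖x - θ‖ ^ (-(d : ℝ))), toSphere_real_univ_euclideanSpace hd0]
    ring
  rw [hval] at hlim
  refine hlim.congr' ?_
  filter_upwards [Ioo_mem_nhdsGT (zero_lt_one : (0 : ℝ) < 1)] with ε hε
  obtain ⟨hε0, hε1⟩ := hε
  set B : Set (EuclideanSpace ℝ (Fin d)) :=
    {z | ∃ r ∈ Ioo (1 - ε) (1 : ℝ), ∃ θ ∈ S, z = r • θ}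
  have hBmem : ∀ (θ : sphere (0 : EuclideanSpace ℝ (Fin d)) 1) (r : ℝ), 0 < r →
      (r • (θ : EuclideanSpace ℝ (Fin d)) ∈ B ↔ θ ∈ T ∧ r ∈ Ioo (1 - ε) 1) := by
    intro θ r hr
    constructor
    · rintro ⟨s, hs, η, hη, h⟩
      have hs0 : 0 < s := by linarith [hs.1]
      have hη1 : ‖η‖ = 1 := by simpa using hSsub hη
      have hrs : r = s := by
        have := congrArg norm h
        rwa [norm_smul, norm_smul, norm_eq_of_mem_sphere, hη1, mul_one, mul_one,
          norm_of_nonneg hr.le, norm_of_nonneg hs0.le] at this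
      subst hrs
      have : (θ : EuclideanSpace ℝ (Fin d)) = η :=
        smul_right_injective (EuclideanSpace ℝ (Fin d)) hr.ne' h
      exact ⟨by rw [hT, mem_preimage, this]; exact hη, hs⟩
    · rintro ⟨hθ, hr'⟩
      exact ⟨r, hr', θ, hθ, rfl⟩
  have hBm : MeasurableSet B := by
    have hBeq : B = {z : EuclideanSpace ℝ (Fin d) | ‖z‖ ∈ Ioo (1 - ε) 1 ∧ ‖z‖⁻¹ • z ∈ S} := by
      ext z
      constructor
      · rintro ⟨r, hr, θ, hθ, rfl⟩
        have hr0 : 0 < r := by linarith [hr.1]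
        have hθ1 : ‖θ‖ = 1 := by simpa using hSsub hθ
        have hn : ‖r • θ‖ = r := by rw [norm_smul, hθ1, mul_one, norm_of_nonneg hr0.le]
        refine ⟨by rwa [hn], ?_⟩
        rwa [hn, smul_smul, inv_mul_cancel₀ hr0.ne', one_smul]
      · rintro ⟨hz, hzS⟩
        have hz0 : ‖z‖ ≠ 0 := by linarith [hz.1]
        exact ⟨‖z‖, hz, _, hzS, by rw [smul_smul, mul_inv_cancel₀ hz0, one_smul]⟩
    rw [hBeq]
    exact (measurable_norm measurableSet_Ioo).inter
      ((measurable_norm.inv.smul measurable_id) hS.measurableSet)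
  rw [← integral_indicator hBm,
    integral_eq_integral_toSphere_prod (volume : Measure (EuclideanSpace ℝ (Fin d))),
    integral_prod_comp_one_sub_mul _ _ hε0, ← mul_assoc, ← rpow_add_one hε0.ne',
    sub_add_cancel, ← integral_const_mul, ← integral_indicator (hTm.prod measurableSet_Ioo)]
  refine integral_congr_ae (.of_forall fun p => ?_)
  obtain ⟨θ, t⟩ := p
  have hfin : Module.finrank ℝ (EuclideanSpace ℝ (Fin d)) = d := finrank_euclideanSpace_fin
  by_cases hr : 0 < 1 - ε * t
  · have hiff : (θ, t) ∈ T ×ˢ Ioo (0 : ℝ) 1 ↔ (1 - ε * t) • (θ : EuclideanSpace ℝ (Fin d)) ∈ B := by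
      rw [hBmem θ _ hr, mem_prod, mem_Ioo, mem_Ioo]
      refine and_congr_right fun _ => ⟨fun h => ⟨?_, ?_⟩, fun h => ⟨?_, ?_⟩⟩
      · nlinarith [h.2]
      · nlinarith [h.1]
      · exact pos_of_mul_pos_right (by linarith [h.2]) hε0.le
      · exact lt_of_mul_lt_mul_left (by linarith [h.1]) hε0.le
    simp only [indicator_of_mem (mem_Ioi.2 hr), hfin]
    by_cases hp : (θ, t) ∈ T ×ˢ Ioo (0 : ℝ) 1
    · have ht0 : 0 < t := hp.2.1
      rw [indicator_of_mem hp, indicator_of_mem (hiff.1 hp), norm_smul, norm_eq_of_mem_sphere,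
        mul_one, norm_of_nonneg hr.le]
      have hfac : (1 - (1 - ε * t) ^ 2) ^ (-α / 2) =
          ε ^ (-α / 2) * t ^ (-α / 2) * (1 + (1 - ε * t)) ^ (-α / 2) := by
        rw [← mul_rpow hε0.le ht0.le, ← mul_rpow (by positivity) (by linarith)]
        ring_nf
      have hcancel : ε ^ (α / 2) * ε ^ (-α / 2) = 1 := by
        rw [← rpow_add hε0, neg_div, add_neg_cancel, rpow_zero]
      simp only [H, hfac, ← neg_div]
      linear_combination (-(t ^ (-α / 2) * ((1 - ε * t) ^ (d - 1) *
        (((1 - ε * t) ^ 2 - ‖x‖ ^ 2) ^ (α / 2) * (1 + (1 - ε * t)) ^ (-α / 2) *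
          ‖x - (1 - ε * t) • (θ : EuclideanSpace ℝ (Fin d))‖ ^ (-(d : ℝ)))))) * hcancel
    · rw [indicator_of_notMem hp, indicator_of_notMem (hiff.not.1 hp), mul_zero, mul_zero]
  · have hp : (θ, t) ∉ T ×ˢ Ioo (0 : ℝ) 1 := fun hp => hr (by nlinarith [hp.2.1, hp.2.2])
    simp only [indicator_of_notMem hp, indicator_of_notMem (show (1 - ε * t) ∉ Ioi (0 : ℝ) from hr),
      mul_zero]
end

section
/- Let d ≥ 2 be an integer, let α ∈ (0,2), let S' ⊆ S ⊆ S^{d-1} be closed sets with σ₁(S) > 0, and let x ∈ ℝ^d with |x| > 1. For 0 < ε < 1 set A_ε = {rθ : r ∈ (1, 1+ε), θ ∈ S} and A'_ε = {rθ : r ∈ (1, 1+ε), θ ∈ S'}. Then lim_{ε → 0+} [∫_{A'_ε} (|x|² − |z|²)^{α/2} |z|^{−α} |x − z|^{−d} dz] / [∫_{A_ε} (|x|² − |z|²)^{α/2} |z|^{−α} |x − z|^{−d} dz] = [∫_{S'} |θ − x|^{−d} σ₁(dθ)] / [∫_{S} |θ − x|^{−d} σ₁(dθ)], where the integrals over A_ε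 and A'_ε are with respect to Lebesgue measure on ℝ^d. -/
open MeasureTheory Metric Set Real Filter

open Measure in
/-- The radial measure of a bounded shell interval to the right of `1` is positive and finite. -/
lemma volumeIoiPow_real_Ioo_pos (n : ℕ) {ε : ℝ} (hε : 0 < ε) :
    0 < (volumeIoiPow n).real {r : Ioi (0 : ℝ) | (r : ℝ) ∈ Ioo 1 (1 + ε)} := by
  have hm : MeasurableSet {r : Ioi (0 : ℝ) | (r : ℝ) ∈ Ioo 1 (1 + ε)} :=
    measurable_subtype_coe measurableSet_Ioo
  refine ENNReal.toReal_pos ?_ ?_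
  · intro h0
    rw [volumeIoiPow, withDensity_apply_eq_zero (by fun_prop)] at h0
    have hset : {r : Ioi (0 : ℝ) | ENNReal.ofReal ((r : ℝ) ^ n) ≠ 0} ∩
        {r : Ioi (0 : ℝ) | (r : ℝ) ∈ Ioo 1 (1 + ε)} =
        {r : Ioi (0 : ℝ) | (r : ℝ) ∈ Ioo 1 (1 + ε)} := by
      refine inter_eq_right.2 fun r _ => ?_
      have : (0 : ℝ) < r := r.2
      simpa using pow_pos this n
    rw [hset, comap_subtype_coe_apply measurableSet_Ioi] at h0
    have himg : Subtype.val '' {r : Ioi (0 : ℝ) | (r : ℝ) ∈ Ioo 1 (1 + ε)} = Ioo 1 (1 + ε) := by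
      refine Set.Subset.antisymm (by rintro _ ⟨r, hr, rfl⟩; exact hr) fun r hr => ?_
      exact ⟨⟨r, zero_lt_one.trans hr.1⟩, hr, rfl⟩
    rw [himg] at h0
    simp only [Real.volume_Ioo, ENNReal.ofReal_eq_zero] at h0
    linarith
  · refine ne_top_of_le_ne_top (b := volumeIoiPow n (Iio ⟨1 + ε, by simp only [mem_Ioi]; linarith⟩))
      ?_ (measure_mono fun r hr => ?_)
    · simp [volumeIoiPow_apply_Iio]
    · exact show (r : ℝ) < 1 + ε from hr.2

section Shell

variable {E : Type*} [NormedAddCommGroup E] [NormedSpace ℝ E] [MeasurableSpace E]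

/-- The exterior shell over a set of directions. -/
def extShell (T : Set E) (ε : ℝ) : Set E :=
  {z | ∃ r ∈ Ioo (1 : ℝ) (1 + ε), ∃ θ ∈ T, z = r • θ}

variable [BorelSpace E] [FiniteDimensional ℝ E] [Nontrivial E]
  (μ : Measure E) [μ.IsAddHaarMeasure]

open Measure in
/-- Polar coordinates for the integral over an exterior shell. -/
lemma setIntegral_extShell (f : E → ℝ) (T : Set (sphere (0 : E) 1)) (ε : ℝ) :
    ∫ z in extShell (Subtype.val '' T) ε, f z ∂μ =
      ∫ p in T ×ˢ {r : Ioi (0 : ℝ) | (r : ℝ) ∈ Ioo 1 (1 + ε)}, f ((p.2 : ℝ) • (p.1 : E))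
        ∂(μ.toSphere.prod (volumeIoiPow (Module.finrank ℝ E - 1))) := by
  have h0 : MeasurableSet ({0}ᶜ : Set E) := (measurableSet_singleton _).compl
  have hmp := MeasurePreserving.comp
    (⟨measurable_subtype_coe, map_comap_subtype_coe h0 μ⟩ :
      MeasurePreserving (Subtype.val : ({0}ᶜ : Set E) → E) (μ.comap (↑)) (μ.restrict {0}ᶜ))
    (μ.measurePreserving_homeomorphUnitSphereProd.symm
      (homeomorphUnitSphereProd E).toMeasurableEquiv)
  have hemb : MeasurableEmbedding
      ((Subtype.val : ({0}ᶜ : Set E) → E) ∘ (homeomorphUnitSphereProd E).toMeasurableEquiv.symm) :=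
    (MeasurableEmbedding.subtype_coe h0).comp (MeasurableEquiv.measurableEmbedding _)
  have key := hmp.setIntegral_preimage_emb hemb f (extShell (Subtype.val '' T) ε)
  rw [restrict_compl_singleton] at key
  rw [← key]
  have hval : ∀ p : sphere (0 : E) 1 × Ioi (0 : ℝ),
      ((Subtype.val : ({0}ᶜ : Set E) → E) ∘
        (homeomorphUnitSphereProd E).toMeasurableEquiv.symm) p = (p.2 : ℝ) • (p.1 : E) :=
    fun p => rfl
  simp only [hval]
  congr 2
  ext ⟨θ, r⟩
  have hr : (0 : ℝ) < r := r.2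
  have hθ : ‖(θ : E)‖ = 1 := by simp
  simp only [mem_preimage, hval, extShell, mem_image, mem_ofPred_eq, mem_prod]
  constructor
  · rintro ⟨s, hs, _, ⟨φ, hφ, rfl⟩, h⟩
    have hs0 : (0 : ℝ) < s := zero_lt_one.trans hs.1
    have hrs : (r : ℝ) = s := by
      have := congrArg norm h
      simpa [norm_smul, abs_of_pos hr, abs_of_pos hs0] using this
    rw [hrs] at h
    have : θ = φ := Subtype.ext (smul_right_injective E hs0.ne' h)
    exact ⟨this ▸ hφ, hrs ▸ hs⟩
  · rintro ⟨hθT, hrI⟩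
    exact ⟨r, hrI, θ, ⟨θ, hθT, rfl⟩, rfl⟩

open Measure in
/-- Averages over thin exterior shells converge to integrals over the sphere. -/
lemma tendsto_setIntegral_extShell {f : E → ℝ} {ρ : ℝ} (hρ : 1 < ρ)
    (hf : ContinuousOn f (closedBall 0 ρ \ ball 0 1)) {T : Set (sphere (0 : E) 1)}
    (hT : MeasurableSet T) :
    Tendsto (fun ε => (∫ z in extShell (Subtype.val '' T) ε, f z ∂μ) /
        (volumeIoiPow (Module.finrank ℝ E - 1)).real {r : Ioi (0 : ℝ) | (r : ℝ) ∈ Ioo 1 (1 + ε)})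
      (nhdsWithin 0 (Ioi 0)) (nhds (∫ θ in T, f θ ∂μ.toSphere)) := by
  have hK : IsCompact (closedBall (0 : E) ρ \ ball 0 1) :=
    (isCompact_closedBall (0 : E) ρ).diff isOpen_ball
  have huc := Metric.uniformContinuousOn_iff.1 (hK.uniformContinuousOn_of_continuous hf)
  have hmem : ∀ (θ : sphere (0 : E) 1) (r : ℝ), 1 ≤ r → r ≤ ρ →
      r • (θ : E) ∈ closedBall (0 : E) ρ \ ball 0 1 := by
    intro θ r h1 h2
    simp [norm_smul, abs_of_nonneg (zero_le_one.trans h1), h1, h2]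
  set V := volumeIoiPow (Module.finrank ℝ E - 1) with hV
  set M : ℝ := μ.toSphere.real T with hM
  have hM0 : 0 ≤ M := measureReal_nonneg
  rw [Metric.tendsto_nhds]
  intro η hη
  obtain ⟨δ, hδ, hδf⟩ := huc (η / (M + 1)) (by positivity)
  have hev : Ioo 0 (min δ (ρ - 1)) ∈ nhdsWithin (0 : ℝ) (Ioi 0) :=
    Ioo_mem_nhdsGT (lt_min hδ (by linarith))
  filter_upwards [hev] with ε hε
  have hεδ : ε < δ := hε.2.trans_le (min_le_left _ _)
  have hερ : ε < ρ - 1 := hε.2.trans_le (min_le_right _ _)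
  set I : Set (Ioi (0 : ℝ)) := {r | (r : ℝ) ∈ Ioo 1 (1 + ε)} with hI
  have hIm : MeasurableSet I := measurable_subtype_coe measurableSet_Ioo
  have hc : 0 < V.real I := volumeIoiPow_real_Ioo_pos _ hε.1
  have hVI : V I ≠ ⊤ := fun h => by simp [Measure.real, h] at hc
  have hfin : (μ.toSphere.prod V) (T ×ˢ I) ≠ ⊤ := by
    rw [prod_prod]; exact ENNReal.mul_ne_top (measure_ne_top _ _) hVI
  have hreal : (μ.toSphere.prod V).real (T ×ˢ I) = M * V.real I := by
    simp [Measure.real, prod_prod, hM]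
  have hfc : Continuous fun θ : sphere (0 : E) 1 => f θ := by
    refine hf.comp_continuous continuous_subtype_val fun θ => ?_
    simpa using hmem θ 1 le_rfl hρ.le
  have hbound : ∀ p ∈ T ×ˢ I, ‖f ((p.2 : ℝ) • (p.1 : E)) - f p.1‖ ≤ η / (M + 1) := by
    rintro ⟨θ, r⟩ ⟨-, hr⟩
    rw [← dist_eq_norm]
    refine (hδf _ (hmem θ r hr.1.le (by linarith [hr.2])) _
      (by simpa using hmem θ 1 le_rfl hρ.le) ?_).le
    have : (r : ℝ) • (θ : E) - θ = ((r : ℝ) - 1) • (θ : E) := by rw [sub_smul, one_smul]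
    rw [dist_eq_norm, this, norm_smul, Real.norm_eq_abs, abs_of_pos (by linarith [hr.1])]
    simp only [norm_eq_of_mem_sphere, mul_one]
    linarith [hr.2]
  have hint1 : IntegrableOn (fun p : sphere (0 : E) 1 × Ioi (0 : ℝ) => f p.1) (T ×ˢ I)
      (μ.toSphere.prod V) := by
    obtain ⟨C, hC⟩ := (isCompact_range hfc).isBounded.exists_norm_le
    refine Measure.integrableOn_of_bounded hfin
      (hfc.comp continuous_fst).aestronglyMeasurable (M := C) ?_
    exact Eventually.of_forall fun p => hC _ (mem_range_self p.1)
  have hint2 : IntegrableOn (fun p : sphere (0 : E) 1 × Ioi (0 : ℝ) =>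
      f ((p.2 : ℝ) • (p.1 : E)) - f p.1) (T ×ˢ I) (μ.toSphere.prod V) := by
    have hcont : ContinuousOn (fun p : sphere (0 : E) 1 × Ioi (0 : ℝ) => f ((p.2 : ℝ) • (p.1 : E)))
        (T ×ˢ I) := by
      refine hf.comp (by fun_prop) ?_
      rintro ⟨θ, r⟩ ⟨-, hr⟩
      exact hmem θ r hr.1.le (by linarith [hr.2])
    exact IntegrableOn.of_bound (lt_top_iff_ne_top.2 hfin)
      ((hcont.sub (hfc.comp continuous_fst).continuousOn).aestronglyMeasurable (hT.prod hIm)) _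
      ((ae_restrict_iff' (hT.prod hIm)).2 (Eventually.of_forall hbound))
  have hfst : ∫ p in T ×ˢ I, f p.1 ∂(μ.toSphere.prod V) =
      V.real I * ∫ θ in T, f θ ∂μ.toSphere := by
    rw [← Measure.prod_restrict]
    have := integral_fun_fst (μ := μ.toSphere.restrict T) (ν := V.restrict I)
      (fun θ : sphere (0 : E) 1 => f θ)
    rw [this]
    simp
  have hsplit : ∫ z in extShell (Subtype.val '' T) ε, f z ∂μ =
      (∫ p in T ×ˢ I, (f ((p.2 : ℝ) • (p.1 : E)) - f p.1) ∂(μ.toSphere.prod V)) +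
        V.real I * ∫ θ in T, f θ ∂μ.toSphere := by
    rw [setIntegral_extShell, ← hfst, ← integral_add hint2 hint1]
    simp only [sub_add_cancel, hI, hV]
  have hle := norm_setIntegral_le_of_norm_le_const (lt_top_iff_ne_top.2 hfin) hbound
  rw [hreal] at hle
  rw [Real.dist_eq, hsplit, add_div, mul_div_cancel_left₀ _ hc.ne', add_sub_cancel_right, abs_div,
    abs_of_pos hc, div_lt_iff₀ hc]
  refine hle.trans_lt ?_
  rw [← mul_assoc]
  refine mul_lt_mul_of_pos_right ?_ hc
  rw [div_mul_eq_mul_div, div_lt_iff₀ (by positivity)]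
  nlinarith

end Shell

/-- Integrals against `unifSphere` in terms of `Measure.toSphere`. -/
lemma setIntegral_unifSphere (d : ℕ) (g : EuclideanSpace ℝ (Fin d) → ℝ)
    (T : Set (EuclideanSpace ℝ (Fin d))) :
    ∫ θ in T, g θ ∂(unifSphere d) =
      ((((volume : Measure (EuclideanSpace ℝ (Fin d))).toSphere univ)⁻¹).toReal) *
        ∫ θ in Subtype.val ⁻¹' T, g θ ∂(volume : Measure (EuclideanSpace ℝ (Fin d))).toSphere := by
  have hemb : MeasurableEmbedding (Subtype.val : sphere (0 : EuclideanSpace ℝ (Fin d)) 1 → _) :=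
    MeasurableEmbedding.subtype_coe isClosed_sphere.measurableSet
  simp only [unifSphere]
  rw [Measure.restrict_smul, integral_smul_measure, hemb.setIntegral_map, hemb.map_apply,
    preimage_univ, smul_eq_mul]

/-- Limiting ratio of integrals over exterior shells over `S' ⊆ S` equals the ratio of the
corresponding surface integrals. -/
theorem stmt11 (d : ℕ) (hd : 2 ≤ d) (α : ℝ) (hα : α ∈ Set.Ioo (0 : ℝ) 2)
    (S' S : Set (EuclideanSpace ℝ (Fin d))) (hS' : IsClosed S') (hS : IsClosed S)
    (hsub : S' ⊆ S) (hSsub : S ⊆ sphere (0 : EuclideanSpace ℝ (Fin d)) 1)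
    (hSpos : 0 < unifSphere d S)
    (x : EuclideanSpace ℝ (Fin d)) (hx : 1 < ‖x‖) :
    Tendsto (fun ε : ℝ =>
        (∫ z in {z : EuclideanSpace ℝ (Fin d) |
            ∃ r ∈ Set.Ioo (1 : ℝ) (1 + ε), ∃ θ ∈ S', z = r • θ},
          (‖x‖ ^ 2 - ‖z‖ ^ 2) ^ (α / 2) * ‖z‖ ^ (-α) * ‖x - z‖ ^ (-(d : ℝ))) /
        (∫ z in {z : EuclideanSpace ℝ (Fin d) |
            ∃ r ∈ Set.Ioo (1 : ℝ) (1 + ε), ∃ θ ∈ S, z = r • θ},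
          (‖x‖ ^ 2 - ‖z‖ ^ 2) ^ (α / 2) * ‖z‖ ^ (-α) * ‖x - z‖ ^ (-(d : ℝ))))
      (nhdsWithin 0 (Set.Ioi 0))
      (nhds ((∫ θ in S', ‖θ - x‖ ^ (-(d : ℝ)) ∂(unifSphere d)) /
        (∫ θ in S, ‖θ - x‖ ^ (-(d : ℝ)) ∂(unifSphere d)))) := by
  have : Nontrivial (EuclideanSpace ℝ (Fin d)) := by
    have : Nonempty (Fin d) := ⟨⟨0, by lia⟩⟩
    infer_instance
  set ν : Measure (sphere (0 : EuclideanSpace ℝ (Fin d)) 1) :=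
    (volume : Measure (EuclideanSpace ℝ (Fin d))).toSphere
  have hαp : 0 ≤ α / 2 := by linarith [hα.1]
  set f : EuclideanSpace ℝ (Fin d) → ℝ := fun z =>
    (‖x‖ ^ 2 - ‖z‖ ^ 2) ^ (α / 2) * ‖z‖ ^ (-α) * ‖x - z‖ ^ (-(d : ℝ)) with hf
  have hfc : ContinuousOn f (closedBall 0 ((1 + ‖x‖) / 2) \ ball 0 1) := by
    have hz : ∀ z ∈ closedBall (0 : EuclideanSpace ℝ (Fin d)) ((1 + ‖x‖) / 2) \ ball 0 1,
        1 ≤ ‖z‖ ∧ ‖z‖ < ‖x‖ := by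
      rintro z ⟨h1, h2⟩
      simp only [mem_closedBall, dist_zero_right, mem_ball, not_lt] at h1 h2
      exact ⟨h2, by linarith⟩
    refine ContinuousOn.mul (ContinuousOn.mul ?_ ?_) ?_
    · exact ContinuousOn.rpow_const (by fun_prop) fun z _ => Or.inr hαp
    · exact ContinuousOn.rpow_const (by fun_prop) fun z h => Or.inl (by linarith [(hz z h).1])
    · refine ContinuousOn.rpow_const (by fun_prop) fun z h => Or.inl ?_
      rw [norm_ne_zero_iff, sub_ne_zero]
      rintro rfl
      exact (hz _ h).2.false
  have hlim : ∀ T : Set (EuclideanSpace ℝ (Fin d)), IsClosed T → T ⊆ sphere 0 1 →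
      Tendsto (fun ε => (∫ z in extShell T ε, f z) /
        (Measure.volumeIoiPow (Module.finrank ℝ (EuclideanSpace ℝ (Fin d)) - 1)).real
          {r : Ioi (0 : ℝ) | (r : ℝ) ∈ Ioo 1 (1 + ε)})
      (nhdsWithin 0 (Ioi 0)) (nhds (∫ θ in Subtype.val ⁻¹' T, f θ ∂ν)) := by
    intro T hT hTs
    have := tendsto_setIntegral_extShell (volume : Measure (EuclideanSpace ℝ (Fin d)))
      (by linarith) hfc
      (T := Subtype.val ⁻¹' T) (measurable_subtype_coe hT.measurableSet)
    rwa [Subtype.image_preimage_coe, inter_eq_right.2 hTs] at this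
  set k : ℝ := (‖x‖ ^ 2 - 1) ^ (α / 2) with hk
  have hkpos : 0 < k := Real.rpow_pos_of_pos (by nlinarith) _
  have hfS : ∀ θ : sphere (0 : EuclideanSpace ℝ (Fin d)) 1,
      f θ = k * ‖(θ : EuclideanSpace ℝ (Fin d)) - x‖ ^ (-(d : ℝ)) := by
    intro θ
    simp [hf, hk, norm_sub_rev x]
  set c : ℝ := ((ν univ)⁻¹).toReal with hc
  have hν0 : ν ≠ 0 := Measure.toSphere_ne_zero _
  have hcpos : 0 < c :=
    ENNReal.toReal_pos (by simp [measure_ne_top]) (by simpa using hν0)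
  have hνS : 0 < ν (Subtype.val ⁻¹' S) := by
    have h := hSpos
    simp only [unifSphere, Measure.smul_apply, smul_eq_mul] at h
    rw [Measure.map_apply measurable_subtype_coe hS.measurableSet] at h
    exact pos_of_ne_zero (right_ne_zero_of_mul h.ne')
  have hgpos : ∀ θ : sphere (0 : EuclideanSpace ℝ (Fin d)) 1,
      0 < ‖(θ : EuclideanSpace ℝ (Fin d)) - x‖ := by
    intro θ
    rw [norm_pos_iff, sub_ne_zero]
    rintro h
    have : ‖(θ : EuclideanSpace ℝ (Fin d))‖ = 1 := by simp
    rw [h] at this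
    linarith
  have hgc : Continuous fun θ : sphere (0 : EuclideanSpace ℝ (Fin d)) 1 =>
      ‖(θ : EuclideanSpace ℝ (Fin d)) - x‖ ^ (-(d : ℝ)) :=
    Continuous.rpow_const (by fun_prop) fun θ => Or.inl (hgpos θ).ne'
  have hpos : 0 < ∫ θ in Subtype.val ⁻¹' S,
      ‖(θ : EuclideanSpace ℝ (Fin d)) - x‖ ^ (-(d : ℝ)) ∂ν := by
    rw [integral_pos_iff_support_of_nonneg]
    · have hsupp : Function.support (fun θ : sphere (0 : EuclideanSpace ℝ (Fin d)) 1 =>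
          ‖(θ : EuclideanSpace ℝ (Fin d)) - x‖ ^ (-(d : ℝ)))
          = univ := eq_univ_of_forall fun θ => (Real.rpow_pos_of_pos (hgpos θ) _).ne'
      rw [hsupp]
      simpa using hνS
    · exact fun θ => (Real.rpow_pos_of_pos (hgpos θ) _).le
    · exact (hgc.integrable_of_hasCompactSupport
        (HasCompactSupport.of_compactSpace _)).integrableOn
  have hlim' := (hlim S' hS' (hsub.trans hSsub)).div (hlim S hS hSsub) (by
    simp only [hfS, integral_const_mul]
    exact (mul_pos hkpos hpos).ne')
  simp only [hfS, integral_const_mul] at hlim'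
  rw [mul_div_mul_left _ _ hkpos.ne'] at hlim'
  rw [setIntegral_unifSphere, setIntegral_unifSphere, mul_div_mul_left _ _ hcpos.ne']
  refine hlim'.congr' ?_
  filter_upwards [self_mem_nhdsWithin] with ε hε
  exact div_div_div_cancel_right₀ (volumeIoiPow_real_Ioo_pos _ hε).ne' _ _
end

section
/- Let d ≥ 2 be an integer, let ν > 0 be a real number, and let 0 < a < r be real numbers. Then ∫₀^π (sin φ)^{d−2} (a² + 2ar cos φ + r²)^{−ν} dφ = r^{−2ν} B((d−1)/2, 1/2) · Σ_{n=0}^∞ [ (ν)_n (ν − d/2 + 1)_n / ((d/2)_n · n!) ] (a/r)^{2n}, where (q)_n = q(q+1)···(q+n−1) denotes the ascending Pochhammer symbol (with (q)_0 = 1), B(x,y) = Γ(x)Γ(y)/Γ(x+y) is the Beta function, and the series converges absolutely since a/r < 1. -/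
open MeasureTheory Metric Set Real Filter Polynomial

theorem ascPochhammer_eval_succ_left {R : Type*} [CommSemiring R] (n : ℕ) (q : R) :
    (ascPochhammer R (n + 1)).eval q = q * (ascPochhammer R n).eval (q + 1) := by
  simp [ascPochhammer_succ_left]

theorem ascPochhammer_eval_add {R : Type*} [CommSemiring R] (m n : ℕ) (q : R) :
    (ascPochhammer R (m + n)).eval q =
      (ascPochhammer R m).eval q * (ascPochhammer R n).eval (q + m) := by
  simp [← ascPochhammer_mul]

/-- The `n`-th forward difference of `k ↦ (b)_k / (c)_k`. -/
theorem fwdDiff_iter_ascPochhammer_div (n : ℕ) (b c : ℝ) (hc : 0 < c) (k : ℕ) :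
    (fwdDiff 1)^[n]
        (fun k : ℕ => (ascPochhammer ℝ k).eval b / (ascPochhammer ℝ k).eval c) k =
      (descPochhammer ℝ n).eval (b - c) / (ascPochhammer ℝ n).eval c *
        ((ascPochhammer ℝ k).eval b / (ascPochhammer ℝ k).eval (c + n)) := by
  induction n generalizing k with
  | zero => simp
  | succ n ih =>
    have hcn : 0 < c + n := by positivity
    have h1 := ascPochhammer_pos n c hc
    have h2 := ascPochhammer_pos k (c + n) hcn
    have h3 := ascPochhammer_pos k (c + n + 1) (by positivity)
    have h4 : (ascPochhammer ℝ k).eval (c + n) * (c + n + k) =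
        (c + n) * (ascPochhammer ℝ k).eval (c + n + 1) := by
      rw [← ascPochhammer_succ_eval, ascPochhammer_eval_succ_left]
    have hk : 0 < c + n + k := by positivity
    have h5 : (ascPochhammer ℝ k).eval (c + n + 1) =
        (ascPochhammer ℝ k).eval (c + n) * (c + n + k) / (c + n) := by
      rw [h4]; field_simp
    rw [Function.iterate_succ_apply', fwdDiff, ih, ih]
    simp only [ascPochhammer_succ_eval, descPochhammer_succ_eval]
    push_cast
    rw [← add_assoc, h5]
    field_simp
    ring

/-- The Chu–Vandermonde identity for ascending Pochhammer symbols. -/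
theorem sum_antidiagonal_ascPochhammer_div (n : ℕ) (b c : ℝ) (hc : 0 < c) :
    ∑ p ∈ Finset.HasAntidiagonal.antidiagonal n, (-1) ^ p.2 * (ascPochhammer ℝ p.1).eval b /
        ((ascPochhammer ℝ p.1).eval c * p.1.factorial * p.2.factorial) =
      (descPochhammer ℝ n).eval (b - c) / ((ascPochhammer ℝ n).eval c * n.factorial) := by
  have h := fwdDiff_iter_ascPochhammer_div n b c hc 0
  rw [fwdDiff_iter_eq_sum_shift] at h
  rw [Finset.Nat.sum_antidiagonal_eq_sum_range_succ
    (fun i j => (-1) ^ j * (ascPochhammer ℝ i).eval b /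
        ((ascPochhammer ℝ i).eval c * i.factorial * j.factorial))]
  have hn : (n.factorial : ℝ) ≠ 0 := by positivity
  simp only [ascPochhammer_zero, eval_one, div_one, mul_one] at h
  rw [← div_div, ← h, eq_div_iff hn, Finset.sum_mul]
  refine Finset.sum_congr rfl fun k hk => ?_
  have hkn : k ≤ n := by simpa [Nat.lt_succ_iff] using hk
  have h1 := (ascPochhammer_pos k c hc).ne'
  rw [zsmul_eq_mul]
  push_cast
  rw [Nat.cast_choose ℝ hkn]
  simp only [zero_add, smul_eq_mul, mul_one]
  field_simp

/-- The convolution identity behind the quadratic transformation of `₂F₁`. -/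
theorem sum_antidiagonal_ascPochhammer_two_mul (n : ℕ) (ν c : ℝ) (hc : 0 < c) :
    ∑ p ∈ Finset.HasAntidiagonal.antidiagonal n, (ascPochhammer ℝ (2 * p.1)).eval ν /
        (p.1.factorial * (ascPochhammer ℝ p.1).eval c) *
        ((ascPochhammer ℝ p.2).eval (ν + 2 * p.1) / p.2.factorial * (-1) ^ p.2) =
      (ascPochhammer ℝ n).eval ν * (ascPochhammer ℝ n).eval (ν - c + 1) /
        ((ascPochhammer ℝ n).eval c * n.factorial) := by
  have h := sum_antidiagonal_ascPochhammer_div n (ν + n) c hc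
  rw [descPochhammer_eval_eq_ascPochhammer,
    show ν + n - c - n + 1 = ν - c + 1 by ring] at h
  rw [mul_div_assoc, ← h, Finset.mul_sum]
  refine Finset.sum_congr rfl fun p hp => ?_
  have hp' : p.1 + p.2 = n := by simpa using hp
  have e : (ascPochhammer ℝ (2 * p.1)).eval ν * (ascPochhammer ℝ p.2).eval (ν + 2 * p.1) =
      (ascPochhammer ℝ n).eval ν * (ascPochhammer ℝ p.1).eval (ν + n) := by
    have h1 := ascPochhammer_eval_add (2 * p.1) p.2 ν
    have h2 := ascPochhammer_eval_add n p.1 ν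
    push_cast at h1
    rw [← h1, ← h2]
    congr 2
    omega
  calc _ = ((ascPochhammer ℝ (2 * p.1)).eval ν * (ascPochhammer ℝ p.2).eval (ν + 2 * p.1)) *
        ((-1) ^ p.2 / ((ascPochhammer ℝ p.1).eval c * p.1.factorial * p.2.factorial)) := by
        field_simp
    _ = _ := by rw [e]; ring

/-- The binomial series, with coefficients written as Pochhammer symbols. -/
theorem hasSum_ascPochhammer_div_factorial (a : ℝ) {x : ℝ} (hx : |x| < 1) :
    HasSum (fun n : ℕ => (ascPochhammer ℝ n).eval a / n.factorial * x ^ n) ((1 - x) ^ (-a)) := by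
  have h := (one_div_one_sub_rpow_hasFPowerSeriesOnBall_zero a).hasSum
    (y := x) (by simpa [enorm_eq_nnnorm, ← NNReal.coe_lt_one] using hx)
  have hx' : 0 ≤ 1 - x := by linarith [le_abs_self x]
  rw [zero_add, one_div, ← rpow_neg hx'] at h
  convert! h using 2 with n
  have hm := Ring.factorial_nsmul_multichoose_eq_ascPochhammer a n
  rw [ascPochhammer_smeval_eq_eval, nsmul_eq_mul] at hm
  rw [FormalMultilinearSeries.ofScalars_apply_eq, smul_eq_mul, Ring.choose, ← hm,
    show a + n - 1 - n + 1 = a by ring, mul_div_cancel_left₀ _ (by positivity)]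

/-- The ratio test for a power series given by the ratios of its coefficients. -/
theorem summable_abs_of_ratio_tendsto {f ρ : ℕ → ℝ} {L x : ℝ}
    (hf : ∀ n, f (n + 1) = ρ n * f n) (hρ : Tendsto ρ atTop (nhds L)) (hx : |L * x| < 1) :
    Summable fun n => |f n * x ^ n| := by
  obtain ⟨s, hs, hs1⟩ := exists_between hx
  refine summable_of_ratio_norm_eventually_le hs1 ?_
  filter_upwards [(hρ.mul_const x).abs.eventually_le_const hs] with n hn
  rw [norm_abs_eq_norm, norm_abs_eq_norm, norm_eq_abs, norm_eq_abs, hf,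
    show ρ n * f n * x ^ (n + 1) = (ρ n * x) * (f n * x ^ n) by ring, abs_mul]
  gcongr

theorem tendsto_mul_add_div_mul_add (a b c d : ℝ) (hc : c ≠ 0) :
    Tendsto (fun n : ℕ => (a * n + b) / (c * n + d)) atTop (nhds (a / c)) := by
  simpa [add_comm] using tendsto_add_mul_div_add_mul_atTop_nhds b d a hc

/-- A real power series converging on `(-R, R)` is analytic there. -/
theorem analyticAt_tsum_mul_pow {f : ℕ → ℝ} {R : ℝ}
    (hf : ∀ x, |x| < R → Summable fun n => |f n * x ^ n|) {x : ℝ} (hx : |x| < R) :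
    AnalyticAt ℝ (fun x => ∑' n, f n * x ^ n) x := by
  obtain ⟨s, hs, hs1⟩ := exists_between hx
  have hs0 : 0 ≤ s := (abs_nonneg x).trans hs.le
  lift s to NNReal using hs0
  have hr := (FormalMultilinearSeries.ofScalars ℝ f).le_radius_of_summable (r := s) (by
    simpa [FormalMultilinearSeries.ofScalars_norm, abs_mul] using
      hf s (by simpa using hs1))
  have hpos : 0 < (FormalMultilinearSeries.ofScalars ℝ f).radius := by
    refine lt_of_lt_of_le ?_ hr
    exact_mod_cast (abs_nonneg x).trans_lt hs
  have hb := (FormalMultilinearSeries.ofScalars ℝ f).hasFPowerSeriesOnBall hpos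
  have hx' : x ∈ Metric.eball (0 : ℝ) (FormalMultilinearSeries.ofScalars ℝ f).radius := by
    refine Metric.eball_subset_eball hr ?_
    simpa [enorm_eq_nnnorm, ← NNReal.coe_lt_coe] using hs
  refine (hb.analyticAt_of_mem hx').congr (Eventually.of_forall fun y => ?_)
  simp only [FormalMultilinearSeries.sum, FormalMultilinearSeries.ofScalars_apply_eq, smul_eq_mul]

theorem integral_sin_pow_eq_Gamma (e : ℕ) :
    ∫ φ in (0 : ℝ)..π, sin φ ^ e =
      Gamma (((e + 1 : ℕ) : ℝ) / 2) * Gamma (1 / 2) / Gamma (((e + 1 : ℕ) : ℝ) / 2 + 1 / 2) := by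
  induction e using Nat.twoStepInduction with
  | zero =>
    norm_num [Real.Gamma_one_half_eq, Real.mul_self_sqrt pi_pos.le]
  | one =>
    have h : Gamma (3 / 2) = 1 / 2 * Gamma (1 / 2) := by
      rw [← Real.Gamma_add_one (by norm_num)]; norm_num
    have h0 : Gamma (1 / 2) ≠ 0 := (Real.Gamma_pos_of_pos (by norm_num)).ne'
    have e1 : ((1 + 1 : ℕ) : ℝ) / 2 = 1 := by norm_num
    rw [e1, show (1 : ℝ) + 1 / 2 = 3 / 2 by norm_num, h, Real.Gamma_one]
    simp only [pow_one, integral_sin, cos_zero, cos_pi]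
    field_simp
    norm_num
  | more n ih _ =>
    rw [integral_sin_pow, ih]
    have e1 : ((n + 2 + 1 : ℕ) : ℝ) / 2 = ((n + 1 : ℕ) : ℝ) / 2 + 1 := by push_cast; ring
    rw [e1, add_right_comm, Real.Gamma_add_one (by positivity), Real.Gamma_add_one (by positivity)]
    have h0 : Gamma (((n + 1 : ℕ) : ℝ) / 2 + 1 / 2) ≠ 0 :=
      (Real.Gamma_pos_of_pos (by positivity)).ne'
    have h1 : (n : ℝ) + 1 + 1 ≠ 0 := by positivity
    have h2 : (n : ℝ) + 2 ≠ 0 := by positivity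
    simp only [sin_zero, sin_pi]
    push_cast at h0 ⊢
    field_simp
    ring

theorem integral_sin_pow_mul_cos_pow_add_two (e m : ℕ) :
    ∫ φ in (0 : ℝ)..π, sin φ ^ e * cos φ ^ (m + 2) =
      (m + 1) / (m + e + 2) * ∫ φ in (0 : ℝ)..π, sin φ ^ e * cos φ ^ m := by
  have hd : ∀ φ ∈ uIcc 0 π, HasDerivAt (fun φ => sin φ ^ (e + 1) * cos φ ^ (m + 1))
      ((m + e + 2) * (sin φ ^ e * cos φ ^ (m + 2)) - (m + 1) * (sin φ ^ e * cos φ ^ m)) φ := by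
    intro φ _
    convert! ((hasDerivAt_sin φ).pow (e + 1)).mul ((hasDerivAt_cos φ).pow (m + 1)) using 1
    simp only [Pi.pow_apply, add_tsub_cancel_right]
    push_cast
    have : sin φ ^ (e + 1) * sin φ = sin φ ^ e * (1 - cos φ ^ 2) := by
      rw [← sin_sq]; ring
    linear_combination (m + 1) * cos φ ^ m * this
  have h := intervalIntegral.integral_eq_sub_of_hasDerivAt hd
    (Continuous.intervalIntegrable (by fun_prop) _ _)
  rw [intervalIntegral.integral_sub (Continuous.intervalIntegrable (by fun_prop) _ _)
    (Continuous.intervalIntegrable (by fun_prop) _ _), intervalIntegral.integral_const_mul,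
    intervalIntegral.integral_const_mul] at h
  simp only [sin_pi, sin_zero, ne_eq, Nat.succ_ne_zero, not_false_eq_true, zero_pow, zero_mul,
    sub_self] at h
  have : (m : ℝ) + e + 2 ≠ 0 := by positivity
  field_simp
  linarith

theorem integral_sin_pow_mul_cos_pow_two_mul (e k : ℕ) :
    (∫ φ in (0 : ℝ)..π, sin φ ^ e * cos φ ^ (2 * k)) / ((2 * k).factorial : ℝ) =
      (∫ φ in (0 : ℝ)..π, sin φ ^ e) /
        (4 ^ k * (k.factorial * (ascPochhammer ℝ k).eval (((e + 2 : ℕ) : ℝ) / 2))) := by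
  induction k with
  | zero => simp
  | succ k ih =>
    have h1 := (ascPochhammer_pos k (((e + 2 : ℕ) : ℝ) / 2) (by positivity)).ne'
    rw [show 2 * (k + 1) = 2 * k + 2 by ring, integral_sin_pow_mul_cos_pow_add_two,
      ascPochhammer_succ_eval, Nat.factorial_succ, Nat.factorial_succ, Nat.factorial_succ]
    rw [div_eq_iff (by positivity)] at ih
    rw [ih]
    push_cast at h1 ⊢
    have h2 : 2 * (k : ℝ) + e + 2 ≠ 0 := by positivity
    have h3 : ((e : ℝ) + 2) / 2 + k ≠ 0 := by positivity
    field_simp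
    ring

theorem integral_sin_pow_mul_cos_pow_odd_eq_zero (e k : ℕ) :
    ∫ φ in (0 : ℝ)..π, sin φ ^ e * cos φ ^ (2 * k + 1) = 0 := by
  have h := intervalIntegral.integral_comp_sub_left (a := 0) (b := π)
    (fun φ => sin φ ^ e * cos φ ^ (2 * k + 1)) π
  simp only [sin_pi_sub, cos_pi_sub, sub_self, sub_zero, (odd_two_mul_add_one k).neg_pow,
    mul_neg, intervalIntegral.integral_neg] at h
  linarith

/-- Coefficients of the series in `w = x / (1 + x) ^ 2` obtained by expanding the integrand in
powers of `cos φ`. -/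
noncomputable def evenCoeff (ν c : ℝ) (k : ℕ) : ℝ :=
  (ascPochhammer ℝ (2 * k)).eval ν / (k.factorial * (ascPochhammer ℝ k).eval c)

theorem hasSum_integral_sin_pow_mul_one_add_mul_cos (e : ℕ) (ν : ℝ) {y : ℝ} (hy : |y| < 1) :
    HasSum (fun k => evenCoeff ν (((e + 2 : ℕ) : ℝ) / 2) k * (y ^ 2 / 4) ^ k *
        ∫ φ in (0 : ℝ)..π, sin φ ^ e)
      (∫ φ in (0 : ℝ)..π, sin φ ^ e * (1 + y * cos φ) ^ (-ν)) := by
  have hb : ∀ φ : ℝ, |-(y * cos φ)| ≤ |y| := fun φ => by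
    rw [abs_neg, abs_mul]
    exact mul_le_of_le_one_right (abs_nonneg y) (abs_cos_le_one φ)
  have hs : HasSum (fun n : ℕ => ∫ φ in (0 : ℝ)..π, sin φ ^ e *
        ((ascPochhammer ℝ n).eval ν / n.factorial * (-(y * cos φ)) ^ n))
      (∫ φ in (0 : ℝ)..π, sin φ ^ e * (1 + y * cos φ) ^ (-ν)) := by
    refine intervalIntegral.hasSum_integral_of_dominated_convergence
      (fun n _ => |(ascPochhammer ℝ n).eval ν / n.factorial * |y| ^ n|)
      (fun n => (Continuous.aestronglyMeasurable (by fun_prop)))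
      (fun n => .of_forall fun φ _ => ?_) (.of_forall fun φ _ => ?_) ?_
      (.of_forall fun φ _ => ?_)
    · rw [norm_eq_abs, abs_mul, abs_mul, abs_mul, abs_pow, abs_pow, abs_pow, abs_abs]
      refine (mul_le_of_le_one_left (by positivity)
        (pow_le_one₀ (abs_nonneg _) (abs_sin_le_one φ))).trans ?_
      have := hb φ
      gcongr
    · exact (hasSum_ascPochhammer_div_factorial ν (by rwa [abs_abs])).summable.abs
    · exact intervalIntegrable_const
    · have := (hasSum_ascPochhammer_div_factorial ν ((hb φ).trans_lt hy)).mul_left (sin φ ^ e)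
      rwa [sub_neg_eq_add] at this
  have hinj : Function.Injective fun k : ℕ => 2 * k := fun a b h => by simpa using h
  rw [← hinj.hasSum_iff] at hs
  · convert hs using 1
    ext k
    have h := integral_sin_pow_mul_cos_pow_two_mul e k
    have h1 := (ascPochhammer_pos k (((e + 2 : ℕ) : ℝ) / 2) (by positivity)).ne'
    have h2 : ∀ φ : ℝ, sin φ ^ e * ((ascPochhammer ℝ (2 * k)).eval ν / (2 * k).factorial *
        (-(y * cos φ)) ^ (2 * k)) = ((ascPochhammer ℝ (2 * k)).eval ν / (2 * k).factorial *
        y ^ (2 * k)) * (sin φ ^ e * cos φ ^ (2 * k)) := fun φ => by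
      rw [(even_two_mul k).neg_pow]; ring
    simp only [Function.comp_apply, h2, intervalIntegral.integral_const_mul]
    calc _ = (ascPochhammer ℝ (2 * k)).eval ν * y ^ (2 * k) * ((∫ φ in (0 : ℝ)..π, sin φ ^ e) /
        (4 ^ k * (k.factorial * (ascPochhammer ℝ k).eval (((e + 2 : ℕ) : ℝ) / 2)))) := by
          rw [evenCoeff, div_pow, pow_mul]; field_simp
      _ = _ := by rw [← h]; ring
  · intro n hn
    obtain ⟨k, rfl⟩ : Odd n := by
      rw [← Nat.not_even_iff_odd]
      rintro ⟨k, rfl⟩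
      exact hn ⟨k, by ring⟩
    have h2 : ∀ φ : ℝ, sin φ ^ e * ((ascPochhammer ℝ (2 * k + 1)).eval ν / (2 * k + 1).factorial *
        (-(y * cos φ)) ^ (2 * k + 1)) = ((ascPochhammer ℝ (2 * k + 1)).eval ν /
        (2 * k + 1).factorial * -(y ^ (2 * k + 1))) * (sin φ ^ e * cos φ ^ (2 * k + 1)) :=
      fun φ => by rw [(odd_two_mul_add_one k).neg_pow]; ring
    simp only [h2, intervalIntegral.integral_const_mul,
      integral_sin_pow_mul_cos_pow_odd_eq_zero, mul_zero]

/-- Coefficients of `₂F₁(ν, ν - c + 1; c; ·)`. -/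
noncomputable def hypCoeff (ν c : ℝ) (n : ℕ) : ℝ :=
  (ascPochhammer ℝ n).eval ν * (ascPochhammer ℝ n).eval (ν - c + 1) /
    ((ascPochhammer ℝ n).eval c * n.factorial)

theorem summable_abs_hypCoeff (ν : ℝ) {c x : ℝ} (hc : 0 < c) (hx : |x| < 1) :
    Summable fun n => |hypCoeff ν c n * x ^ n| := by
  refine summable_abs_of_ratio_tendsto
    (ρ := fun n : ℕ => ((1 * n + ν) / (1 * n + c)) * ((1 * n + (ν - c + 1)) / (1 * n + 1)))
    (L := 1 / 1 * (1 / 1)) (fun n => ?_)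
    ((tendsto_mul_add_div_mul_add _ _ _ _ one_ne_zero).mul
      (tendsto_mul_add_div_mul_add _ _ _ _ one_ne_zero)) (by simpa using hx)
  have h1 := (ascPochhammer_pos n c hc).ne'
  have h2 : (n : ℝ) + c ≠ 0 := by positivity
  have h3 : c + (n : ℝ) ≠ 0 := by positivity
  simp only [hypCoeff, ascPochhammer_succ_eval, Nat.factorial_succ]
  push_cast
  field_simp
  ring

theorem summable_abs_evenCoeff (ν : ℝ) {c x : ℝ} (hc : 0 < c) (hx : |x| < 1 / 4) :
    Summable fun n => |evenCoeff ν c n * x ^ n| := by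
  refine summable_abs_of_ratio_tendsto
    (ρ := fun n : ℕ => ((2 * n + ν) / (1 * n + c)) * ((2 * n + (ν + 1)) / (1 * n + 1)))
    (L := 2 / 1 * (2 / 1)) (fun n => ?_)
    ((tendsto_mul_add_div_mul_add _ _ _ _ one_ne_zero).mul
      (tendsto_mul_add_div_mul_add _ _ _ _ one_ne_zero)) ?_
  · have h1 := (ascPochhammer_pos n c hc).ne'
    have h2 : (n : ℝ) + c ≠ 0 := by positivity
    have h3 : c + (n : ℝ) ≠ 0 := by positivity
    rw [evenCoeff, show 2 * (n + 1) = 2 * n + 1 + 1 by ring]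
    simp only [evenCoeff, ascPochhammer_succ_eval, Nat.factorial_succ]
    push_cast
    field_simp
    ring
  · rw [abs_mul]
    norm_num
    linarith

theorem evenCoeff_nonneg {ν c : ℝ} (hν : 0 < ν) (hc : 0 < c) (k : ℕ) : 0 ≤ evenCoeff ν c k := by
  have h1 := ascPochhammer_pos k c hc
  have h2 := ascPochhammer_pos (2 * k) ν hν
  rw [evenCoeff]
  positivity

theorem rpow_neg_add_two_mul {u : ℝ} (hu : 0 < u) (ν : ℝ) (k : ℕ) :
    u ^ (-(ν + 2 * k)) = u ^ (-ν) * (1 / u ^ 2) ^ k := by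
  rw [neg_add, rpow_add hu, rpow_neg hu.le (2 * k)]
  norm_cast
  rw [pow_mul, one_div, inv_pow]

/-- Regrouping the double series in powers of `x` near the origin. -/
theorem quadratic_transformation_of_lt {ν c x : ℝ} (hν : 0 < ν) (hc : 0 < c) (hx0 : 0 < x)
    (hx1 : x < 1 / 10) :
    (1 + x) ^ (-ν) * ∑' k, evenCoeff ν c k * (x / (1 + x) ^ 2) ^ k =
      ∑' n, hypCoeff ν c n * x ^ n := by
  set F : ℕ × ℕ → ℝ := fun p => evenCoeff ν c p.1 * x ^ p.1 *
    ((ascPochhammer ℝ p.2).eval (ν + 2 * p.1) / p.2.factorial * (-x) ^ p.2) with hF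
  have hpos : ∀ k m : ℕ, 0 < (ascPochhammer ℝ m).eval (ν + 2 * k) := fun k m =>
    ascPochhammer_pos _ _ (by positivity)
  have hnorm : ∀ p, |F p| = evenCoeff ν c p.1 * x ^ p.1 *
      ((ascPochhammer ℝ p.2).eval (ν + 2 * p.1) / p.2.factorial * x ^ p.2) := fun p => by
    rw [hF]
    simp only [abs_mul, abs_pow, abs_neg, abs_div, abs_of_pos hx0, abs_of_pos (hpos _ _),
      abs_of_nonneg (evenCoeff_nonneg hν hc _), Nat.abs_cast]
  have hxabs : |x| < 1 := by rw [abs_of_pos hx0]; linarith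
  have hrow' : ∀ k : ℕ, HasSum (fun m => |F (k, m)|)
      ((1 - x) ^ (-ν) * (evenCoeff ν c k * (x / (1 - x) ^ 2) ^ k)) := fun k => by
    simp only [hnorm]
    convert! (hasSum_ascPochhammer_div_factorial (ν + 2 * k) hxabs).mul_left
      (evenCoeff ν c k * x ^ k) using 1
    rw [rpow_neg_add_two_mul (by linarith), div_eq_mul_one_div x, mul_pow]
    ring
  have hrow : ∀ k : ℕ, HasSum (fun m => F (k, m))
      ((1 + x) ^ (-ν) * (evenCoeff ν c k * (x / (1 + x) ^ 2) ^ k)) := fun k => by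
    convert! (hasSum_ascPochhammer_div_factorial (ν + 2 * k) (x := -x) (by rwa [abs_neg])).mul_left
      (evenCoeff ν c k * x ^ k) using 1
    rw [sub_neg_eq_add, rpow_neg_add_two_mul (by linarith), div_eq_mul_one_div x, mul_pow]
    ring
  have hsum : Summable F := by
    refine Summable.of_abs ((summable_prod_of_nonneg fun p => abs_nonneg _).mpr
      ⟨fun k => (hrow' k).summable, ?_⟩)
    simp only [(hrow' _).tsum_eq]
    refine (summable_abs_evenCoeff ν hc ?_).of_abs.mul_left _
    have : 0 < 1 - x := by linarith
    rw [abs_of_pos (by positivity), div_lt_iff₀ (by positivity)]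
    nlinarith
  have hdiag := ((Finset.HasAntidiagonal.sigmaAntidiagonalEquivProd.hasSum_iff.mpr
    hsum.hasSum).sigma fun n => hasSum_fintype _).tsum_eq
  rw [← tsum_mul_left, (hsum.hasSum.prod_fiberwise hrow).tsum_eq, ← hdiag]
  refine tsum_congr fun n => ?_
  rw [hypCoeff, ← sum_antidiagonal_ascPochhammer_two_mul n ν c hc, Finset.sum_mul]
  refine Eq.trans ?_ (Finset.sum_coe_sort (Finset.HasAntidiagonal.antidiagonal n) _)
  refine Fintype.sum_congr _ _ fun p => ?_
  have hp : p.1.1 + p.1.2 = n := Finset.HasAntidiagonal.mem_antidiagonal.mp p.2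
  rw [Function.comp_apply, Finset.HasAntidiagonal.sigmaAntidiagonalEquivProd_apply, hF]
  simp only [neg_pow x, ← hp, pow_add, evenCoeff]
  ring

/-- A quadratic transformation of `₂F₁` on the whole unit interval. -/
theorem quadratic_transformation {ν c x : ℝ} (hν : 0 < ν) (hc : 0 < c) (hx : x ∈ Ioo (0 : ℝ) 1) :
    (1 + x) ^ (-ν) * ∑' k, evenCoeff ν c k * (x / (1 + x) ^ 2) ^ k =
      ∑' n, hypCoeff ν c n * x ^ n := by
  have hL : AnalyticOnNhd ℝ (fun x : ℝ => (1 + x) ^ (-ν) *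
      ∑' k, evenCoeff ν c k * (x / (1 + x) ^ 2) ^ k) (Ioo 0 1) := by
    intro y hy
    have hy1 : 0 < 1 + y := by linarith [hy.1]
    have hw : |y / (1 + y) ^ 2| < 1 / 4 := by
      rw [abs_of_pos (div_pos hy.1 (by positivity)), div_lt_iff₀ (by positivity)]
      nlinarith [mul_pos (sub_pos.2 hy.2) (sub_pos.2 hy.2)]
    have h1 : AnalyticAt ℝ (fun x : ℝ => 1 + x) y := by fun_prop
    have h2 : AnalyticAt ℝ (fun x : ℝ => x / (1 + x) ^ 2) y :=
      analyticAt_id.div (h1.pow 2) (by positivity)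
    have h3 : AnalyticAt ℝ (fun x : ℝ => (1 + x) ^ (-ν)) y :=
      (((h1.log hy1).mul analyticAt_const).rexp).congr <| by
        filter_upwards [Ioo_mem_nhds hy.1 hy.2] with z hz
        exact (rpow_def_of_pos (by linarith [hz.1]) _).symm
    exact h3.mul ((analyticAt_tsum_mul_pow
      (fun w hw => summable_abs_evenCoeff ν hc hw) hw).comp_of_eq h2 rfl)
  have hR : AnalyticOnNhd ℝ (fun x : ℝ => ∑' n, hypCoeff ν c n * x ^ n) (Ioo 0 1) := fun y hy =>
    analyticAt_tsum_mul_pow (fun w hw => summable_abs_hypCoeff ν hc hw)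
      (by rw [abs_of_pos hy.1]; exact hy.2)
  refine hL.eqOn_of_preconnected_of_eventuallyEq hR isPreconnected_Ioo
    (z₀ := 1 / 20) (by norm_num) ?_ hx
  filter_upwards [Ioo_mem_nhds (a := (0 : ℝ)) (b := 1 / 10) (x := 1 / 20)
    (by norm_num) (by norm_num)] with y hy
  exact quadratic_transformation_of_lt hν hc hy.1 hy.2

/-- Gradshteyn–Ryzhik 3.665(2): for `0 < a < r` and `ν > 0`,
`∫₀^π (sin φ)^{d−2} (a² + 2ar cos φ + r²)^{−ν} dφ
   = r^{−2ν} B((d−1)/2, 1/2) ₂F₁(ν, ν − d/2 + 1; d/2; a²/r²)`,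
where the hypergeometric series (written with ascending Pochhammer symbols)
converges absolutely since `a/r < 1`. -/
theorem stmt19 (d : ℕ) (hd : 2 ≤ d) (ν : ℝ) (hν : 0 < ν) (a r : ℝ) (ha : 0 < a) (har : a < r) :
    (Summable fun n : ℕ =>
      |((ascPochhammer ℝ n).eval ν * (ascPochhammer ℝ n).eval (ν - (d : ℝ) / 2 + 1) /
          ((ascPochhammer ℝ n).eval ((d : ℝ) / 2) * (n.factorial : ℝ))) * (a / r) ^ (2 * n)|) ∧
    ∫ φ in (0 : ℝ)..π, (Real.sin φ) ^ (d - 2) *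
        (a ^ 2 + 2 * a * r * Real.cos φ + r ^ 2) ^ (-ν)
      = r ^ (-2 * ν) *
          (Real.Gamma (((d : ℝ) - 1) / 2) * Real.Gamma (1 / 2) /
            Real.Gamma (((d : ℝ) - 1) / 2 + 1 / 2)) *
          ∑' n : ℕ,
            ((ascPochhammer ℝ n).eval ν * (ascPochhammer ℝ n).eval (ν - (d : ℝ) / 2 + 1) /
                ((ascPochhammer ℝ n).eval ((d : ℝ) / 2) * (n.factorial : ℝ))) *
              (a / r) ^ (2 * n) := by
  obtain ⟨e, rfl⟩ : ∃ e, d = e + 2 := ⟨d - 2, by omega⟩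
  have hr : 0 < r := ha.trans har
  set c : ℝ := ((e + 2 : ℕ) : ℝ) / 2 with hc_def
  have hc : 0 < c := by positivity
  set t := a / r with ht
  have ht0 : 0 < t := div_pos ha hr
  have ht1 : t < 1 := (div_lt_one hr).2 har
  have hx : t ^ 2 ∈ Ioo (0 : ℝ) 1 := ⟨by positivity, by nlinarith⟩
  have hat : a = t * r := by rw [ht]; field_simp
  simp only [pow_mul]
  refine ⟨summable_abs_hypCoeff ν hc (by rw [abs_of_pos hx.1]; exact hx.2), ?_⟩
  change _ = _ * ∑' n, hypCoeff ν c n * (t ^ 2) ^ n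
  rw [← quadratic_transformation hν hc hx]
  set y := 2 * t / (1 + t ^ 2) with hy_def
  have hy1 : |y| < 1 := by
    rw [abs_of_pos (by positivity), div_lt_one (by positivity)]
    nlinarith [mul_pos (sub_pos.2 ht1) (sub_pos.2 ht1)]
  have hy2 : y ^ 2 / 4 = t ^ 2 / (1 + t ^ 2) ^ 2 := by
    rw [hy_def]; field_simp; ring
  have hI := (hasSum_integral_sin_pow_mul_one_add_mul_cos e ν hy1).tsum_eq
  rw [tsum_mul_right, hy2] at hI
  have hint : ∀ φ : ℝ, sin φ ^ e * (a ^ 2 + 2 * a * r * cos φ + r ^ 2) ^ (-ν) =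
      r ^ (-2 * ν) * (1 + t ^ 2) ^ (-ν) * (sin φ ^ e * (1 + y * cos φ) ^ (-ν)) := fun φ => by
    have h0 : 0 ≤ 1 + y * cos φ := by
      have : |y * cos φ| ≤ 1 := by
        rw [abs_mul]; exact mul_le_one₀ hy1.le (abs_nonneg _) (abs_cos_le_one φ)
      linarith [neg_abs_le (y * cos φ)]
    have h1 : a ^ 2 + 2 * a * r * cos φ + r ^ 2 = r ^ 2 * (1 + t ^ 2) * (1 + y * cos φ) := by
      rw [hat, hy_def]; field_simp; ring
    rw [h1, mul_rpow (by positivity) h0, mul_rpow (by positivity) (by positivity),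
      ← rpow_natCast r 2, ← rpow_mul hr.le]
    push_cast
    rw [mul_neg, neg_mul]
    ring
  have hB : ((e + 2 : ℕ) : ℝ) - 1 = ((e + 1 : ℕ) : ℝ) := by push_cast; ring
  rw [add_tsub_cancel_right, hB, ← integral_sin_pow_eq_Gamma]
  simp only [hint, intervalIntegral.integral_const_mul]
  rw [← hI]
  ring
end
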